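/- arXiv:math/0407291 — 9 statements merged into one kernel-verified Lean document; each statement's English description precedes it below -/
import Mathlib

section
/- (Anticommutativity, type A; part of Proposition 3.2.) For all i ≠ j in {1,…,n}, θ_i θ_j + θ_j θ_i = 0. -/
/-- Anticommutativity of the flat connections `θ_i` in `Λ_quad(A_{n-1})`
(part of Proposition 3.2 of Kirillov–Maeno). -/
theorem theta_anticomm_typeA (n : ℕ) (hn : 1 ≤ n) (R : Type*) [Ring R]
    (e : Fin n → Fin n → R)
    (hsymm : ∀ a b : Fin n, a ≠ b → e a b = e b a)
    (hsq : ∀ a b : Fin n, a ≠ b → e a b * e a b = 0)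
    (hdisj : ∀ a b c d : Fin n, a ≠ b → c ≠ d → a ≠ c → a ≠ d → b ≠ c → b ≠ d →
      e a b * e c d + e c d * e a b = 0)
    (htri : ∀ a b c : Fin n, a ≠ b → b ≠ c → c ≠ a →
      e a b * e b c + e b c * e c a + e c a * e a b = 0)
    (θ : Fin n → R)
    (hθ : ∀ i : Fin n, θ i = ∑ j ∈ Finset.univ.filter (fun j => j ≠ i), e i j) :
    ∀ i j : Fin n, i ≠ j → θ i * θ j + θ j * θ i = 0 := by
  intro i j hij
  set S : Finset (Fin n) := Finset.univ.filter (fun k => k ≠ i ∧ k ≠ j) with hS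
  have mem {k : Fin n} (hk : k ∈ S) : k ≠ i ∧ k ≠ j := by simpa [hS] using hk
  have split_i : θ i = e i j + ∑ k ∈ S, e i k := by
    rw [hθ, ← Finset.sum_insert (by simp [hS])]
    congr 1
    ext k
    by_cases hk : k = j <;> simp [hS, hk, hij.symm]
  have split_j : θ j = e i j + ∑ k ∈ S, e j k := by
    rw [hθ, hsymm i j hij, ← Finset.sum_insert (by simp [hS])]
    congr 1
    ext k
    by_cases hk : k = i <;> simp [hS, hk, hij]
  have off_diagonal : (∑ k ∈ S, e i k) * (∑ k ∈ S, e j k) + (∑ k ∈ S, e j k) * (∑ k ∈ S, e i k)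
      = ∑ k ∈ S, (e i k * e j k + e j k * e i k) := by
    rw [Finset.sum_mul_sum, Finset.sum_mul_sum, Finset.sum_comm (s := S) (t := S)
      (f := fun k l => e j k * e i l), ← Finset.sum_add_distrib]
    refine Finset.sum_congr rfl fun k hk => ?_
    rw [← Finset.sum_add_distrib]
    refine Finset.sum_eq_single_of_mem k hk fun l hl hlk => ?_
    exact hdisj i k j l (mem hk).1.symm (mem hl).2.symm hij (mem hl).1.symm (mem hk).2 hlk.symm
  have triangles : ∑ k ∈ S, (e i j * e j k + e i k * e i j + (e i j * e i k + e j k * e i j)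
      + (e i k * e j k + e j k * e i k)) = 0 := by
    refine Finset.sum_eq_zero fun k hk => ?_
    obtain ⟨hki, hkj⟩ := mem hk
    have h₁ := htri i j k hij hkj.symm hki
    have h₂ := htri j i k hij.symm hki.symm hkj
    rw [hsymm k i hki] at h₁
    rw [hsymm j i hij.symm, hsymm k j hkj] at h₂
    rw [← add_zero (0 : R)]
    nth_rewrite 1 [← h₁]
    rw [← h₂]
    abel
  simp only [Finset.sum_add_distrib, ← Finset.mul_sum, ← Finset.sum_mul] at triangles off_diagonal
  rw [← off_diagonal] at triangles
  rw [split_i, split_j, ← triangles]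
  simp only [add_mul, mul_add, hsq i j hij]
  abel
end

section
/- (Anticommutativity, type B; part of Proposition 3.2.) For all i ≠ j in {1,…,n}, θ_i θ_j + θ_j θ_i = 0. -/
/-- If `a k` and `b l` anticommute for `k ≠ l`, then the anticommutator of `∑ a` and `∑ b`
reduces to its diagonal part. -/
lemma sum_mul_sum_add_sum_mul_sum_of_anticomm {ι R : Type*} [NonUnitalNonAssocRing R]
    (s : Finset ι) (a b : ι → R)
    (h : ∀ k ∈ s, ∀ l ∈ s, k ≠ l → a k * b l + b l * a k = 0) :
    (∑ k ∈ s, a k) * (∑ k ∈ s, b k) + (∑ k ∈ s, b k) * (∑ k ∈ s, a k)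
      = ∑ k ∈ s, (a k * b k + b k * a k) := by
  rw [Finset.sum_mul_sum, Finset.sum_mul_sum, Finset.sum_comm (f := fun i j => b i * a j),
    ← Finset.sum_add_distrib]
  refine Finset.sum_congr rfl fun k hk => ?_
  rw [← Finset.sum_add_distrib]
  exact Finset.sum_eq_single k (fun l hl hlk => h k hk l hl hlk.symm) (fun h => absurd hk h)

/-- The anticommutator of `∑ a` with an element anticommuting with every `a k` vanishes. -/
lemma sum_mul_add_mul_sum_of_anticomm {ι R : Type*} [NonUnitalNonAssocRing R]
    (s : Finset ι) (a : ι → R) (y : R) (h : ∀ k ∈ s, a k * y + y * a k = 0) :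
    (∑ k ∈ s, a k) * y + y * (∑ k ∈ s, a k) = 0 := by
  rw [Finset.sum_mul, Finset.mul_sum, ← Finset.sum_add_distrib]
  exact Finset.sum_eq_zero h

/-- Anticommutativity of the flat connections `θ_i` in `Λ_quad(B_n)`
(part of Proposition 3.2 of Kirillov–Maeno). `ebar i j` denotes `ē(i,j)` and
`f i` denotes the generator `e_{(i)}`. -/
theorem theta_anticomm_typeB (n : ℕ) (hn : 1 ≤ n) (R : Type*) [Ring R]
    (e ebar : Fin n → Fin n → R) (f : Fin n → R)
    (hsymm : ∀ i j : Fin n, i ≠ j → e i j = e j i)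
    (hsymmb : ∀ i j : Fin n, i ≠ j → ebar i j = ebar j i)
    (hsq : ∀ i j : Fin n, i ≠ j → e i j * e i j = 0)
    (hsqb : ∀ i j : Fin n, i ≠ j → ebar i j * ebar i j = 0)
    (hsqf : ∀ i : Fin n, f i * f i = 0)
    (hdisj : ∀ i j k l : Fin n, i ≠ j → k ≠ l → i ≠ k → i ≠ l → j ≠ k → j ≠ l →
      e i j * e k l + e k l * e i j = 0)
    (hdisjb : ∀ i j k l : Fin n, i ≠ j → k ≠ l → i ≠ k → i ≠ l → j ≠ k → j ≠ l →
      e i j * ebar k l + ebar k l * e i j = 0)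
    (hdisjbb : ∀ i j k l : Fin n, i ≠ j → k ≠ l → i ≠ k → i ≠ l → j ≠ k → j ≠ l →
      ebar i j * ebar k l + ebar k l * ebar i j = 0)
    (hf : ∀ i j : Fin n, i ≠ j → f i * f j + f j * f i = 0)
    (hmix : ∀ i j : Fin n, i ≠ j → e i j * ebar i j + ebar i j * e i j = 0)
    (hef : ∀ i j k : Fin n, i ≠ j → k ≠ i → k ≠ j →
      e i j * f k + f k * e i j = 0)
    (hebf : ∀ i j k : Fin n, i ≠ j → k ≠ i → k ≠ j →
      ebar i j * f k + f k * ebar i j = 0)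
    (htri : ∀ i j k : Fin n, i ≠ j → j ≠ k → k ≠ i →
      e i j * e j k + e j k * e k i + e k i * e i j = 0)
    (htrib : ∀ i j k : Fin n, i ≠ j → j ≠ k → k ≠ i →
      ebar i k * e i j + e j i * ebar j k + ebar k j * ebar i k = 0)
    (hB : ∀ i j : Fin n, i ≠ j →
      e i j * f i + f j * e i j + f i * ebar i j + ebar i j * f j = 0)
    (θ : Fin n → R)
    (hθ : ∀ i : Fin n,
      θ i = ∑ j ∈ Finset.univ.filter (fun j => j ≠ i), (e i j + ebar i j) + 2 * f i) :
    ∀ i j : Fin n, i ≠ j → θ i * θ j + θ j * θ i = 0 := by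
  intro i j hij
  set s : Finset (Fin n) := Finset.univ.filter (fun k => k ≠ i ∧ k ≠ j) with hs
  have mem_s : ∀ k, k ∈ s ↔ k ≠ i ∧ k ≠ j := fun k => by simp [hs]
  have hsi : Finset.univ.filter (fun k => k ≠ i) = insert j s := by
    ext k
    simp only [Finset.mem_filter, Finset.mem_univ, true_and, Finset.mem_insert, mem_s]
    grind
  have hsj : Finset.univ.filter (fun k => k ≠ j) = insert i s := by
    ext k
    simp only [Finset.mem_filter, Finset.mem_univ, true_and, Finset.mem_insert, mem_s]
    grind
  have hi : θ i = (e i j + ebar i j) + ∑ k ∈ s, (e i k + ebar i k) + 2 * f i := by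
    rw [hθ, hsi, Finset.sum_insert (by simp [mem_s])]
  have hj : θ j = (e i j + ebar i j) + ∑ k ∈ s, (e j k + ebar j k) + 2 * f j := by
    rw [hθ, hsj, Finset.sum_insert (by simp [mem_s]), hsymm j i hij.symm, hsymmb j i hij.symm]
  have hAB := sum_mul_sum_add_sum_mul_sum_of_anticomm s (fun k => e i k + ebar i k)
    (fun k => e j k + ebar j k) (by
      intro k hk l hl hkl
      rw [mem_s] at hk hl
      have h₁ := hdisj i k j l hk.1.symm hl.2.symm hij hl.1.symm hk.2 hkl
      have h₂ := hdisjb i k j l hk.1.symm hl.2.symm hij hl.1.symm hk.2 hkl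
      have h₃ := hdisjb j l i k hl.2.symm hk.1.symm hij.symm hk.2.symm hl.1 hkl.symm
      have h₄ := hdisjbb i k j l hk.1.symm hl.2.symm hij hl.1.symm hk.2 hkl
      linear_combination (norm := noncomm_ring) h₁ + h₂ + h₃ + h₄)
  have hAf := sum_mul_add_mul_sum_of_anticomm s (fun k => e i k + ebar i k) (f j) (by
    intro k hk
    rw [mem_s] at hk
    have h₁ := hef i k j hk.1.symm hij.symm hk.2.symm
    have h₂ := hebf i k j hk.1.symm hij.symm hk.2.symm
    linear_combination (norm := noncomm_ring) h₁ + h₂)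
  have hBf := sum_mul_add_mul_sum_of_anticomm s (fun k => e j k + ebar j k) (f i) (by
    intro k hk
    rw [mem_s] at hk
    have h₁ := hef j k i hk.2.symm hij hk.1.symm
    have h₂ := hebf j k i hk.2.symm hij hk.1.symm
    linear_combination (norm := noncomm_ring) h₁ + h₂)
  have hT : ∑ k ∈ s, (((e i j + ebar i j) * (e i k + ebar i k)
        + (e i k + ebar i k) * (e i j + ebar i j))
      + ((e i j + ebar i j) * (e j k + ebar j k) + (e j k + ebar j k) * (e i j + ebar i j))
      + ((e i k + ebar i k) * (e j k + ebar j k)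
        + (e j k + ebar j k) * (e i k + ebar i k))) = 0 := by
    refine Finset.sum_eq_zero fun k hk => ?_
    obtain ⟨hki, hkj⟩ := (mem_s k).1 hk
    have t₁ := htri i j k hij hkj.symm hki
    have t₂ := htri j i k hij.symm hki.symm hkj
    have b₁ := htrib i j k hij hkj.symm hki
    have b₂ := htrib j i k hij.symm hki.symm hkj
    have b₃ := htrib i k j hki.symm hkj hij.symm
    have b₄ := htrib k i j hki hij hkj.symm
    have b₅ := htrib j k i hkj.symm hki hij
    have b₆ := htrib k j i hkj hij.symm hki.symm
    simp only [hsymm j i hij.symm, hsymm k i hki, hsymm k j hkj, hsymmb j i hij.symm,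
      hsymmb k i hki, hsymmb k j hkj] at t₁ t₂ b₁ b₂ b₃ b₄ b₅ b₆
    linear_combination (norm := noncomm_ring) t₁ + t₂ + b₁ + b₂ + b₃ + b₄ + b₅ + b₆
  rw [Finset.sum_add_distrib, Finset.sum_add_distrib, ← hAB, Finset.sum_add_distrib,
    Finset.sum_add_distrib, ← Finset.mul_sum, ← Finset.sum_mul, ← Finset.mul_sum,
    ← Finset.sum_mul] at hT
  have hx : (e i j + ebar i j) * (e i j + ebar i j) = 0 := by
    linear_combination (norm := noncomm_ring) hsq i j hij + hsqb i j hij + hmix i j hij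
  have hxf : (e i j + ebar i j) * (f i + f j) + (f i + f j) * (e i j + ebar i j) = 0 := by
    have h₁ := hB i j hij
    have h₂ := hB j i hij.symm
    rw [hsymm j i hij.symm, hsymmb j i hij.symm] at h₂
    linear_combination (norm := noncomm_ring) h₁ + h₂
  have hff := hf i j hij
  rw [hi, hj]
  generalize ∑ k ∈ s, (e i k + ebar i k) = A at *
  generalize ∑ k ∈ s, (e j k + ebar j k) = B at *
  generalize e i j + ebar i j = x at *
  linear_combination (norm := noncomm_ring) 2 * hx + hT + 2 * hxf + 2 * hAf + 2 * hBf + 4 * hff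
end

section
/- (Anticommutativity, type D; part of Proposition 3.2.) For all i ≠ j in {1,…,n}, θ_i θ_j + θ_j θ_i = 0. -/
/-- If two families `x`, `y` anticommute off the diagonal, and the diagonal anticommutators
are compensated by those of `x k + y k` with a square-zero element `a`, then `a + ∑ x` and
`a + ∑ y` anticommute. -/
theorem anticomm_add_sum {ι R : Type*} [Ring R] (s : Finset ι) (a : R)
    (x y : ι → R) (ha : a * a = 0)
    (hoff : ∀ k ∈ s, ∀ l ∈ s, k ≠ l → x k * y l + y l * x k = 0)
    (hdiag : ∀ k ∈ s, a * y k + y k * a + (x k * a + a * x k) + (x k * y k + y k * x k) = 0) :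
    (a + ∑ k ∈ s, x k) * (a + ∑ k ∈ s, y k) + (a + ∑ k ∈ s, y k) * (a + ∑ k ∈ s, x k) = 0 := by
  have hprod : (∑ k ∈ s, x k) * (∑ l ∈ s, y l) + (∑ l ∈ s, y l) * (∑ k ∈ s, x k)
      = ∑ k ∈ s, (x k * y k + y k * x k) := by
    rw [Finset.sum_mul_sum, Finset.sum_mul_sum, Finset.sum_comm (f := fun l k => y l * x k),
      ← Finset.sum_add_distrib]
    refine Finset.sum_congr rfl fun k hk => ?_
    rw [← Finset.sum_add_distrib]
    exact Finset.sum_eq_single_of_mem k hk fun l hl hlk => hoff k hk l hl hlk.symm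
  have hsum := Finset.sum_eq_zero hdiag
  simp only [Finset.sum_add_distrib, ← Finset.mul_sum, ← Finset.sum_mul] at hsum hprod
  rw [← hprod] at hsum
  linear_combination (norm := noncomm_ring) hsum + ha + ha

/-- Anticommutativity of the flat connections `θ_i` in `Λ_quad(D_n)`
(part of Proposition 3.2 of Kirillov–Maeno). `ebar` denotes `ē`. -/
theorem theta_anticomm_typeD (n : ℕ) (hn : 1 ≤ n) (R : Type*) [Ring R]
    (e ebar : Fin n → Fin n → R)
    (hsymm : ∀ i j : Fin n, i ≠ j → e i j = e j i)
    (hsymmb : ∀ i j : Fin n, i ≠ j → ebar i j = ebar j i)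
    (hsq : ∀ i j : Fin n, i ≠ j → e i j * e i j = 0)
    (hsqb : ∀ i j : Fin n, i ≠ j → ebar i j * ebar i j = 0)
    (hdisj : ∀ i j k l : Fin n, i ≠ j → k ≠ l → i ≠ k → i ≠ l → j ≠ k → j ≠ l →
      e i j * e k l + e k l * e i j = 0)
    (hdisjb : ∀ i j k l : Fin n, i ≠ j → k ≠ l → i ≠ k → i ≠ l → j ≠ k → j ≠ l →
      e i j * ebar k l + ebar k l * e i j = 0)
    (hdisjbb : ∀ i j k l : Fin n, i ≠ j → k ≠ l → i ≠ k → i ≠ l → j ≠ k → j ≠ l →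
      ebar i j * ebar k l + ebar k l * ebar i j = 0)
    (hmix : ∀ i j : Fin n, i ≠ j → e i j * ebar i j + ebar i j * e i j = 0)
    (htri : ∀ i j k : Fin n, i ≠ j → j ≠ k → k ≠ i →
      e i j * e j k + e j k * e k i + e k i * e i j = 0)
    (htrib : ∀ i j k : Fin n, i ≠ j → j ≠ k → k ≠ i →
      ebar i k * e i j + e j i * ebar j k + ebar k j * ebar i k = 0)
    (θ : Fin n → R)
    (hθ : ∀ i : Fin n,
      θ i = ∑ j ∈ Finset.univ.filter (fun j => j ≠ i), (e i j + ebar i j)) :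
    ∀ i j : Fin n, i ≠ j → θ i * θ j + θ j * θ i = 0 := by
  intro i j hij
  have hθ_split : ∀ i j : Fin n, i ≠ j → θ i = (e i j + ebar i j) +
      ∑ k ∈ Finset.univ.filter (fun k => k ≠ i ∧ k ≠ j), (e i k + ebar i k) := by
    intro i j hij
    rw [hθ, ← Finset.add_sum_erase _ _ (by simpa using hij.symm : j ∈ _)]
    congr 2
    ext k
    simp [and_comm]
  rw [hθ_split i j hij, hθ_split j i hij.symm, ← hsymm i j hij, ← hsymmb i j hij]
  simp only [and_comm (a := _ ≠ j)]
  refine anticomm_add_sum _ _ _ _ ?_ ?_ ?_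
  · linear_combination (norm := noncomm_ring) hsq i j hij + hmix i j hij + hsqb i j hij
  · intro k hk l hl hkl
    simp only [Finset.mem_filter, Finset.mem_univ, true_and] at hk hl
    have hee := hdisj i k j l hk.1.symm hl.2.symm hij hl.1.symm hk.2 hkl
    have heb := hdisjb i k j l hk.1.symm hl.2.symm hij hl.1.symm hk.2 hkl
    have hbe := hdisjb j l i k hl.2.symm hk.1.symm hij.symm hk.2.symm hl.1 hkl.symm
    have hbb := hdisjbb i k j l hk.1.symm hl.2.symm hij hl.1.symm hk.2 hkl
    linear_combination (norm := noncomm_ring) hee + heb + hbe + hbb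
  · intro k hk
    simp only [Finset.mem_filter, Finset.mem_univ, true_and] at hk
    obtain ⟨hki, hkj⟩ := hk
    have tri₁ := htri i j k hij hkj.symm hki
    have tri₂ := htri j i k hij.symm hki.symm hkj
    have mix₁ := htrib i j k hij hkj.symm hki
    have mix₂ := htrib j i k hij.symm hki.symm hkj
    have mix₃ := htrib i k j hki.symm hkj hij.symm
    have mix₄ := htrib k i j hki hij hkj.symm
    have mix₅ := htrib j k i hkj.symm hki hij
    have mix₆ := htrib k j i hkj hij.symm hki.symm
    simp only [hsymm j i hij.symm, hsymm k i hki, hsymm k j hkj, hsymmb j i hij.symm,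
      hsymmb k i hki, hsymmb k j hkj] at tri₁ tri₂ mix₁ mix₂ mix₃ mix₄ mix₅ mix₆
    linear_combination (norm := noncomm_ring)
      tri₁ + tri₂ + mix₁ + mix₂ + mix₃ + mix₄ + mix₅ + mix₆
end

section
/- (Flatness, type A; part of Proposition 3.2.) Let θ = Σ_{1≤a<b≤n} e(a,b). Then for every i ∈ {1,…,n}, θ θ_i + θ_i θ = θ_i². Equivalently, defining dη := θη + ηθ for 1-forms η and the covariant curvature F(η) := dη + η², the connection −θ_i is flat: F(−θ_i) = 0. -/
/-- Flatness of the connections `-θ_i` in `Λ_quad(A_{n-1})`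
(part of Proposition 3.2 of Kirillov–Maeno): with `θ = Σ_{a<b} e(a,b)`,
one has `θθ_i + θ_iθ = θ_i²`, i.e. `F(-θ_i) = d(-θ_i) + (-θ_i)² = 0`
where `dη = θη + ηθ`. -/
theorem theta_flat_typeA (n : ℕ) (hn : 1 ≤ n)
    (K : Type*) [Field K] [CharZero K] (R : Type*) [Ring R] [Algebra K R]
    (e : Fin n → Fin n → R)
    (hsymm : ∀ a b : Fin n, a ≠ b → e a b = e b a)
    (hsq : ∀ a b : Fin n, a ≠ b → e a b * e a b = 0)
    (hdisj : ∀ a b c d : Fin n, a ≠ b → c ≠ d → a ≠ c → a ≠ d → b ≠ c → b ≠ d →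
      e a b * e c d + e c d * e a b = 0)
    (htri : ∀ a b c : Fin n, a ≠ b → b ≠ c → c ≠ a →
      e a b * e b c + e b c * e c a + e c a * e a b = 0)
    (θ : Fin n → R)
    (hθ : ∀ i : Fin n, θ i = ∑ j ∈ Finset.univ.filter (fun j => j ≠ i), e i j)
    (Θ : R)
    (hΘ : Θ = ∑ p ∈ Finset.univ.filter (fun p : Fin n × Fin n => p.1 < p.2), e p.1 p.2) :
    ∀ i : Fin n, Θ * θ i + θ i * Θ = θ i ^ 2 ∧
      (Θ * (-θ i) + (-θ i) * Θ) + (-θ i) * (-θ i) = 0 := by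
  intro i
  set f : Fin n → Fin n → R := fun a b => if a = b then 0 else e a b with hf
  set g : Fin n → Fin n → R := fun a b => if a = i ∨ b = i then 0 else f a b with hg
  have hθf : θ i = ∑ j, f i j := by
    rw [hθ, Finset.sum_filter]
    refine Finset.sum_congr rfl fun j _ => ?_
    by_cases h : j = i
    · simp [hf, h]
    · simp [hf, h, Ne.symm h]
  have hΘf : ∑ a, ∑ b, f a b = Θ + Θ := by
    have hΘ' : Θ = ∑ a, ∑ b, if a < b then e a b else 0 := by
      rw [hΘ, Finset.sum_filter, Fintype.sum_prod_type]
    have hpt : ∀ a b, f a b = (if a < b then e a b else 0) + if b < a then e b a else 0 := by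
      intro a b
      rcases lt_trichotomy a b with h | h | h
      · simp [hf, h, h.ne, h.not_gt]
      · simp [hf, h]
      · simp [hf, h, h.ne', h.not_gt, hsymm a b h.ne']
    simp_rw [hpt, Finset.sum_add_distrib]
    rw [Finset.sum_comm (f := fun a b => if b < a then e b a else 0), ← hΘ']
  have hsplit : ∑ a, ∑ b, f a b = ∑ a, ∑ b, g a b + (θ i + θ i) := by
    have hpt : ∀ a b, f a b =
        g a b + ((if a = i then f i b else 0) + if b = i then f i a else 0) := by
      intro a b
      by_cases ha : a = i
      · by_cases hb : b = i
        · simp [hf, hg, ha, hb]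
        · simp [hg, ha, hb]
      · by_cases hb : b = i
        · simp [hf, hg, ha, hb, Ne.symm ha, hsymm a i ha]
        · simp [hg, ha, hb]
    have hrow : ∑ a, ∑ b, (if a = i then f i b else 0) = θ i := by
      rw [Finset.sum_comm]; simp [hθf]
    have hcol : ∑ a, ∑ b, (if b = i then f i a else 0) = θ i := by
      simp [hθf]
    rw [Finset.sum_congr rfl fun a _ => Finset.sum_congr rfl fun b _ => hpt a b]
    simp_rw [Finset.sum_add_distrib]
    rw [hrow, hcol]
  have hanti : ∀ a b, g a b * θ i + θ i * g a b = -(f i a * f i b + f i b * f i a) := by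
    intro a b
    by_cases ha : a = i
    · simp [hf, hg, ha]
    by_cases hb : b = i
    · simp [hf, hg, hb]
    by_cases hab : a = b
    · subst hab
      simp [hf, hg, Ne.symm ha, hsq i a (Ne.symm ha)]
    have hgab : g a b = e a b := by simp [hf, hg, ha, hb, hab]
    rw [hgab, hθf, Finset.mul_sum, Finset.sum_mul, ← Finset.sum_add_distrib,
      Fintype.sum_eq_add a b hab]
    · have h₁ := htri i a b (Ne.symm ha) hab hb
      have h₂ := htri i b a (Ne.symm hb) (Ne.symm hab) ha
      rw [hsymm b i hb] at h₁
      rw [hsymm b a (Ne.symm hab), hsymm a i ha] at h₂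
      simp only [hf, Ne.symm ha, Ne.symm hb, if_false]
      rw [eq_neg_iff_add_eq_zero, ← add_zero (0 : R)]
      nth_rewrite 1 [← h₁]
      rw [← h₂]
      abel
    · rintro c ⟨hca, hcb⟩
      by_cases hc : i = c
      · simp [hf, hc]
      · simpa [hf, hc] using
          hdisj a b i c hab hc ha (Ne.symm hca) hb (Ne.symm hcb)
  have hsum : (∑ a, ∑ b, g a b) * θ i + θ i * ∑ a, ∑ b, g a b = -(θ i * θ i + θ i * θ i) := by
    have hprod : θ i * θ i = ∑ a, ∑ b, f i a * f i b := by
      rw [hθf, Finset.sum_mul_sum]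
    have hprod' : θ i * θ i = ∑ a, ∑ b, f i b * f i a := by
      rw [hprod, Finset.sum_comm]
    simp_rw [Finset.sum_mul, Finset.mul_sum, ← Finset.sum_add_distrib, hanti,
      Finset.sum_neg_distrib, Finset.sum_add_distrib]
    rw [← hprod, ← hprod']
  have hdouble : (2 : K) • (Θ * θ i + θ i * Θ) = (2 : K) • (θ i * θ i) := by
    have hG : ∑ a, ∑ b, g a b = Θ + Θ - (θ i + θ i) := by
      rw [← hΘf, hsplit, add_sub_cancel_right]
    rw [hG] at hsum
    rw [two_smul, two_smul, ← sub_eq_zero]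
    rw [← sub_eq_zero] at hsum
    rw [← hsum]
    noncomm_ring
  have hmain : Θ * θ i + θ i * Θ = θ i * θ i := by
    simpa [smul_smul] using congrArg ((2⁻¹ : K) • ·) hdouble
  refine ⟨by rw [hmain, sq], ?_⟩
  rw [mul_neg, neg_mul, neg_mul_neg, ← neg_add, hmain, neg_add_cancel]
end

section
/- (Flatness, type B; part of Proposition 3.2.) Let θ = Σ_{1≤i<j≤n} (e(i,j) + ē(i,j)) + Σ_{i=1}^n e(i). Then for every i ∈ {1,…,n}, θ θ_i + θ_i θ = θ_i². Equivalently, defining dη := θη + ηθ for 1-forms η and the covariant curvature F(η) := dη + η², the connection −θ_i is flat: F(−θ_i) = 0. -/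
/-- The anticommutator `x * y + y * x`. -/
def anticomm {R : Type*} [Ring R] (x y : R) : R := x * y + y * x

section Anticomm

variable {R ι : Type*} [Ring R]

theorem anticomm_comm (x y : R) : anticomm x y = anticomm y x := add_comm _ _

theorem anticomm_self (x : R) : anticomm x x = 2 * (x * x) := (two_mul _).symm

theorem anticomm_add_left (x y z : R) :
    anticomm (x + y) z = anticomm x z + anticomm y z := by
  simp only [anticomm]; noncomm_ring

theorem anticomm_add_right (x y z : R) :
    anticomm x (y + z) = anticomm x y + anticomm x z := by
  simp only [anticomm]; noncomm_ring

@[simp] theorem anticomm_zero_left (x : R) : anticomm 0 x = 0 := by simp [anticomm]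

@[simp] theorem anticomm_zero_right (x : R) : anticomm x 0 = 0 := by simp [anticomm]

theorem anticomm_sum_left (t : Finset ι) (g : ι → R) (x : R) :
    anticomm (∑ j ∈ t, g j) x = ∑ j ∈ t, anticomm (g j) x := by
  simp only [anticomm, Finset.sum_mul, Finset.mul_sum, Finset.sum_add_distrib]

theorem anticomm_sum_right (t : Finset ι) (g : ι → R) (x : R) :
    anticomm x (∑ j ∈ t, g j) = ∑ j ∈ t, anticomm x (g j) := by
  simp only [anticomm, Finset.sum_mul, Finset.mul_sum, Finset.sum_add_distrib]

end Anticomm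

section Flatness

variable {R ι : Type*} [Ring R] [Fintype ι]

/-- For a symmetric array `s` with zero diagonal and square-zero entries, in which entries with
disjoint indices anticommute, `s j k` anticommutes with all but few summands of a row sum. -/
theorem anticomm_row_sum [DecidableEq ι] (s : ι → ι → R) (hdiag : ∀ i, s i i = 0)
    (hsymm : ∀ i j, s i j = s j i) (hsq : ∀ i j, s i j * s i j = 0)
    (hdisj : ∀ i j k l, i ≠ k → i ≠ l → j ≠ k → j ≠ l → anticomm (s i j) (s k l) = 0)
    (i j k : ι) :
    anticomm (s j k) (∑ l, s i l) = anticomm (s j k) (s i j) + anticomm (s j k) (s k i) +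
      (if j = i then anticomm (s i k) (∑ l, s i l) else 0) +
      (if k = i then anticomm (s i j) (∑ l, s i l) else 0) := by
  rcases eq_or_ne j i with rfl | hj
  · rcases eq_or_ne k j with rfl | hk
    · simp [hdiag]
    · simp [hdiag, hk, hsymm k j, anticomm_self, hsq]
  rcases eq_or_ne k i with rfl | hk
  · simp [hdiag, hj, hsymm j k, anticomm_self, hsq]
  rcases eq_or_ne j k with rfl | hjk
  · simp [hdiag, hj]
  rw [anticomm_sum_right, if_neg hj, if_neg hk, add_zero, add_zero, hsymm k i,
    ← Finset.sum_pair (f := fun l => anticomm (s j k) (s i l)) hjk]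
  refine (Finset.sum_subset (Finset.subset_univ _) fun l _ hl => ?_).symm
  simp only [Finset.mem_insert, Finset.mem_singleton, not_or] at hl
  exact hdisj _ _ _ _ hj (Ne.symm hl.1) hk (Ne.symm hl.2)

theorem anticomm_total_sum_row_sum [DecidableEq ι] (s : ι → ι → R) (hdiag : ∀ i, s i i = 0)
    (hsymm : ∀ i j, s i j = s j i) (hsq : ∀ i j, s i j * s i j = 0)
    (hdisj : ∀ i j k l, i ≠ k → i ≠ l → j ≠ k → j ≠ l → anticomm (s i j) (s k l) = 0)
    (htri : ∀ i j k, anticomm (s i j) (s j k) + anticomm (s j k) (s k i) +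
      anticomm (s k i) (s i j) = 0) (i : ι) :
    anticomm (∑ j, ∑ k, s j k) (∑ l, s i l) = 2 * ((∑ l, s i l) * ∑ l, s i l) := by
  have hpair : ∀ j k, anticomm (s j k) (s i j) + anticomm (s j k) (s k i) =
      -anticomm (s i j) (s i k) := fun j k => by
    rw [eq_neg_iff_add_eq_zero, ← htri i j k, anticomm_comm (s j k) (s i j),
      anticomm_comm (s i j) (s i k), hsymm i k]
  have hrow : ∑ k, anticomm (s i k) (∑ l, s i l) = 2 * ((∑ l, s i l) * ∑ l, s i l) := by
    rw [← anticomm_sum_left, anticomm_self]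
  have h1 : ∑ j, ∑ k, (if j = i then anticomm (s i k) (∑ l, s i l) else 0) =
      2 * ((∑ l, s i l) * ∑ l, s i l) := by
    rw [Finset.sum_comm]; simpa using hrow
  have h2 : ∑ j, ∑ k, (if k = i then anticomm (s i j) (∑ l, s i l) else 0) =
      2 * ((∑ l, s i l) * ∑ l, s i l) := by
    simpa using hrow
  rw [anticomm_sum_left]
  simp only [anticomm_sum_left Finset.univ (s _)]
  rw [Finset.sum_congr rfl fun j _ => Finset.sum_congr rfl fun k _ =>
    anticomm_row_sum s hdiag hsymm hsq hdisj i j k]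
  simp only [hpair, Finset.sum_add_distrib, Finset.sum_neg_distrib, h1, h2,
    ← anticomm_sum_right, hrow]
  abel

theorem anticomm_total_sum_vertex [DecidableEq ι] (s : ι → ι → R) (f : ι → R)
    (hdiag : ∀ i, s i i = 0)
    (hsymm : ∀ i j, s i j = s j i)
    (hsf : ∀ i j k, k ≠ i → k ≠ j → anticomm (s i j) (f k) = 0) (i : ι) :
    anticomm (∑ j, ∑ k, s j k) (f i) = 2 * anticomm (∑ l, s i l) (f i) := by
  have hterm : ∀ j k, anticomm (s j k) (f i) =
      (if j = i then anticomm (s i k) (f i) else 0) +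
      (if k = i then anticomm (s i j) (f i) else 0) := fun j k => by
    rcases eq_or_ne j i with rfl | hj
    · rcases eq_or_ne k j with rfl | hk
      · simp [hdiag]
      · simp [hk]
    rcases eq_or_ne k i with rfl | hk
    · simp [hj, hsymm j k]
    simp [hj, hk, hsf j k i hj.symm hk.symm]
  simp only [anticomm_sum_left]
  rw [Finset.sum_congr rfl fun j _ => Finset.sum_congr rfl fun k _ => hterm j k]
  simp only [Finset.sum_add_distrib]
  rw [Finset.sum_comm]
  simp [two_mul]

theorem anticomm_vertex_sum_row_sum [DecidableEq ι] (s : ι → ι → R) (f : ι → R)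
    (hdiag : ∀ i, s i i = 0)
    (hsf : ∀ i j k, k ≠ i → k ≠ j → anticomm (s i j) (f k) = 0)
    (hB : ∀ i j, anticomm (s i j) (f i) + anticomm (s i j) (f j) = 0) (i : ι) :
    anticomm (∑ k, f k) (∑ l, s i l) = 0 := by
  rw [anticomm_sum_right]
  refine Finset.sum_eq_zero fun l _ => ?_
  rcases eq_or_ne i l with rfl | hl
  · simp [hdiag]
  rw [anticomm_comm, anticomm_sum_right, ← hB i l,
    ← Finset.sum_pair (f := fun k => anticomm (s i l) (f k)) hl]
  refine (Finset.sum_subset (Finset.subset_univ _) fun k _ hk => ?_).symm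
  simp only [Finset.mem_insert, Finset.mem_singleton, not_or] at hk
  exact hsf _ _ _ hk.1 hk.2

theorem anticomm_vertex_sum_vertex (f : ι → R) (hsqf : ∀ i, f i * f i = 0)
    (hf : ∀ i j, i ≠ j → anticomm (f i) (f j) = 0) (i : ι) :
    anticomm (∑ k, f k) (f i) = 0 := by
  rw [anticomm_sum_left]
  refine Finset.sum_eq_zero fun k _ => ?_
  rcases eq_or_ne k i with rfl | hk
  · simp [anticomm_self, hsqf]
  · exact hf _ _ hk

/-- Twice the flatness identity, for an array `s` and vertex elements `f`. -/
theorem anticomm_total_row [DecidableEq ι] (s : ι → ι → R) (f : ι → R) (hdiag : ∀ i, s i i = 0)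
    (hsymm : ∀ i j, s i j = s j i) (hsq : ∀ i j, s i j * s i j = 0)
    (hsqf : ∀ i, f i * f i = 0)
    (hdisj : ∀ i j k l, i ≠ k → i ≠ l → j ≠ k → j ≠ l → anticomm (s i j) (s k l) = 0)
    (htri : ∀ i j k, anticomm (s i j) (s j k) + anticomm (s j k) (s k i) +
      anticomm (s k i) (s i j) = 0)
    (hsf : ∀ i j k, k ≠ i → k ≠ j → anticomm (s i j) (f k) = 0)
    (hf : ∀ i j, i ≠ j → anticomm (f i) (f j) = 0)
    (hB : ∀ i j, anticomm (s i j) (f i) + anticomm (s i j) (f j) = 0) (i : ι) :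
    anticomm (∑ j, ∑ k, s j k + 2 * ∑ k, f k) (∑ l, s i l + 2 * f i) =
      2 * (∑ l, s i l + 2 * f i) ^ 2 := by
  have hSA := anticomm_total_sum_row_sum s hdiag hsymm hsq hdisj htri i
  have hSf := anticomm_total_sum_vertex s f hdiag hsymm hsf i
  have hFA := anticomm_vertex_sum_row_sum s f hdiag hsf hB i
  have hFf := anticomm_vertex_sum_vertex f hsqf hf i
  have hff := hsqf i
  simp only [two_mul, anticomm_add_left, anticomm_add_right] at hSA hSf ⊢
  rw [hSA, hSf, hFA, hFf]
  simp only [anticomm, pow_two, add_mul, mul_add, hff]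
  abel

end Flatness

theorem two_mul_sum_lt {M ι : Type*} [Ring M] [Fintype ι] [LinearOrder ι] (s : ι → ι → M)
    (hdiag : ∀ i, s i i = 0) (hsymm : ∀ i j, s i j = s j i) :
    2 * ∑ p ∈ Finset.univ.filter (fun p : ι × ι => p.1 < p.2), s p.1 p.2 =
      ∑ j, ∑ k, s j k := by
  have hlt : ∑ p ∈ Finset.univ.filter (fun p : ι × ι => p.1 < p.2), s p.1 p.2 =
      ∑ j, ∑ k, if j < k then s j k else 0 := by
    rw [Finset.sum_filter, Fintype.sum_prod_type]
  have hgt : ∑ p ∈ Finset.univ.filter (fun p : ι × ι => p.1 < p.2), s p.1 p.2 =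
      ∑ j, ∑ k, if k < j then s j k else 0 := by
    rw [hlt, Finset.sum_comm]
    simp only [hsymm]
  rw [two_mul]
  nth_rewrite 1 [hlt]
  rw [hgt]
  simp only [← Finset.sum_add_distrib]
  refine Finset.sum_congr rfl fun j _ => Finset.sum_congr rfl fun k _ => ?_
  rcases lt_trichotomy j k with h | rfl | h
  · simp [h, h.not_gt]
  · simp [hdiag]
  · simp [h, h.not_gt]

/-- Flatness of the connections `-θ_i` in `Λ_quad(B_n)`
(part of Proposition 3.2 of Kirillov–Maeno): with
`θ = Σ_{i<j} (e(i,j) + ē(i,j)) + Σ_i e(i)`, one has `θθ_i + θ_iθ = θ_i²`,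
i.e. `F(-θ_i) = d(-θ_i) + (-θ_i)² = 0` where `dη = θη + ηθ`.
`ebar i j` denotes `ē(i,j)` and `f i` denotes `e_{(i)}`. -/
theorem theta_flat_typeB (n : ℕ) (hn : 1 ≤ n)
    (K : Type*) [Field K] [CharZero K] (R : Type*) [Ring R] [Algebra K R]
    (e ebar : Fin n → Fin n → R) (f : Fin n → R)
    (hsymm : ∀ i j : Fin n, i ≠ j → e i j = e j i)
    (hsymmb : ∀ i j : Fin n, i ≠ j → ebar i j = ebar j i)
    (hsq : ∀ i j : Fin n, i ≠ j → e i j * e i j = 0)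
    (hsqb : ∀ i j : Fin n, i ≠ j → ebar i j * ebar i j = 0)
    (hsqf : ∀ i : Fin n, f i * f i = 0)
    (hdisj : ∀ i j k l : Fin n, i ≠ j → k ≠ l → i ≠ k → i ≠ l → j ≠ k → j ≠ l →
      e i j * e k l + e k l * e i j = 0)
    (hdisjb : ∀ i j k l : Fin n, i ≠ j → k ≠ l → i ≠ k → i ≠ l → j ≠ k → j ≠ l →
      e i j * ebar k l + ebar k l * e i j = 0)
    (hdisjbb : ∀ i j k l : Fin n, i ≠ j → k ≠ l → i ≠ k → i ≠ l → j ≠ k → j ≠ l →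
      ebar i j * ebar k l + ebar k l * ebar i j = 0)
    (hf : ∀ i j : Fin n, i ≠ j → f i * f j + f j * f i = 0)
    (hmix : ∀ i j : Fin n, i ≠ j → e i j * ebar i j + ebar i j * e i j = 0)
    (hef : ∀ i j k : Fin n, i ≠ j → k ≠ i → k ≠ j →
      e i j * f k + f k * e i j = 0)
    (hebf : ∀ i j k : Fin n, i ≠ j → k ≠ i → k ≠ j →
      ebar i j * f k + f k * ebar i j = 0)
    (htri : ∀ i j k : Fin n, i ≠ j → j ≠ k → k ≠ i →
      e i j * e j k + e j k * e k i + e k i * e i j = 0)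
    (htrib : ∀ i j k : Fin n, i ≠ j → j ≠ k → k ≠ i →
      ebar i k * e i j + e j i * ebar j k + ebar k j * ebar i k = 0)
    (hB : ∀ i j : Fin n, i ≠ j →
      e i j * f i + f j * e i j + f i * ebar i j + ebar i j * f j = 0)
    (θ : Fin n → R)
    (hθ : ∀ i : Fin n,
      θ i = ∑ j ∈ Finset.univ.filter (fun j => j ≠ i), (e i j + ebar i j) + 2 * f i)
    (Θ : R)
    (hΘ : Θ = ∑ p ∈ Finset.univ.filter (fun p : Fin n × Fin n => p.1 < p.2),
        (e p.1 p.2 + ebar p.1 p.2) + ∑ i : Fin n, f i) :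
    ∀ i : Fin n, Θ * θ i + θ i * Θ = θ i ^ 2 ∧
      (Θ * (-θ i) + (-θ i) * Θ) + (-θ i) * (-θ i) = 0 := by
  have htwo : IsUnit (2 : R) := by
    simpa only [map_ofNat] using (IsUnit.mk0 (2 : K) two_ne_zero).map (algebraMap K R)
  let s : Fin n → Fin n → R := fun i j => if i = j then 0 else e i j + ebar i j
  have hs : ∀ i j, i ≠ j → s i j = e i j + ebar i j := fun i j h => if_neg h
  have hdiag : ∀ i, s i i = 0 := fun i => if_pos rfl
  have hssymm : ∀ i j, s i j = s j i := fun i j => by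
    rcases eq_or_ne i j with rfl | h
    · rfl
    · rw [hs _ _ h, hs _ _ h.symm, hsymm _ _ h, hsymmb _ _ h]
  have hssq : ∀ i j, s i j * s i j = 0 := fun i j => by
    rcases eq_or_ne i j with rfl | h
    · simp [hdiag]
    · rw [hs _ _ h]
      linear_combination (norm := noncomm_ring) hsq i j h + hsqb i j h + hmix i j h
  have hsdisj : ∀ i j k l, i ≠ k → i ≠ l → j ≠ k → j ≠ l → anticomm (s i j) (s k l) = 0 := by
    intro i j k l hik hil hjk hjl
    rcases eq_or_ne i j with rfl | hij
    · simp [hdiag]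
    rcases eq_or_ne k l with rfl | hkl
    · simp [hdiag]
    rw [hs _ _ hij, hs _ _ hkl, anticomm]
    linear_combination (norm := noncomm_ring) hdisj i j k l hij hkl hik hil hjk hjl +
      hdisjb i j k l hij hkl hik hil hjk hjl + hdisjbb i j k l hij hkl hik hil hjk hjl +
      hdisjb k l i j hkl hij hik.symm hjk.symm hil.symm hjl.symm
  have hstri : ∀ i j k, anticomm (s i j) (s j k) + anticomm (s j k) (s k i) +
      anticomm (s k i) (s i j) = 0 := by
    intro i j k
    rcases eq_or_ne i j with rfl | hij
    · simp [hdiag, hssymm k i, anticomm_self, hssq]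
    rcases eq_or_ne j k with rfl | hjk
    · simp [hdiag, hssymm j i, anticomm_self, hssq]
    rcases eq_or_ne k i with rfl | hki
    · simp [hdiag, hssymm j k, anticomm_self, hssq]
    have h1 := htri i j k hij hjk hki
    have h2 := htri j i k hij.symm hki.symm hjk.symm
    have h3 := htrib i j k hij hjk hki
    have h4 := htrib j i k hij.symm hki.symm hjk.symm
    have h5 := htrib i k j hki.symm hjk.symm hij.symm
    have h6 := htrib k i j hki hij hjk
    have h7 := htrib j k i hjk hki hij
    have h8 := htrib k j i hjk.symm hij.symm hki.symm
    rw [hs _ _ hij, hs _ _ hjk, hs _ _ hki]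
    simp only [anticomm, hsymm j i hij.symm, hsymm k j hjk.symm, hsymm i k hki.symm,
      hsymmb j i hij.symm, hsymmb k j hjk.symm, hsymmb i k hki.symm] at *
    linear_combination (norm := noncomm_ring) h1 + h2 + h3 + h4 + h5 + h6 + h7 + h8
  have hssf : ∀ i j k, k ≠ i → k ≠ j → anticomm (s i j) (f k) = 0 := by
    intro i j k hki hkj
    rcases eq_or_ne i j with rfl | hij
    · simp [hdiag]
    rw [hs _ _ hij, anticomm]
    linear_combination (norm := noncomm_ring) hef i j k hij hki hkj + hebf i j k hij hki hkj
  have hsB : ∀ i j, anticomm (s i j) (f i) + anticomm (s i j) (f j) = 0 := by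
    intro i j
    rcases eq_or_ne i j with rfl | hij
    · simp [hdiag]
    have h := hB j i hij.symm
    rw [hsymm j i hij.symm, hsymmb j i hij.symm] at h
    rw [hs _ _ hij, anticomm, anticomm]
    linear_combination (norm := noncomm_ring) hB i j hij + h
  have hθs : ∀ i, θ i = ∑ l, s i l + 2 * f i := fun i => by
    rw [hθ, Finset.sum_filter]
    refine congrArg (· + 2 * f i) (Finset.sum_congr rfl fun j _ => ?_)
    simp only [s, ne_eq, ite_not, eq_comm]
  have hΘs : 2 * Θ = ∑ j, ∑ k, s j k + 2 * ∑ k, f k := by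
    rw [hΘ, mul_add, ← two_mul_sum_lt s hdiag hssymm]
    refine congrArg (2 * · + 2 * ∑ k, f k) (Finset.sum_congr rfl fun p hp => ?_)
    exact (hs _ _ (Finset.mem_filter.mp hp).2.ne).symm
  intro i
  have hflat : Θ * θ i + θ i * Θ = θ i ^ 2 := by
    apply htwo.mul_left_cancel
    have h := anticomm_total_row s f hdiag hssymm hssq hsqf hsdisj hstri hssf
      (fun i j hij => hf i j hij) hsB i
    rw [← hθs, ← hΘs, anticomm] at h
    rw [← h]
    noncomm_ring
  refine ⟨hflat, ?_⟩
  rw [mul_neg, neg_mul, neg_mul_neg, ← neg_add, hflat, pow_two, neg_add_cancel]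
end

section
/- Lemma 5.1 (Cyclic relations in Λ_quad(A_{n−1})). For any k ≥ 2 and any distinct elements a_1, …, a_k of {1,…,n}, Σ_{i=2}^{k} (−1)^{k(i−1)} e(a_1,a_i) e(a_1,a_{i+1}) ⋯ e(a_1,a_k) · e(a_1,a_2) e(a_1,a_3) ⋯ e(a_1,a_i) = 0, where the i-th summand is the product of the k factors e(a_1,a_j) taken in the cyclic order j = i, i+1, …, k, 2, 3, …, i. -/
/-- The product `x i * x (i + 1) * ⋯ * x (i + l - 1)` of `l` consecutive terms of a sequence. -/
def segProd {R : Type*} [Monoid R] (x : ℕ → R) (i l : ℕ) : R :=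
  ((List.range' i l).map x).prod

theorem segProd_zero {R : Type*} [Monoid R] (x : ℕ → R) (i : ℕ) : segProd x i 0 = 1 := by
  simp [segProd]

theorem segProd_succ_left {R : Type*} [Monoid R] (x : ℕ → R) (i l : ℕ) :
    segProd x i (l + 1) = x i * segProd x (i + 1) l := by
  simp [segProd, List.range'_succ]

theorem segProd_succ_right {R : Type*} [Monoid R] (x : ℕ → R) (i l : ℕ) :
    segProd x i (l + 1) = segProd x i l * x (i + l) := by
  simp [segProd, List.range'_concat]

theorem segProd_shift {R : Type*} [Monoid R] (x : ℕ → R) (c i l : ℕ) :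
    segProd (fun j => x (j + c)) i l = segProd x (i + c) l := by
  induction l generalizing i with
  | zero => simp [segProd_zero]
  | succ l ih => rw [segProd_succ_left, segProd_succ_left, ih, Nat.add_right_comm]

/-- An element anticommuting with each factor commutes with the product up to sign. -/
theorem mul_segProd_of_anticomm {R : Type*} [Ring R] (x : ℕ → R) (y : R) (i l : ℕ)
    (h : ∀ j, i ≤ j → j < i + l → y * x j + x j * y = 0) :
    y * segProd x i l = (-1 : ℤ) ^ l • (segProd x i l * y) := by
  induction l with
  | zero => simp [segProd_zero]
  | succ l ih =>
    rw [segProd_succ_right, ← mul_assoc, ih fun j h₁ h₂ => h j h₁ (by omega), smul_mul_assoc,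
      mul_assoc, eq_neg_of_add_eq_zero_left (h (i + l) (by omega) (by omega)), pow_succ]
    simp [mul_assoc]

/-- Cyclic relation for square-zero elements `x 0, …, x m` with auxiliary elements `y i j`
satisfying three-term relations. -/
theorem sum_cyclic_segProd_eq_zero {R : Type*} [Ring R] (m : ℕ) (x : ℕ → R) (y : ℕ → ℕ → R)
    (hsq : ∀ i ≤ m, x i * x i = 0)
    (htri : ∀ i j, i < j → j ≤ m → x j * x i + x i * y i j + y i j * x j = 0)
    (hanti : ∀ i l j, i < l → l < j → j ≤ m → y i j * x l + x l * y i j = 0) :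
    ∑ i ∈ Finset.range (m + 1),
      (-1 : ℤ) ^ (m * i) • (segProd x i (m + 1 - i) * segProd x 0 (i + 1)) = 0 := by
  induction m generalizing x y with
  | zero => simpa [segProd] using hsq 0 le_rfl
  | succ m ih =>
    have ih_init := ih x y (fun i hi => hsq i (by omega)) (fun i j h hj => htri i j h (by omega))
      (fun i l j h h' hj => hanti i l j h h' (by omega))
    have ih_tail := ih (fun i => x (i + 1)) (fun i j => y (i + 1) (j + 1))
      (fun i hi => hsq _ (by omega)) (fun i j h hj => htri _ _ (by omega) (by omega))
      (fun i l j h h' hj => hanti _ _ _ (by omega) (by omega) (by omega))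
    simp only [segProd_shift] at ih_tail
    rw [Finset.sum_range_succ'] at ih_init
    rw [Finset.sum_range_succ] at ih_tail
    rw [Finset.sum_range_succ, Finset.sum_range_succ']
    set z := y 0 (m + 1)
    have hz : x (m + 1) * x 0 = -(x 0 * z + z * x (m + 1)) := by
      rw [eq_neg_iff_add_eq_zero, ← add_assoc]
      exact htri 0 (m + 1) (by omega) le_rfl
    have hcomm : ∀ i l, 1 ≤ i → i + l ≤ m + 1 →
        z * segProd x i l = (-1 : ℤ) ^ l • (segProd x i l * z) := fun i l h₁ h₂ =>
      mul_segProd_of_anticomm x z i l fun j h h' => hanti _ _ _ (by omega) (by omega) le_rfl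
    have hcomm' : ∀ i l, 1 ≤ i → i + l ≤ m + 1 →
        segProd x i l * z = (-1 : ℤ) ^ l • (z * segProd x i l) := fun i l h₁ h₂ => by
      rw [hcomm i l h₁ h₂, smul_smul, ← pow_add, Even.neg_one_pow ⟨l, rfl⟩, one_smul]
    have hmid : ∀ j ∈ Finset.range m,
        (-1 : ℤ) ^ ((m + 1) * (j + 1)) •
          (segProd x (j + 1) (m + 1 + 1 - (j + 1)) * segProd x 0 (j + 1 + 1)) =
        -((-1 : ℤ) ^ (m * (j + 1)) •
            (segProd x (j + 1) (m + 1 - (j + 1)) * segProd x 0 (j + 1 + 1))) * z +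
          z * ((-1 : ℤ) ^ (m * j) •
            (segProd x (j + 1) (m + 1 - j) * segProd x (0 + 1) (j + 1))) := by
      intro j hj
      obtain ⟨d, rfl⟩ := Nat.exists_eq_add_of_lt (Finset.mem_range.mp hj)
      have h₁ : j + d + 1 + 1 + 1 - (j + 1) = d + 1 + 1 := by omega
      have h₂ : j + d + 1 + 1 - (j + 1) = d + 1 := by omega
      have h₃ : j + d + 1 + 1 - j = d + 1 + 1 := by omega
      have h₄ : j + 1 + (d + 1) = j + d + 1 + 1 := by omega
      rw [h₁, h₂, h₃, segProd_succ_right x (j + 1) (d + 1), segProd_succ_left x 0 (j + 1), h₄]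
      have hA := hcomm 1 (j + 1) le_rfl (by omega)
      have hB := hcomm' (j + 1) (d + 1) (by omega) (by omega)
      generalize segProd x (j + 1) (d + 1) = A at *
      simp only [Nat.zero_add]
      generalize segProd x 1 (j + 1) = B at *
      have key : A * x (j + d + 1 + 1) * (x 0 * B) =
          -((-1 : ℤ) ^ (j + 1) • (A * (x 0 * B) * z)) -
            (-1 : ℤ) ^ (d + 1) • (z * (A * x (j + d + 1 + 1) * B)) := by
        calc A * x (j + d + 1 + 1) * (x 0 * B) = A * (x (j + d + 1 + 1) * x 0) * B := by
              simp only [mul_assoc]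
          _ = -(A * x 0 * (z * B)) - (A * z) * (x (j + d + 1 + 1) * B) := by
              rw [hz]; noncomm_ring
          _ = _ := by
              rw [hA, hB]; simp only [mul_smul_comm, smul_mul_assoc, mul_assoc]
      rw [key]
      simp only [smul_sub, smul_neg, smul_smul, mul_smul_comm, smul_mul_assoc, neg_mul, ← pow_add]
      have e₁ : (-1 : ℤ) ^ ((j + d + 1 + 1) * (j + 1) + (j + 1)) =
          (-1) ^ ((j + d + 1) * (j + 1)) := by
        rw [show (j + d + 1 + 1) * (j + 1) + (j + 1) =
          (j + d + 1) * (j + 1) + 2 * (j + 1) by ring, pow_add, pow_mul (-1 : ℤ) 2]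
        simp
      have e₂ : (-1 : ℤ) ^ ((j + d + 1 + 1) * (j + 1) + (d + 1)) =
          -(-1) ^ ((j + d + 1) * j) := by
        rw [show (j + d + 1 + 1) * (j + 1) + (d + 1) =
          (j + d + 1) * j + 2 * (j + d + 1) + 1 by ring, pow_succ, pow_add, pow_mul (-1 : ℤ) 2]
        simp
      rw [e₁, e₂]
      simp [sub_eq_add_neg]
    rw [Finset.sum_congr rfl hmid, Finset.sum_add_distrib, ← Finset.sum_mul, ← Finset.mul_sum,
      Finset.sum_neg_distrib, eq_neg_of_add_eq_zero_left ih_init,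
      eq_neg_of_add_eq_zero_left ih_tail]
    have hm : (-1 : ℤ) ^ (m * m) = (-1) ^ m := by
      rcases Nat.even_or_odd m with h | h
      · rw [h.neg_one_pow, (h.mul_left m).neg_one_pow]
      · rw [h.neg_one_pow, (h.mul h).neg_one_pow]
    have hm' : (-1 : ℤ) ^ ((m + 1) * (m + 1)) = -(-1) ^ m := by
      rw [show (m + 1) * (m + 1) = m * m + 2 * m + 1 by ring, pow_succ, pow_add,
        pow_mul (-1 : ℤ) 2, hm]
      simp
    have hone : ∀ i, segProd x i 1 = x i := by simp [segProd]
    have hlast : x 0 * z * (segProd x 1 m * x (m + 1)) =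
        (-1 : ℤ) ^ m • (segProd x 0 (m + 1) * z * x (m + 1)) := by
      rw [segProd_succ_left, ← mul_assoc, mul_assoc (x 0), hcomm 1 m le_rfl (by omega)]
      simp only [mul_smul_comm, smul_mul_assoc, mul_assoc, Nat.zero_add]
    have hfirst : segProd x 0 (m + 1 + 1) * x 0 =
        -(segProd x 0 (m + 1) * x 0 * z) - segProd x 0 (m + 1) * z * x (m + 1) := by
      rw [segProd_succ_right, Nat.zero_add, mul_assoc, hz]; noncomm_ring
    have hfinal : x (m + 1) * segProd x 0 (m + 1 + 1) =
        -((-1 : ℤ) ^ m • (segProd x 0 (m + 1) * z * x (m + 1))) -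
          z * (x (m + 1) * segProd x 1 (m + 1)) := by
      rw [← hlast, segProd_succ_left x 0 (m + 1), ← mul_assoc, hz, Nat.zero_add,
        segProd_succ_right x 1 m, Nat.add_comm 1 m]
      noncomm_ring
    simp only [Nat.sub_zero, Nat.zero_add, mul_zero, pow_zero, one_smul, Nat.add_sub_cancel_left,
      hone, hm, hm', hfirst, hfinal]
    simp only [neg_smul, smul_sub, smul_neg, smul_smul, ← pow_add, Even.neg_one_pow ⟨m, rfl⟩,
      one_smul, mul_neg, mul_smul_comm, neg_mul, neg_neg]
    abel

/-- Lemma 5.1 of Kirillov–Maeno (cyclic relations in `Λ_quad(A_{n-1})`).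
For distinct `a 1, …, a k` the alternating sum of the cyclically rotated
products `e(a_1,a_i) e(a_1,a_{i+1}) ⋯ e(a_1,a_k) e(a_1,a_2) ⋯ e(a_1,a_i)`
vanishes. -/
theorem cyclic_relations_typeA (n : ℕ) (hn : 1 ≤ n) (R : Type*) [Ring R]
    (e : Fin n → Fin n → R)
    (hsymm : ∀ a b : Fin n, a ≠ b → e a b = e b a)
    (hsq : ∀ a b : Fin n, a ≠ b → e a b * e a b = 0)
    (hdisj : ∀ a b c d : Fin n, a ≠ b → c ≠ d → a ≠ c → a ≠ d → b ≠ c → b ≠ d →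
      e a b * e c d + e c d * e a b = 0)
    (htri : ∀ a b c : Fin n, a ≠ b → b ≠ c → c ≠ a →
      e a b * e b c + e b c * e c a + e c a * e a b = 0)
    (k : ℕ) (hk : 2 ≤ k) (a : ℕ → Fin n)
    (hinj : ∀ i j : ℕ, 1 ≤ i → i ≤ k → 1 ≤ j → j ≤ k → i ≠ j → a i ≠ a j) :
    ∑ i ∈ Finset.Icc 2 k, (-1 : R) ^ (k * (i - 1)) *
      (((List.range' i (k + 1 - i)).map (fun j => e (a 1) (a j))).prod *
        ((List.range' 2 (i - 1)).map (fun j => e (a 1) (a j))).prod) = 0 := by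
  obtain ⟨m, rfl⟩ := Nat.exists_eq_add_of_le' hk
  have hne : ∀ i j, i ≤ m → j ≤ m → i ≠ j → a (i + 2) ≠ a (j + 2) := fun i j hi hj h =>
    hinj _ _ (by omega) (by omega) (by omega) (by omega) (by omega)
  have hne_one : ∀ i, i ≤ m → a 1 ≠ a (i + 2) := fun i hi =>
    hinj _ _ (by omega) (by omega) (by omega) (by omega) (by omega)
  have key := sum_cyclic_segProd_eq_zero m (fun j => e (a 1) (a (j + 2)))
    (fun i j => e (a (i + 2)) (a (j + 2))) (fun i hi => hsq _ _ (hne_one i hi))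
    (fun i j hij hj => by
      have h := htri (a (j + 2)) (a 1) (a (i + 2)) (hne_one j hj).symm (hne_one i (by omega))
        (hne i j (by omega) hj (by omega))
      rwa [hsymm _ _ (hne_one j hj).symm] at h)
    (fun i l j hil hlj hj => hdisj _ _ _ _ (hne i j (by omega) hj (by omega))
      (hne_one l (by omega)) (hne_one i (by omega)).symm (hne i l (by omega) (by omega) (by omega))
      (hne_one j hj).symm (hne j l hj (by omega) (by omega)))
  simp only [segProd_shift (fun j => e (a 1) (a j)) 2] at key
  rw [← Finset.Ico_add_one_right_eq_Icc, Finset.sum_Ico_eq_sum_range,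
    show m + 2 + 1 - 2 = m + 1 by omega]
  have hsum := congrArg (fun t => (-1 : ℤ) ^ m • t) key
  simp only [smul_zero, Finset.smul_sum, smul_smul] at hsum
  rw [← hsum]
  refine Finset.sum_congr rfl fun i _ => ?_
  have hsign : (-1 : ℤ) ^ m * (-1) ^ (m * i) = (-1) ^ ((m + 2) * (2 + i - 1)) := by
    rw [show 2 + i - 1 = i + 1 by omega, show (m + 2) * (i + 1) = m + m * i + 2 * (i + 1) by ring,
      pow_add, pow_add, pow_mul (-1 : ℤ) 2]
    simp
  rw [hsign, zsmul_eq_mul, show m + 2 + 1 - (2 + i) = m + 1 - i by omega,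
    show 2 + i - 1 = i + 1 by omega, Nat.add_comm 2 i]
  simp [segProd]
end

section
/- Lemma 5.2. For any k ≥ 2 and any distinct elements a_1, …, a_{k+1} of {1,…,n}, the following identity holds: (∏_{j=2}^{k} e(a_1,a_j)) e(a_1,a_2) e(a_1,a_{k+1}) + (−1)^{k+1} e(a_1,a_{k+1}) (∏_{j=2}^{k} e(a_1,a_j)) e(a_1,a_2) + (∏_{j=2}^{k+1} e(a_1,a_j)) e(a_2,a_{k+1}) + (−1)^{k+1} e(a_2,a_{k+1}) e(a_1,a_{k+1}) (∏_{j=3}^{k} e(a_1,a_j)) e(a_1,a_2) = 0, where each product ∏ is taken in increasing order of the index j. -/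
/-- An element anticommuting with every member of a list moves past its product up to sign. -/
theorem List.prod_mul_of_forall_anticommute {R : Type*} [Ring R] (z : R) (l : List R)
    (h : ∀ x ∈ l, x * z = -(z * x)) : l.prod * z = (-1 : R) ^ l.length * (z * l.prod) := by
  induction l with
  | nil => simp
  | cons x l ih =>
    rw [List.prod_cons, mul_assoc, ih fun y hy => h y (List.mem_cons_of_mem _ hy),
      ← mul_assoc, ((Commute.neg_one_right x).pow_right _).eq, mul_assoc, ← mul_assoc x,
      h x List.mem_cons_self, List.length_cons, pow_succ]
    noncomm_ring

/-- Lemma 5.2 of Kirillov–Maeno. For distinct `a 1, …, a (k+1)` in `Λ_quad(A_{n-1})`: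
`(∏_{j=2}^k e(a_1,a_j)) e(a_1,a_2) e(a_1,a_{k+1})
 + (-1)^{k+1} e(a_1,a_{k+1}) (∏_{j=2}^k e(a_1,a_j)) e(a_1,a_2)
 + (∏_{j=2}^{k+1} e(a_1,a_j)) e(a_2,a_{k+1})
 + (-1)^{k+1} e(a_2,a_{k+1}) e(a_1,a_{k+1}) (∏_{j=3}^k e(a_1,a_j)) e(a_1,a_2) = 0`. -/
theorem lem52_typeA (n : ℕ) (hn : 1 ≤ n) (R : Type*) [Ring R]
    (e : Fin n → Fin n → R)
    (hsymm : ∀ a b : Fin n, a ≠ b → e a b = e b a)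
    (hsq : ∀ a b : Fin n, a ≠ b → e a b * e a b = 0)
    (hdisj : ∀ a b c d : Fin n, a ≠ b → c ≠ d → a ≠ c → a ≠ d → b ≠ c → b ≠ d →
      e a b * e c d + e c d * e a b = 0)
    (htri : ∀ a b c : Fin n, a ≠ b → b ≠ c → c ≠ a →
      e a b * e b c + e b c * e c a + e c a * e a b = 0)
    (k : ℕ) (hk : 2 ≤ k) (a : ℕ → Fin n)
    (hinj : ∀ i j : ℕ, 1 ≤ i → i ≤ k + 1 → 1 ≤ j → j ≤ k + 1 → i ≠ j → a i ≠ a j) :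
    ((List.range' 2 (k - 1)).map (fun j => e (a 1) (a j))).prod *
        e (a 1) (a 2) * e (a 1) (a (k + 1)) +
      (-1 : R) ^ (k + 1) *
        (e (a 1) (a (k + 1)) *
          ((List.range' 2 (k - 1)).map (fun j => e (a 1) (a j))).prod * e (a 1) (a 2)) +
      ((List.range' 2 k).map (fun j => e (a 1) (a j))).prod * e (a 2) (a (k + 1)) +
      (-1 : R) ^ (k + 1) *
        (e (a 2) (a (k + 1)) * e (a 1) (a (k + 1)) *
          ((List.range' 3 (k - 2)).map (fun j => e (a 1) (a j))).prod * e (a 1) (a 2))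
      = 0 := by
  obtain ⟨m, rfl⟩ := Nat.exists_eq_add_of_le' hk
  have ne (i j : ℕ) (hi : 1 ≤ i ∧ i ≤ m + 3) (hj : 1 ≤ j ∧ j ≤ m + 3) (hij : i ≠ j) : a i ≠ a j :=
    hinj i j hi.1 hi.2 hj.1 hj.2 hij
  have h12 : a 1 ≠ a 2 := ne _ _ (by lia) (by lia) (by lia)
  have h1k : a 1 ≠ a (m + 3) := ne _ _ (by lia) (by lia) (by lia)
  have h2k : a 2 ≠ a (m + 3) := ne _ _ (by lia) (by lia) (by lia)
  have htri₁ := htri (a 1) (a 2) (a (m + 3)) h12 h2k h1k.symm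
  have htri₂ := htri (a 1) (a (m + 3)) (a 2) h1k h2k.symm h12.symm
  rw [hsymm _ _ h1k.symm] at htri₁
  rw [hsymm _ _ h2k.symm, hsymm _ _ h12.symm] at htri₂
  have hmove := List.prod_mul_of_forall_anticommute (e (a 2) (a (m + 3)))
    ((List.range' 3 m).map fun j => e (a 1) (a j)) (by
      simp only [List.mem_map, List.mem_range'_1]
      rintro _ ⟨j, hj, rfl⟩
      exact eq_neg_of_add_eq_zero_left (hdisj _ _ _ _ (ne _ _ (by lia) (by lia) (by lia)) h2k h12
        h1k (ne _ _ (by lia) (by lia) (by lia)) (ne _ _ (by lia) (by lia) (by lia))))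
  have hinit : List.range' 2 (m + 2 - 1) = 2 :: List.range' 3 m := by
    simp [List.range'_succ]
  have hfull : List.range' 2 (m + 2) = 2 :: (List.range' 3 m ++ [m + 3]) := by
    rw [List.range'_succ, List.range'_concat]
    simp [add_comm]
  rw [List.length_map, List.length_range'] at hmove
  rw [hinit, hfull, Nat.add_sub_cancel]
  simp only [List.map_cons, List.map_append, List.map_nil, List.prod_cons, List.prod_append,
    List.prod_nil, mul_one]
  rw [show m + 2 + 1 = m + 3 from rfl]
  generalize ((List.range' 3 m).map fun j => e (a 1) (a j)).prod = M at *
  generalize e (a 1) (a 2) = x at *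
  generalize e (a 1) (a (m + 3)) = y at *
  generalize e (a 2) (a (m + 3)) = z at *
  have hsign : x * (-1 : R) ^ m = (-1) ^ m * x := ((Commute.neg_one_right x).pow_right m).eq
  have hpow : (-1 : R) ^ (m + 3) = -(-1) ^ m := by rw [pow_add]; norm_num
  rw [hpow]
  calc
    _ = x * M * (y * z + z * x + x * y) - (-1) ^ m * ((x * z + z * y + y * x) * M * x)
        - x * (M * z) * x + (-1) ^ m * x * (z * M) * x := by noncomm_ring
    _ = 0 := by
      rw [htri₁, htri₂, hmove, ← mul_assoc x, hsign]
      noncomm_ring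
end

section
/- Corollary 5.1. For every integer m ≥ 1, θ_1^{2m} + θ_2^{2m} + ⋯ + θ_n^{2m} = 0. -/
namespace DunklElements

/-- The defining relations of the quadratic algebra, with `e a a = 0` as a convention. -/
structure Rel {ι A : Type*} [Ring A] (e : ι → ι → A) : Prop where
  symm : ∀ a b, e a b = e b a
  diag : ∀ a, e a a = 0
  sq : ∀ a b, e a b * e a b = 0
  anti : ∀ a b c d, a ≠ c → a ≠ d → b ≠ c → b ≠ d → e a b * e c d + e c d * e a b = 0
  tri : ∀ a b c, e a b * e b c + e b c * e c a + e c a * e a b = 0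

/-- The generator `e a b` if `b` lies in `S`, and zero otherwise. -/
def restr {ι A : Type*} [DecidableEq ι] [Zero A] (e : ι → ι → A) (S : Finset ι) (a b : ι) : A :=
  if b ∈ S then e a b else 0

/-- The Dunkl element at `a` of the subalgebra with index set `S`. -/
def theta {ι A : Type*} [Ring A] (e : ι → ι → A) (S : Finset ι) (a : ι) : A :=
  ∑ c ∈ S, e a c

/-- The product of the values of `f` along a list, taken from the last entry to the first. -/
def revProd {ι A : Type*} [Monoid A] (f : ι → A) : List ι → A
  | [] => 1
  | i :: l => revProd f l * f i

section RevProd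

variable {ι A : Type*} [Monoid A] (f : ι → A)

@[simp] lemma revProd_nil : revProd f [] = 1 := rfl

@[simp] lemma revProd_cons (i : ι) (l : List ι) : revProd f (i :: l) = revProd f l * f i := rfl

lemma revProd_append (l l' : List ι) : revProd f (l ++ l') = revProd f l' * revProd f l := by
  induction l with
  | nil => simp
  | cons i l ih => simp [ih, mul_assoc]

lemma op_revProd (l : List ι) :
    revProd (fun i => MulOpposite.op (f i)) l = MulOpposite.op (l.map f).prod := by
  induction l with
  | nil => simp
  | cons i l ih => simp [ih]

end RevProd

section Anticommuting

variable {ι A : Type*} [Ring A] {y : ι → A}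

lemma commute_sq_of_anticommute {a b : A} (h : a * b = -(b * a)) : Commute a (b * b) := by
  change a * (b * b) = b * b * a
  rw [← mul_assoc, h, neg_mul, mul_assoc, h, mul_neg, neg_neg, mul_assoc]

lemma commute_list_prod {x : A} {f : ι → A} {l : List ι} (h : ∀ a ∈ l, Commute x (f a)) :
    Commute x (l.map f).prod :=
  Commute.list_prod_right _ _ (by simpa using h)

lemma commute_revProd {x : A} {f : ι → A} {l : List ι} (h : ∀ a ∈ l, Commute x (f a)) :
    Commute x (revProd f l) := by
  induction l with
  | nil => exact Commute.one_right x
  | cons i l ih =>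
    exact (ih fun a ha => h a (by simp [ha])).mul_right (h i (by simp))

/-- Products of `u ± y` telescope to products of `u ^ 2 - y ^ 2` for anticommuting `y`. -/
lemma prod_sub_mul_revProd_add (u : ℤ) {l : List ι} (hl : l.Nodup)
    (hy : ∀ a ∈ l, ∀ b ∈ l, a ≠ b → y a * y b = -(y b * y a)) :
    (l.map fun a => (u : A) - y a).prod * revProd (fun a => (u : A) + y a) l
      = (l.map fun a => (u : A) * u - y a * y a).prod := by
  induction l with
  | nil => simp
  | cons i l ih =>
    have ih' := ih hl.of_cons fun a ha b hb => hy a (by simp [ha]) b (by simp [hb])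
    have hc : Commute ((u : A) + y i) (l.map fun a => (u : A) * u - y a * y a).prod := by
      refine commute_list_prod fun a ha => ?_
      have hne : i ≠ a := fun h => (List.nodup_cons.1 hl).1 (h ▸ ha)
      have := commute_sq_of_anticommute (hy i (by simp) a (by simp [ha]) hne)
      have hu : ∀ z : A, Commute (u : A) z := fun z => Int.cast_commute u z
      exact (hu _).add_left (((hu _).symm.mul_right (hu _).symm).sub_right this)
    simp only [List.map_cons, List.prod_cons, revProd_cons]
    rw [mul_assoc, ← mul_assoc _ (revProd _ _), ih', ← hc.eq, ← mul_assoc]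
    congr 1
    have := (Int.cast_commute u (y i)).eq
    rw [sub_mul, mul_add, mul_add, this]
    abel

lemma revProd_add_mul_prod_sub (u : ℤ) {l : List ι} (hl : l.Nodup)
    (hy : ∀ a ∈ l, ∀ b ∈ l, a ≠ b → y a * y b = -(y b * y a)) :
    revProd (fun a => (u : A) + y a) l * (l.map fun a => (u : A) - y a).prod
      = (l.map fun a => (u : A) * u - y a * y a).prod := by
  induction l with
  | nil => simp
  | cons i l ih =>
    have ih' := ih hl.of_cons fun a ha b hb => hy a (by simp [ha]) b (by simp [hb])
    have hu : ∀ z : A, Commute (u : A) z := fun z => Int.cast_commute u z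
    have hc : Commute ((u : A) * u - y i * y i) (revProd (fun a => (u : A) + y a) l) := by
      refine commute_revProd fun a ha => ?_
      have hne : a ≠ i := fun h => (List.nodup_cons.1 hl).1 (h ▸ ha)
      have := commute_sq_of_anticommute (hy a (by simp [ha]) i (by simp) hne)
      exact ((hu _).mul_left (hu _)).sub_left (((hu _).symm.add_right this.symm))
    simp only [List.map_cons, List.prod_cons, revProd_cons]
    rw [← ih', ← mul_assoc _ (revProd _ _), hc.eq, mul_assoc, mul_assoc, ← mul_assoc (_ + _)]
    congr 2
    rw [add_mul, mul_sub, mul_sub, (hu (y i)).eq]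
    abel

lemma revProd_perm {l l' : List ι} (h : l.Perm l') (hl : l.Nodup)
    (hy : ∀ a ∈ l, ∀ b ∈ l, a ≠ b → y a * y b = -(y b * y a)) :
    revProd y l = revProd y l' ∨ revProd y l = -revProd y l' := by
  induction h with
  | nil => simp
  | cons i h ih =>
    rcases ih hl.of_cons fun a ha b hb => hy a (by simp [ha]) b (by simp [hb]) with h | h <;>
      simp [h]
  | swap a b l =>
    right
    have := hy a (by simp) b (by simp) (by rintro rfl; simp at hl)
    simp [mul_assoc, this]
  | trans h₁ h₂ ih₁ ih₂ =>
    have := ih₂ (h₁.nodup hl) fun a ha b hb => hy a (h₁.mem_iff.2 ha) b (h₁.mem_iff.2 hb)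
    rcases ih₁ hl hy with h | h <;> rcases this with h' | h' <;> simp [h, h']

lemma prod_one_sub_sq_perm {l l' : List ι} (h : l.Perm l')
    (hy : ∀ a ∈ l, ∀ b ∈ l, a ≠ b → y a * y b = -(y b * y a)) :
    (l.map fun a => 1 - y a * y a).prod = (l'.map fun a => 1 - y a * y a).prod := by
  refine List.Perm.prod_eq' (h.map _) (List.pairwise_iff_forall_sublist.2 ?_)
  intro x z hxz
  have hx : x ∈ l.map fun a => 1 - y a * y a := hxz.subset (by simp)
  have hz : z ∈ l.map fun a => 1 - y a * y a := hxz.subset (by simp)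
  obtain ⟨a, ha, rfl⟩ := List.mem_map.1 hx
  obtain ⟨b, hb, rfl⟩ := List.mem_map.1 hz
  by_cases hab : a = b
  · subst hab
    exact Commute.refl _
  have h := commute_sq_of_anticommute (hy a ha b hb hab)
  exact ((Commute.one_right _).sub_right ((Commute.one_left _).sub_left (h.mul_left h)))

end Anticommuting

namespace Rel

variable {ι A : Type*} [Ring A] {e : ι → ι → A}

lemma sq' (h : Rel e) (a b : ι) : e a b * e b a = 0 := by
  rw [h.symm b a, h.sq]

/-- The relations follow from their instances with distinct indices. -/
lemma of_distinct (symm : ∀ a b, e a b = e b a) (diag : ∀ a, e a a = 0)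
    (sq : ∀ a b, a ≠ b → e a b * e a b = 0)
    (anti : ∀ a b c d, a ≠ b → c ≠ d → a ≠ c → a ≠ d → b ≠ c → b ≠ d →
      e a b * e c d + e c d * e a b = 0)
    (tri : ∀ a b c, a ≠ b → b ≠ c → c ≠ a →
      e a b * e b c + e b c * e c a + e c a * e a b = 0) : Rel e := by
  have sq' : ∀ a b, e a b * e a b = 0 := fun a b => by
    by_cases hab : a = b
    · simp [hab, diag]
    · exact sq a b hab
  have sq'' : ∀ a b, e a b * e b a = 0 := fun a b => by rw [symm b a, sq']
  refine ⟨symm, diag, sq', fun a b c d h₁ h₂ h₃ h₄ => ?_, fun a b c => ?_⟩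
  · by_cases hab : a = b
    · simp [hab, diag]
    by_cases hcd : c = d
    · simp [hcd, diag]
    exact anti a b c d hab hcd h₁ h₂ h₃ h₄
  · by_cases hab : a = b
    · simp [hab, diag, sq'']
    by_cases hbc : b = c
    · simp [hbc, diag, sq'']
    by_cases hca : c = a
    · simp [hca, diag, sq'']
    exact tri a b c hab hbc hca

variable [DecidableEq ι]

lemma theta_eq_add (S : Finset ι) (a b : ι) :
    theta e S a = theta e (S.erase b) a + restr e S a b := by
  unfold theta restr
  split_ifs with hb
  · rw [Finset.sum_erase_add _ _ hb]
  · rw [Finset.erase_eq_of_notMem hb, add_zero]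

lemma theta_anticomm (h : Rel e) {S : Finset ι} {a b : ι} (ha : a ∈ S) (hb : b ∈ S)
    (hab : a ≠ b) : theta e S a * theta e S b = -(theta e S b * theta e S a) := by
  have key : ∀ T : Finset ι, a ∉ T → b ∉ T →
      e a b * theta e T b + theta e T a * e a b + theta e T a * theta e T b
      + (e a b * theta e T a + theta e T b * e a b + theta e T b * theta e T a) = 0 := by
    intro T haT hbT
    have h1 : theta e T a * theta e T b + theta e T b * theta e T a
        = ∑ c ∈ T, (e a c * e b c + e b c * e a c) := by
      unfold theta
      rw [Finset.sum_mul_sum, Finset.sum_mul_sum, Finset.sum_comm (s := T) (t := T)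
        (f := fun i j => e b i * e a j), ← Finset.sum_add_distrib]
      refine Finset.sum_congr rfl fun c hc => ?_
      rw [← Finset.sum_add_distrib]
      refine Finset.sum_eq_single_of_mem c hc fun d hd hdc => ?_
      exact h.anti _ _ _ _ hab (by rintro rfl; exact haT hd) (by rintro rfl; exact hbT hc)
        hdc.symm
    have h2 : e a b * theta e T b + theta e T a * e a b + (e a b * theta e T a + theta e T b * e a b)
        = ∑ c ∈ T, (e a b * e b c + e a c * e a b + (e a b * e a c + e b c * e a b)) := by
      simp only [theta, Finset.mul_sum, Finset.sum_mul, Finset.sum_add_distrib]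
    calc _ = (e a b * theta e T b + theta e T a * e a b
            + (e a b * theta e T a + theta e T b * e a b))
          + (theta e T a * theta e T b + theta e T b * theta e T a) := by abel
      _ = 0 := by
        rw [h1, h2, ← Finset.sum_add_distrib]
        refine Finset.sum_eq_zero fun c _ => ?_
        have t1 := h.tri a b c
        have t2 := h.tri b a c
        rw [h.symm c a] at t1
        rw [h.symm c b, h.symm b a] at t2
        calc _ = (e a b * e b c + e b c * e a c + e a c * e a b)
              + (e a b * e a c + e a c * e b c + e b c * e a b) := by abel
          _ = 0 := by rw [t1, t2, add_zero]
  have hS : ∀ c, theta e S c = theta e ((S.erase a).erase b) c + e c a + e c b := by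
    intro c
    rw [theta_eq_add S c a, theta_eq_add (S.erase a) c b]
    simp only [restr, ha, if_true, Finset.mem_erase, hb, and_true, ne_eq, hab.symm, not_false_eq_true]
    abel
  have := key ((S.erase a).erase b) (by simp) (by simp)
  rw [eq_neg_iff_add_eq_zero, hS a, hS b, h.diag, h.diag, h.symm b a]
  refine Eq.trans ?_ this
  simp only [add_zero, add_mul, mul_add, h.sq]
  abel

lemma restr_mul_add_theta (h : Rel e) {S : Finset ι} {u : ℤ} {i j m : ι}
    (hi : i ∈ S) (hm : m ∈ S) (hij : i ≠ j) (him : i ≠ m) (hmj : m ≠ j) :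
    restr e S m j * (u + theta e (S.erase j) i) + restr e S m i * restr e S i j
      = (u - theta e (S.erase m) i) * restr e S m j := by
  by_cases hj : j ∈ S
  swap
  · simp [restr, hj]
  have h1 := Rel.theta_eq_add (e := e) (S.erase j) i m
  have h2 := Rel.theta_eq_add (e := e) (S.erase m) i j
  rw [Finset.erase_right_comm] at h2
  have h3 : e m j * theta e ((S.erase j).erase m) i + theta e ((S.erase j).erase m) i * e m j
      = 0 := by
    rw [theta, Finset.mul_sum, Finset.sum_mul, ← Finset.sum_add_distrib]
    refine Finset.sum_eq_zero fun c hc => ?_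
    simp only [Finset.mem_erase] at hc
    exact h.anti _ _ _ _ him.symm (Ne.symm hc.1) hij.symm (Ne.symm hc.2.1)
  have h4 := h.tri j m i
  rw [h.symm j m] at h4
  have hu := (Int.cast_commute u (e m j)).eq
  rw [h1, h2]
  simp only [restr, hi, hm, hj, if_true, Finset.mem_erase, hmj, hmj.symm, ne_eq,
    not_false_eq_true, and_self]
  rw [← sub_eq_zero, h.symm i m, sub_mul, hu]
  calc _ = (e m j * theta e ((S.erase j).erase m) i + theta e ((S.erase j).erase m) i * e m j)
        + (e m j * e m i + e m i * e i j + e i j * e m j) := by noncomm_ring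
    _ = 0 := by rw [h3, h4, add_zero]

end Rel

/-- A complete family of orthogonal idempotents which the generators `e a b` permute by the
transposition of `a` and `b`. -/
structure Mark {ι A : Type*} [Fintype ι] [Ring A] (e : ι → ι → A) (π : ι → A) : Prop where
  rel : Rel e
  idem : ∀ a, π a * π a = π a
  orth : ∀ a b, a ≠ b → π a * π b = 0
  sum : ∑ a, π a = 1
  swap : ∀ a b, e a b * π a = π b * e a b
  comm : ∀ a b c, c ≠ a → c ≠ b → e a b * π c = π c * e a b

/-- An involution anticommuting with the generators and commuting with the idempotents. -/
structure Grading {ι A : Type*} [Ring A] (e : ι → ι → A) (π : ι → A) (σ : A) : Prop where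
  sq : σ * σ = 1
  anti : ∀ a b, σ * e a b = -(e a b * σ)
  comm : ∀ a, σ * π a = π a * σ

/-- The product of the `u + θ` along a list, in reverse order. -/
abbrev thetaProd {ι A : Type*} [Ring A] (e : ι → ι → A) (S : Finset ι) (u : ℤ) (l : List ι) : A :=
  revProd (fun i => (u : A) + theta e S i) l

/-- The product of the `u - θ` along a list, in reverse order. -/
abbrev thetaProdNeg {ι A : Type*} [Ring A] (e : ι → ι → A) (S : Finset ι) (u : ℤ) (l : List ι) :
    A :=
  revProd (fun i => (u : A) - theta e S i) l

namespace Mark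

variable {ι A : Type*} [Fintype ι] [Ring A] {e : ι → ι → A} {π : ι → A}
  (h : Mark e π) {S : Finset ι} {u : ℤ}
include h

lemma pi_mul_e (a b : ι) : π a * e a b = e a b * π b := by
  rw [h.rel.symm a b, h.swap]

lemma commute_theta {a b : ι} (hab : a ≠ b) (hb : b ∉ S) : Commute (theta e S a) (π b) := by
  refine Commute.sum_left _ _ _ fun c hc => ?_
  exact h.comm _ _ _ hab.symm (by rintro rfl; exact hb hc)

lemma commute_add_theta {a b : ι} (hab : a ≠ b) (hb : b ∉ S) :
    Commute ((u : A) + theta e S a) (π b) :=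
  (Int.cast_commute u (π b)).add_left (h.commute_theta hab hb)

lemma commute_thetaProd {b : ι} {l : List ι} (hl : b ∉ l) (hb : b ∉ S) :
    Commute (thetaProd e S u l) (π b) :=
  (commute_revProd fun a ha =>
    (h.commute_add_theta (by rintro rfl; exact hl ha) hb).symm).symm

variable [DecidableEq ι]

lemma pi_mul_restr (a b : ι) : π a * restr e S a b = restr e S a b * π b := by
  unfold restr
  split_ifs
  · exact h.pi_mul_e a b
  · simp

lemma restr_mul_pi (a b : ι) : restr e S a b * π a = π b * restr e S a b := by
  unfold restr
  split_ifs
  · exact h.swap a b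
  · simp

lemma theta_mul_pi {a b : ι} (hab : a ≠ b) :
    theta e S a * π b = π b * theta e (S.erase b) a + π a * restr e S a b := by
  rw [Rel.theta_eq_add S a b, add_mul, (h.commute_theta hab (by simp)).eq, h.pi_mul_restr]

lemma pi_mul_theta {a b : ι} (hab : a ≠ b) :
    π b * theta e S a = theta e (S.erase b) a * π b + restr e S a b * π a := by
  rw [Rel.theta_eq_add S a b, mul_add, (h.commute_theta hab (by simp)).eq, h.restr_mul_pi]

lemma add_theta_mul_pi {a b : ι} (hab : a ≠ b) :
    ((u : A) + theta e S a) * π b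
      = π b * (u + theta e (S.erase b) a) + π a * restr e S a b := by
  rw [add_mul, h.theta_mul_pi hab, mul_add, (Int.cast_commute u (π b)).eq, add_assoc]

lemma pi_mul_thetaProd_mul_pi_of_notMem {i j : ι} (hij : i ≠ j) {l : List ι} (hl : l.Nodup)
    (hi : i ∉ l) (hj : j ∉ l) : π i * thetaProd e S u l * π j = 0 := by
  induction l generalizing j with
  | nil => simpa using h.orth i j hij
  | cons k l ih =>
    simp only [List.mem_cons, not_or, List.nodup_cons] at hi hj hl
    have hk := h.add_theta_mul_pi (u := u) (S := S) (Ne.symm hj.1)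
    calc _ = π i * thetaProd e S u l * (((u : A) + theta e S k) * π j) := by
          simp only [revProd_cons, mul_assoc]
      _ = π i * thetaProd e S u l * π j * (u + theta e (S.erase j) k)
          + π i * thetaProd e S u l * π k * restr e S k j := by
          rw [hk]; noncomm_ring
      _ = 0 := by
        rw [ih hij hl.2 hi.2 hj.2, ih hi.1 hl.2 hi.2 hl.1, zero_mul, zero_mul, add_zero]

lemma pi_mul_thetaProd_mul_pi_self {j : ι} {l : List ι} (hl : l.Nodup) (hj : j ∉ l) :
    π j * thetaProd e S u l * π j = thetaProd e (S.erase j) u l * π j := by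
  induction l with
  | nil => simpa using h.idem j
  | cons i l ih =>
    simp only [List.mem_cons, not_or, List.nodup_cons] at hj hl
    have hk := h.add_theta_mul_pi (u := u) (S := S) (Ne.symm hj.1)
    calc _ = π j * thetaProd e S u l * (((u : A) + theta e S i) * π j) := by
          simp only [revProd_cons, mul_assoc]
      _ = π j * thetaProd e S u l * π j * (u + theta e (S.erase j) i)
          + π j * thetaProd e S u l * π i * restr e S i j := by
          rw [hk]; noncomm_ring
      _ = _ := by
        rw [ih hl.2 hj.2, h.pi_mul_thetaProd_mul_pi_of_notMem hj.1 hl.2 hj.2 hl.1, zero_mul,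
          add_zero, mul_assoc, ← (h.commute_add_theta (Ne.symm hj.1) (by simp)).eq]
        simp only [revProd_cons, mul_assoc]

lemma pi_mul_thetaProd_mul_pi_of_mem {m j : ι} {l₁ l₂ : List ι} (hl : (l₂ ++ m :: l₁).Nodup)
    (hS : ∀ a ∈ l₂ ++ m :: l₁, a ∈ S) (hj : j ∉ l₂ ++ m :: l₁) :
    π m * thetaProd e S u (l₂ ++ m :: l₁) * π j
      = thetaProd e (S.erase m) u l₁ * thetaProdNeg e (S.erase m) u l₂
        * (restr e S m j * π j) := by
  induction l₂ generalizing j with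
  | nil =>
    simp only [List.nil_append, List.mem_cons, not_or, List.nodup_cons] at hj hl ⊢
    have hk := h.add_theta_mul_pi (u := u) (S := S) (Ne.symm hj.1)
    calc _ = π m * thetaProd e S u l₁ * (((u : A) + theta e S m) * π j) := by
          simp only [revProd_cons, mul_assoc]
      _ = π m * thetaProd e S u l₁ * π j * (u + theta e (S.erase j) m)
          + π m * thetaProd e S u l₁ * π m * restr e S m j := by
          rw [hk]; noncomm_ring
      _ = _ := by
        rw [h.pi_mul_thetaProd_mul_pi_of_notMem (Ne.symm hj.1) hl.2 hl.1 hj.2,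
          h.pi_mul_thetaProd_mul_pi_self hl.2 hl.1, mul_assoc, h.pi_mul_restr]
        simp
  | cons i l₂ ih =>
    simp only [List.cons_append, List.nodup_cons] at hl
    have hi := hl.1
    rw [List.cons_append, List.mem_cons, not_or] at hj
    have hS' : ∀ a ∈ l₂ ++ m :: l₁, a ∈ S := fun a ha => hS a (List.mem_cons_of_mem _ ha)
    have hiS : i ∈ S := hS i (by simp)
    have hmS : m ∈ S := hS m (by simp)
    have him : i ≠ m := by rintro rfl; simp at hi
    have hmj : m ≠ j := by rintro rfl; simp at hj
    have hk := h.add_theta_mul_pi (u := u) (S := S) (Ne.symm hj.1)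
    have hc := (h.commute_add_theta (u := u) (Ne.symm hj.1) (Finset.notMem_erase j S)).eq
    calc _ = π m * thetaProd e S u (l₂ ++ m :: l₁) * (((u : A) + theta e S i) * π j) := by
          simp only [List.cons_append, revProd_cons, mul_assoc]
      _ = π m * thetaProd e S u (l₂ ++ m :: l₁) * π j * (u + theta e (S.erase j) i)
          + π m * thetaProd e S u (l₂ ++ m :: l₁) * π i * restr e S i j := by
          rw [hk]; noncomm_ring
      _ = thetaProd e (S.erase m) u l₁ * thetaProdNeg e (S.erase m) u l₂
          * (restr e S m j * (π j * (u + theta e (S.erase j) i))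
            + restr e S m i * (π i * restr e S i j)) := by
          rw [ih hl.2 hS' hj.2, ih hl.2 hS' hi]
          simp only [mul_add, mul_assoc]
      _ = thetaProd e (S.erase m) u l₁ * thetaProdNeg e (S.erase m) u l₂
          * ((restr e S m j * (u + theta e (S.erase j) i) + restr e S m i * restr e S i j)
            * π j) := by
          rw [← hc, h.pi_mul_restr]; simp only [add_mul, mul_assoc]
      _ = _ := by
          rw [h.rel.restr_mul_add_theta hiS hmS (Ne.symm hj.1) him hmj]
          simp only [revProd_cons, mul_assoc]

lemma pi_mul_thetaProd_concat_mul_pi {b : ι} {l : List ι} (hl : (l ++ [b]).Nodup)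
    (hS : ∀ a ∈ l ++ [b], a ∈ S) :
    π b * thetaProd e S u (l ++ [b]) * π b = u * thetaProd e (S.erase b) u l * π b := by
  induction l with
  | nil =>
    have h0 : π b * theta e S b * π b = 0 := by
      rw [theta, Finset.mul_sum, Finset.sum_mul]
      refine Finset.sum_eq_zero fun c _ => ?_
      by_cases hc : c = b
      · simp [hc, h.rel.diag]
      · rw [h.pi_mul_e, mul_assoc, h.orth c b hc, mul_zero]
    simp only [List.nil_append, revProd_cons, revProd_nil, one_mul, mul_one, mul_add, add_mul, h0,
      add_zero]
    rw [(Int.cast_commute u (π b)).eq.symm, mul_assoc, h.idem]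
  | cons i l ih =>
    simp only [List.cons_append, List.nodup_cons] at hl
    have hi := hl.1
    have hS' : ∀ a ∈ l ++ [b], a ∈ S := fun a ha => hS a (List.mem_cons_of_mem _ ha)
    have hib : i ≠ b := by rintro rfl; simp at hi
    have hk := h.add_theta_mul_pi (u := u) (S := S) hib
    have hc := (h.commute_add_theta (u := u) hib (Finset.notMem_erase b S)).eq
    have hz : restr e S b i * (π i * restr e S i b) = 0 := by
      rw [h.pi_mul_restr, ← mul_assoc]
      unfold restr
      split_ifs <;> simp [h.rel.sq']
    calc _ = π b * thetaProd e S u (l ++ [b]) * (((u : A) + theta e S i) * π b) := by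
          simp only [List.cons_append, revProd_cons, mul_assoc]
      _ = π b * thetaProd e S u (l ++ [b]) * π b * (u + theta e (S.erase b) i)
          + π b * thetaProd e S u (l ++ [b]) * π i * restr e S i b := by
          rw [hk]; noncomm_ring
      _ = _ := by
        rw [ih hl.2 hS', h.pi_mul_thetaProd_mul_pi_of_mem hl.2 hS' hi, mul_assoc _ (_ * π i),
          mul_assoc _ (π i), hz, mul_zero, add_zero, mul_assoc, ← hc]
        simp only [revProd_cons, mul_assoc]

end Mark

/-- The linear coefficient in `t` of the product of the `1 + θ + t σ π` along a list, in reverse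
order. -/
def thetaProdLin {ι A : Type*} [Ring A] (e : ι → ι → A) (S : Finset ι) (π : ι → A) (σ : A) :
    List ι → A
  | [] => 0
  | i :: l => thetaProdLin e S π σ l * (((1 : ℤ) : A) + theta e S i)
      + thetaProd e S 1 l * (σ * π i)

namespace Grading

variable {ι A : Type*} [Ring A] {e : ι → ι → A} {π : ι → A} {σ : A} (g : Grading e π σ)
  {S : Finset ι} {u : ℤ}
include g

lemma mul_theta (a : ι) : σ * theta e S a = -(theta e S a * σ) := by
  simp only [theta, Finset.mul_sum, Finset.sum_mul, g.anti, Finset.sum_neg_distrib]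

lemma thetaProdNeg_mul (l : List ι) :
    thetaProdNeg e S u l * σ = σ * thetaProd e S u l := by
  induction l with
  | nil => simp
  | cons i l ih =>
    have hi : (u - theta e S i) * σ = σ * (u + theta e S i) := by
      rw [mul_add, g.mul_theta, sub_mul, (Int.cast_commute u σ).eq, sub_eq_add_neg]
    simp only [revProd_cons, mul_assoc, hi]
    rw [← mul_assoc, ih, mul_assoc]

end Grading

namespace Mark

variable {ι A : Type*} [Fintype ι] [DecidableEq ι] [Ring A] {e : ι → ι → A} {π : ι → A} {σ : A}
  (h : Mark e π) {S : Finset ι}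
include h

lemma theta_mul_pi_self (b : ι) : theta e S b * π b = ∑ c, π c * restr e S b c := by
  rw [Finset.sum_congr rfl fun c _ => (h.restr_mul_pi (S := S) b c).symm, ← Finset.sum_mul]
  simp only [restr, theta, Finset.sum_ite_mem, Finset.univ_inter]

lemma thetaProdLin_mul_pi_of_notMem {b : ι} {l : List ι} (hl : l.Nodup) (hb : b ∉ l) :
    thetaProdLin e S π σ l * π b = 0 := by
  induction l generalizing b with
  | nil => simp [thetaProdLin]
  | cons i l ih =>
    simp only [List.mem_cons, not_or, List.nodup_cons] at hb hl
    rw [thetaProdLin, add_mul, mul_assoc, h.add_theta_mul_pi (Ne.symm hb.1), mul_add, ← mul_assoc,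
      ih hl.2 hb.2, ← mul_assoc, ih hl.2 hl.1, mul_assoc, mul_assoc, h.orth i b (Ne.symm hb.1)]
    simp

lemma thetaProdLin_mul_pi_of_mem (g : Grading e π σ) {b : ι} {l l₁ l₂ : List ι}
    (hl₁₂ : l = l₂ ++ b :: l₁) (hl : l.Nodup) (hS : ∀ a ∈ l, a ∈ S) :
    thetaProdLin e S π σ l * π b
      = thetaProd e (S.erase b) 1 l₁ * σ * thetaProd e (S.erase b) 1 l₂ * π b := by
  induction l generalizing b l₁ l₂ with
  | nil => simp at hl₁₂
  | cons i l ih =>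
    have hS' : ∀ a ∈ l, a ∈ S := fun a ha => hS a (List.mem_cons_of_mem _ ha)
    have hl' := hl.of_cons
    have hi := (List.nodup_cons.1 hl).1
    have hiS : i ∈ S := hS i (by simp)
    cases l₂ with
    | nil =>
      simp only [List.nil_append, List.cons.injEq] at hl₁₂
      obtain ⟨rfl, rfl⟩ := hl₁₂
      have hcancel : ∀ c ∈ Finset.univ.erase i, thetaProdLin e S π σ l * (π c * restr e S i c)
          + π c * thetaProd e S 1 l * π i * σ = 0 := by
        intro c hc
        have hci : c ≠ i := (Finset.mem_erase.1 hc).1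
        by_cases hcl : c ∈ l
        · obtain ⟨l₂, l₁, rfl⟩ := List.append_of_mem hcl
          rw [← mul_assoc, ih rfl hl' hS', h.pi_mul_thetaProd_mul_pi_of_mem hl' hS' hi]
          have hcS : c ∈ S := hS' c hcl
          simp only [restr, hcS, hiS, if_true, mul_assoc]
          have e1 : π c * e i c = e i c * π i := by rw [h.swap]
          have e2 : e c i * (π i * σ) = -(σ * (e i c * π i)) := by
            rw [← g.comm, ← mul_assoc, ← mul_assoc, g.anti, h.rel.symm i c, neg_mul, neg_neg]
          rw [e1, e2, mul_neg, mul_neg, ← mul_assoc (revProd _ l₂) σ, g.thetaProdNeg_mul]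
          simp only [mul_assoc, add_neg_cancel]
        · rw [h.pi_mul_thetaProd_mul_pi_of_notMem hci hl' hcl hi, ← mul_assoc,
            h.thetaProdLin_mul_pi_of_notMem hl' hcl]
          simp
      have h0 : thetaProdLin e S π σ l * (π i * restr e S i i) = 0 := by
        simp [restr, h.rel.diag]
      have h1 : thetaProd e S 1 l * π i = ∑ c, π c * thetaProd e S 1 l * π i := by
        rw [← Finset.sum_mul, ← Finset.sum_mul, h.sum, one_mul]
      calc _ = thetaProdLin e S π σ l * π i + thetaProdLin e S π σ l * (theta e S i * π i)
            + thetaProd e S 1 l * π i * σ := by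
            rw [thetaProdLin, add_mul]
            have hσ : σ * (π i * π i) = π i * σ := by rw [h.idem, g.comm]
            simp only [mul_assoc _ _ (π i), hσ, Int.cast_one, add_mul, one_mul, mul_add]
            rw [mul_assoc _ (π i) σ]
        _ = ∑ c, (thetaProdLin e S π σ l * (π c * restr e S i c)
              + π c * thetaProd e S 1 l * π i * σ) := by
            rw [h.thetaProdLin_mul_pi_of_notMem hl' hi, h.theta_mul_pi_self, h1, Finset.mul_sum,
              zero_add, Finset.sum_mul, Finset.sum_add_distrib]
        _ = π i * thetaProd e S 1 l * π i * σ := by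
            rw [← Finset.add_sum_erase _ _ (Finset.mem_univ i), Finset.sum_eq_zero hcancel, h0,
              add_zero, zero_add]
        _ = _ := by
            rw [h.pi_mul_thetaProd_mul_pi_self hl' hi, mul_assoc, ← g.comm]
            simp [mul_assoc]
    | cons j l₂ =>
      simp only [List.cons_append, List.cons.injEq] at hl₁₂
      obtain ⟨rfl, hll⟩ := hl₁₂
      have hib : i ≠ b := by rintro rfl; exact hi (by simp [hll])
      rw [thetaProdLin, add_mul, mul_assoc, h.add_theta_mul_pi hib, mul_add, ← mul_assoc,
        ih hll hl' hS', ← mul_assoc, h.thetaProdLin_mul_pi_of_notMem hl' hi, mul_assoc _ (_ * π i),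
        mul_assoc σ, h.orth i b hib, mul_assoc _ (π b) (_ + _),
        ← (h.commute_add_theta hib (Finset.notMem_erase b S)).eq]
      simp only [revProd_cons, mul_assoc, mul_zero, zero_mul, add_zero]

lemma theta_hat_anticomm (g : Grading e π σ) {a b : ι} (ha : a ∈ S) (hb : b ∈ S) (hab : a ≠ b) :
    theta e S a * (σ * π b) + σ * π a * theta e S b + (theta e S b * (σ * π a)
      + σ * π b * theta e S a) = 0 := by
  have h1 := h.theta_mul_pi (S := S) hab
  have h2 := h.theta_mul_pi (S := S) hab.symm
  have h3 := h.pi_mul_theta (S := S) hab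
  have h4 := h.pi_mul_theta (S := S) hab.symm
  rw [← (h.commute_theta hab (by simp)).eq] at h1
  rw [← (h.commute_theta hab.symm (by simp)).eq] at h2
  simp only [restr, ha, hb, if_true] at h1 h2 h3 h4
  have hσ : ∀ a b, theta e S a * (σ * π b) = -(σ * (theta e S a * π b)) := by
    intro a b
    rw [← mul_assoc, ← mul_assoc, g.mul_theta, neg_mul, neg_neg]
  rw [hσ, hσ, mul_assoc, mul_assoc, h1, h2, h3, h4, h.rel.symm b a, h.swap a b, h.pi_mul_e]
  noncomm_ring

end Mark

section Opposite

open MulOpposite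

variable {ι A : Type*} [Ring A] {e : ι → ι → A} {π : ι → A} {σ : A}

/-- The negated generators in the opposite ring. -/
def opGen (e : ι → ι → A) (a b : ι) : Aᵐᵒᵖ := op (-e a b)

lemma Rel.opGen (h : Rel e) : Rel (opGen e) where
  symm a b := by simp [DunklElements.opGen, h.symm a b]
  diag a := by simp [DunklElements.opGen, h.diag]
  sq a b := by simp [DunklElements.opGen, ← op_mul, h.sq]
  anti a b c d h₁ h₂ h₃ h₄ := by
    have := h.anti a b c d h₁ h₂ h₃ h₄
    simp only [DunklElements.opGen, ← op_mul, ← op_add, neg_mul_neg]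
    rw [add_comm, this, op_zero]
  tri a b c := by
    have := h.tri c b a
    simp only [DunklElements.opGen, ← op_mul, ← op_add, neg_mul_neg]
    rw [h.symm c b, h.symm b a, h.symm a c] at this
    rw [add_right_comm, this, op_zero]

lemma Mark.opGen [Fintype ι] (h : Mark e π) :
    Mark (DunklElements.opGen e) (fun a => op (π a)) where
  rel := h.rel.opGen
  idem a := by rw [← op_mul, h.idem]
  orth a b hab := by rw [← op_mul, h.orth b a hab.symm, op_zero]
  sum := by rw [← Finset.op_sum, h.sum, op_one]
  swap a b := by
    rw [DunklElements.opGen, ← op_mul, ← op_mul, mul_neg, neg_mul, h.rel.symm a b, h.swap b a]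
  comm a b c hca hcb := by
    rw [DunklElements.opGen, ← op_mul, ← op_mul, mul_neg, neg_mul, h.comm a b c hca hcb]

lemma Grading.opGen (g : Grading e π σ) :
    Grading (DunklElements.opGen e) (fun a => op (π a)) (op (-σ)) where
  sq := by rw [← op_mul, neg_mul_neg, g.sq, op_one]
  anti a b := by
    rw [DunklElements.opGen, ← op_mul, ← op_mul, ← op_neg, neg_mul_neg, neg_mul_neg, g.anti,
      neg_neg]
  comm a := by rw [← op_mul, ← op_mul, mul_neg, neg_mul, g.comm]

lemma theta_opGen (S : Finset ι) (a : ι) :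
    theta (DunklElements.opGen e) S a = op (-theta e S a) := by
  simp only [theta, DunklElements.opGen, ← Finset.op_sum, Finset.sum_neg_distrib]

lemma thetaProd_opGen (S : Finset ι) (u : ℤ) (l : List ι) :
    thetaProd (DunklElements.opGen e) S u l
      = op (l.map fun i => (u : A) - theta e S i).prod := by
  rw [← op_revProd]
  simp [thetaProd, theta_opGen, sub_eq_add_neg]

end Opposite

section Polynomial

open Polynomial

variable {A : Type*} [Ring A]

lemma linear_mul_linear (a b c d : A) :
    (C a + X * C b) * (C c + X * C d)
      = C (a * c) + X * C (a * d + b * c) + X ^ 2 * C (b * d) := by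
  have hX : ∀ z : A, C z * X = X * C z := fun z => (X_mul_C z).symm
  simp only [mul_add, add_mul, map_mul, map_add, mul_assoc]
  rw [← mul_assoc (C a) X, ← mul_assoc (C b) X, hX, hX, pow_two]
  simp only [mul_assoc]
  abel

lemma coeff_quadratic (x y z : A) (i : ℕ) : coeff (C x + X * C y + X ^ 2 * C z) i
    = if i = 0 then x else if i = 1 then y else if i = 2 then z else 0 := by
  rcases i with _ | _ | _ | i <;> simp [coeff_C]

lemma commute_quadratic {p q r m n k : A}
    (h : Commute (C p + X * C q + X ^ 2 * C r) (C m + X * C n + X ^ 2 * C k)) :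
    r * k = k * r ∧ q * k + r * n = k * q + n * r
      ∧ p * k + q * n + r * m = k * p + n * q + m * r := by
  have h4 := congrArg (fun f => coeff f 4) h.eq
  have h3 := congrArg (fun f => coeff f 3) h.eq
  have h2 := congrArg (fun f => coeff f 2) h.eq
  simp only [coeff_mul, coeff_quadratic, Finset.Nat.antidiagonal_succ,
    Finset.Nat.antidiagonal_zero] at h2 h3 h4
  simp at h2 h3 h4
  refine ⟨h4, ?_, ?_⟩
  · rw [h3]; abel
  · rw [add_assoc, h2]; abel

open MulOpposite

variable {ι : Type*} {e : ι → ι → A} {π : ι → A} {σ : A}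
  {S : Finset ι}

/-- The deformed element `θ + t σ π`. -/
noncomputable def thetaHat (e : ι → ι → A) (S : Finset ι) (π : ι → A) (σ : A) (a : ι) : A[X] :=
  C (theta e S a) + X * C (σ * π a)

/-- The linear coefficient in `t` of the product of the `1 - (θ + t σ π)` along a list. -/
def thetaProdLin' (e : ι → ι → A) (S : Finset ι) (π : ι → A) (σ : A) (l : List ι) : A :=
  unop (thetaProdLin (opGen e) S (fun a => op (π a)) (op (-σ)) l)

lemma thetaProdLin'_cons (i : ι) (l : List ι) : thetaProdLin' e S π σ (i :: l)
    = (((1 : ℤ) : A) - theta e S i) * thetaProdLin' e S π σ l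
      - π i * σ * (l.map fun i => ((1 : ℤ) : A) - theta e S i).prod := by
  simp only [thetaProdLin', thetaProdLin, thetaProd_opGen, theta_opGen, unop_add, unop_mul,
    unop_op, unop_intCast]
  noncomm_ring

variable [Fintype ι]

namespace Mark

lemma thetaHat_sq (h : Mark e π) (g : Grading e π σ) (a : ι) :
    thetaHat e S π σ a * thetaHat e S π σ a = C (theta e S a * theta e S a)
      + X * C (theta e S a * (σ * π a) + σ * π a * theta e S a) + X ^ 2 * C (π a) := by
  have h2 : σ * π a * (σ * π a) = π a := by
    rw [g.comm a, mul_assoc, ← g.comm a, ← mul_assoc σ, g.sq, one_mul, h.idem]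
  rw [thetaHat, linear_mul_linear, h2]

variable [DecidableEq ι]

lemma pi_mul_thetaProdLin'_of_notMem (h : Mark e π) {b : ι} {l : List ι} (hl : l.Nodup)
    (hb : b ∉ l) : π b * thetaProdLin' e S π σ l = 0 := by
  have := congrArg unop (h.opGen.thetaProdLin_mul_pi_of_notMem (S := S) (σ := op (-σ)) hl hb)
  simpa only [thetaProdLin', unop_mul, unop_op, unop_zero] using this

lemma revProd_one_add_thetaHat (h : Mark e π) (g : Grading e π σ) {l : List ι} (hl : l.Nodup) :
    revProd (fun a => ((1 : ℤ) : A[X]) + thetaHat e S π σ a) l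
      = C (thetaProd e S 1 l) + X * C (thetaProdLin e S π σ l) := by
  induction l with
  | nil => simp [thetaProdLin]
  | cons i l ih =>
    have h0 : thetaProdLin e S π σ l * (σ * π i) = 0 := by
      rw [g.comm, ← mul_assoc,
        h.thetaProdLin_mul_pi_of_notMem hl.of_cons (List.nodup_cons.1 hl).1, zero_mul]
    have h1 : ((1 : ℤ) : A[X]) + thetaHat e S π σ i
        = C (((1 : ℤ) : A) + theta e S i) + X * C (σ * π i) := by
      simp [thetaHat, add_assoc]
    rw [revProd_cons, ih hl.of_cons, h1, linear_mul_linear, h0, thetaProdLin,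
      add_comm (thetaProd e S 1 l * _), map_zero, mul_zero, add_zero, ← revProd_cons]

lemma prod_one_sub_thetaHat (h : Mark e π) (g : Grading e π σ) {l : List ι} (hl : l.Nodup) :
    (l.map fun a => ((1 : ℤ) : A[X]) - thetaHat e S π σ a).prod
      = C (l.map fun i => ((1 : ℤ) : A) - theta e S i).prod + X * C (thetaProdLin' e S π σ l) := by
  induction l with
  | nil => simp [thetaProdLin', thetaProdLin]
  | cons i l ih =>
    have h0 : -(σ * π i) * thetaProdLin' e S π σ l = 0 := by
      rw [neg_mul, mul_assoc,
        h.pi_mul_thetaProdLin'_of_notMem hl.of_cons (List.nodup_cons.1 hl).1, mul_zero, neg_zero]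
    have h1 : ((1 : ℤ) : A[X]) - thetaHat e S π σ i
        = C (((1 : ℤ) : A) - theta e S i) + X * C (-(σ * π i)) := by
      simp only [thetaHat, map_sub, map_neg, mul_neg, Int.cast_one, map_one]
      abel
    rw [List.map_cons, List.prod_cons, ih hl.of_cons, h1, linear_mul_linear, h0,
      thetaProdLin'_cons, ← g.comm, List.map_cons, List.prod_cons, neg_mul, ← sub_eq_add_neg]
    simp

lemma thetaHat_anticomm (h : Mark e π) (g : Grading e π σ) {a b : ι} (ha : a ∈ S) (hb : b ∈ S)
    (hab : a ≠ b) : thetaHat e S π σ a * thetaHat e S π σ b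
      = -(thetaHat e S π σ b * thetaHat e S π σ a) := by
  have h2 : ∀ a b, σ * π a * (σ * π b) = π a * π b := by
    intro a b
    rw [g.comm a, mul_assoc, ← mul_assoc σ, g.sq, one_mul]
  have h1 := h.theta_hat_anticomm g ha hb hab
  have h0 := h.rel.theta_anticomm ha hb hab
  rw [eq_neg_iff_add_eq_zero]
  unfold thetaHat
  rw [linear_mul_linear, linear_mul_linear, h2, h2, h.orth a b hab, h.orth b a hab.symm, h0,
    eq_neg_of_add_eq_zero_left h1]
  simp only [map_neg, mul_neg, map_zero, mul_zero, add_zero]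
  abel

end Mark

end Polynomial

section Polynomial

open Polynomial MulOpposite

variable {ι A : Type*} [Ring A] {e : ι → ι → A} {π : ι → A} {σ : A}
  {S : Finset ι}

/-- The diagonal blocks at an idempotent `p` of the linear and the quadratic coefficient of
`(w' + t v') (w + t v)`. -/
lemma diag_blocks {p q q' w w' v v' : A} (hp : p * p = p) (hσ : σ * σ = 1) (hσp : σ * p = p * σ)
    (hv : v * p = σ * q * p) (hv' : p * v' = p * (q' * -σ)) (hw : p * w * p = q * p)
    (hw' : p * w' * p = p * q') (hq : q * p = p * q) (hq' : p * q' = q' * p)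
    (hqq : q' * q = 1) :
    p * (w' * v + v' * w) * p = 0 ∧ p * (v' * v) * p = -p := by
  have h1 : σ * q * p = p * (σ * q) := by rw [mul_assoc, hq, ← mul_assoc, hσp, mul_assoc]
  constructor
  · have e1 : p * (w' * v) * p = q' * σ * q * p := by
      rw [mul_assoc, mul_assoc, hv, h1, ← mul_assoc, ← mul_assoc, hw', hq', mul_assoc, ← h1]
      simp only [mul_assoc]
    have e2 : p * (v' * w) * p = -(q' * σ * q * p) := by
      calc p * (v' * w) * p = p * v' * w * p := by simp only [mul_assoc]
        _ = -(p * q' * σ * w * p) := by rw [hv']; noncomm_ring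
        _ = -(q' * (p * σ) * w * p) := by rw [hq']; simp only [mul_assoc]
        _ = -(q' * σ * (p * w * p)) := by rw [← hσp]; simp only [mul_assoc]
        _ = _ := by rw [hw]; simp only [mul_assoc]
    rw [mul_add, add_mul, e1, e2, add_neg_cancel]
  · calc p * (v' * v) * p = p * v' * (v * p) := by simp only [mul_assoc]
      _ = -(p * q' * (σ * σ) * q * p) := by rw [hv, hv']; noncomm_ring
      _ = -p := by rw [hσ, mul_one, mul_assoc p, hqq, mul_one, hp]

namespace Mark

variable [Fintype ι]

lemma eq_sum_of_commute (h : Mark e π) {x : A} (hx : ∀ c, π c * x = x * π c) :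
    x = ∑ c, π c * x * π c := by
  calc x = x * ∑ c, π c := by rw [h.sum, mul_one]
    _ = ∑ c, π c * x * π c := by
      rw [Finset.mul_sum]
      exact Finset.sum_congr rfl fun c _ => by rw [hx, mul_assoc, h.idem]

variable [DecidableEq ι]

lemma commute_e_sum_pi (h : Mark e π) {a b : ι} (ha : a ∈ S) (hb : b ∈ S) :
    Commute (e a b) (∑ c ∈ S, π c) := by
  by_cases hab : a = b
  · rw [hab, h.rel.diag]; exact Commute.zero_left _
  have hb' : b ∈ S.erase a := Finset.mem_erase.2 ⟨Ne.symm hab, hb⟩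
  rw [← Finset.add_sum_erase _ _ ha, ← Finset.add_sum_erase _ _ hb', ← add_assoc]
  refine Commute.add_right ?_ (Commute.sum_right _ _ _ fun c hc => ?_)
  · change _ * _ = _ * _
    rw [mul_add, add_mul, h.swap, h.pi_mul_e, add_comm]
  · simp only [Finset.mem_erase] at hc
    exact h.comm a b c hc.2.1 hc.1

variable (S) in
/-- The product of the `1 - (θ + t σ π) ^ 2` in any order, in terms of the products of the
`1 - (θ + t σ π)` and of the `1 + (θ + t σ π)`. -/
lemma prod_one_sub_thetaHat_sq (h : Mark e π) (g : Grading e π σ) {l l' : List ι} (hl : l.Nodup)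
    (hp : l.Perm l') (hS : ∀ a ∈ l, a ∈ S) :
    (l.map fun a => 1 - thetaHat e S π σ a * thetaHat e S π σ a).prod
      = C ((l'.map fun i => ((1 : ℤ) : A) - theta e S i).prod * thetaProd e S 1 l')
        + X * C ((l'.map fun i => ((1 : ℤ) : A) - theta e S i).prod * thetaProdLin e S π σ l'
          + thetaProdLin' e S π σ l' * thetaProd e S 1 l')
        + X ^ 2 * C (thetaProdLin' e S π σ l' * thetaProdLin e S π σ l') := by
  have hanti : ∀ a ∈ l, ∀ b ∈ l, a ≠ b → thetaHat e S π σ a * thetaHat e S π σ b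
      = -(thetaHat e S π σ b * thetaHat e S π σ a) :=
    fun a ha b hb hab => h.thetaHat_anticomm g (hS a ha) (hS b hb) hab
  have hl' := hp.nodup hl
  rw [prod_one_sub_sq_perm hp hanti, ← linear_mul_linear, ← h.prod_one_sub_thetaHat g hl',
    ← h.revProd_one_add_thetaHat g hl', prod_sub_mul_revProd_add 1 hl' fun a ha b hb =>
      hanti a (hp.mem_iff.2 ha) b (hp.mem_iff.2 hb)]
  simp

/-- If the products of the `1 - θ ^ 2` are trivial for all sets with one index fewer, then the
product of the `1 - θ ^ 2` commutes with the idempotents. -/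
theorem commute_pi_prod_one_sub_theta_sq (h : Mark e π) (g : Grading e π σ) {l : List ι}
    (hl : l.Nodup) (hS : ∀ a, a ∈ l ↔ a ∈ S)
    (ih : ∀ b ∈ l, ((l.erase b).map fun a =>
      1 - theta e (S.erase b) a * theta e (S.erase b) a).prod = 1) (c : ι) :
    Commute (π c) (l.map fun a => 1 - theta e S a * theta e S a).prod := by
  have hS' : ∀ a ∈ l, a ∈ S := fun a => (hS a).1
  set D : A[X] := (l.map fun a => 1 - thetaHat e S π σ a * thetaHat e S π σ a).prod with hD
  have hcoeff : ∀ l', l.Perm l' →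
      D.coeff 0 = (l'.map fun i => ((1 : ℤ) : A) - theta e S i).prod * thetaProd e S 1 l'
      ∧ D.coeff 1 = (l'.map fun i => ((1 : ℤ) : A) - theta e S i).prod * thetaProdLin e S π σ l'
          + thetaProdLin' e S π σ l' * thetaProd e S 1 l'
      ∧ D.coeff 2 = thetaProdLin' e S π σ l' * thetaProdLin e S π σ l' := by
    intro l' hp
    rw [hD, h.prod_one_sub_thetaHat_sq S g hl hp hS']
    simp only [coeff_quadratic]
    simp
  have hform : D = C (D.coeff 0) + X * C (D.coeff 1) + X ^ 2 * C (D.coeff 2) := by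
    obtain ⟨h0, h1, h2⟩ := hcoeff l (List.Perm.refl l)
    rw [h0, h1, h2, hD]
    exact h.prod_one_sub_thetaHat_sq S g hl (List.Perm.refl l) hS'
  have hM : D.coeff 0 = (l.map fun a => 1 - theta e S a * theta e S a).prod := by
    rw [(hcoeff l (List.Perm.refl l)).1, prod_sub_mul_revProd_add 1 hl fun a ha b hb hab =>
      h.rel.theta_anticomm (hS' a ha) (hS' b hb) hab]
    simp
  have hout : ∀ c, c ∉ S → ∀ k, π c * D.coeff k = D.coeff k * π c := by
    intro c hc k
    have : Commute (C (π c)) D := by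
      refine commute_list_prod fun a ha => ?_
      have hac : a ≠ c := by rintro rfl; exact hc (hS' a ha)
      have h1 : Commute (C (π c)) (thetaHat e S π σ a) := by
        refine Commute.add_right ?_ (Commute.mul_right (Polynomial.commute_X _).symm ?_)
        · exact ((h.commute_theta hac hc).symm).map C
        · refine Commute.map ?_ C
          change _ * _ = _ * _
          rw [← mul_assoc, ← g.comm, mul_assoc, mul_assoc, h.orth c a hac.symm, h.orth a c hac]
      exact (Commute.one_right _).sub_right (h1.mul_right h1)
    have := congrArg (fun f => coeff f k) this.eq
    simpa using this
  have hcomm := fun c (hc : c ∈ S) => commute_quadratic (p := theta e S c * theta e S c)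
    (q := theta e S c * (σ * π c) + σ * π c * theta e S c) (r := π c) (m := D.coeff 0)
    (n := D.coeff 1) (k := D.coeff 2) (by
      rw [← hform, ← h.thetaHat_sq g]
      refine commute_list_prod fun a ha => (Commute.one_right _).sub_right ?_
      by_cases hac : a = c
      · rw [hac]; exact Commute.refl _
      · have := commute_sq_of_anticommute (h.thetaHat_anticomm g (hS' a ha) hc hac)
        exact (this.mul_left this).symm)
  have hdiag : ∀ b, π b * D.coeff 1 * π b = 0
      ∧ π b * D.coeff 2 * π b = if b ∈ S then -π b else 0 := by
    intro b
    by_cases hb : b ∈ S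
    · have hbl := (hS b).2 hb
      have hp : l.Perm (l.erase b ++ [b]) :=
        (List.perm_cons_erase hbl).trans (List.perm_append_comm (l₁ := [b]))
      obtain ⟨-, h1, h2⟩ := hcoeff _ hp
      have hnd := hp.nodup hl
      have hsub : ∀ a ∈ l.erase b ++ [b], a ∈ S := fun a ha => hS' a (hp.mem_iff.2 ha)
      have hbe : b ∉ l.erase b := hl.not_mem_erase
      have w1 := h.thetaProdLin_mul_pi_of_mem g rfl hnd hsub
      have w2 := congrArg unop (h.opGen.thetaProdLin_mul_pi_of_mem g.opGen rfl hnd hsub)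
      have w3 := h.pi_mul_thetaProd_concat_mul_pi (u := 1) hnd hsub
      have w4 := congrArg unop (h.opGen.pi_mul_thetaProd_concat_mul_pi (u := 1) hnd hsub)
      have w5 := (h.commute_thetaProd (u := 1) hbe (Finset.notMem_erase b S)).eq
      have w6 := congrArg unop
        (h.opGen.commute_thetaProd (u := 1) hbe (Finset.notMem_erase b S)).eq
      have w7 := prod_sub_mul_revProd_add 1 (hl.erase b) fun x hx y hy hxy =>
        h.rel.theta_anticomm (S := S.erase b)
          (Finset.mem_erase.2 ⟨(hl.mem_erase_iff.1 hx).1, hS' x (hl.mem_erase_iff.1 hx).2⟩)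
          (Finset.mem_erase.2 ⟨(hl.mem_erase_iff.1 hy).1, hS' y (hl.mem_erase_iff.1 hy).2⟩) hxy
      simp only [thetaProd_opGen, unop_mul, unop_op, unop_intCast] at w2 w4 w6
      rw [← thetaProdLin'] at w2
      set Q := thetaProd e (S.erase b) 1 (l.erase b)
      set Q' := ((l.erase b).map fun i => ((1 : ℤ) : A) - theta e (S.erase b) i).prod
      set W := thetaProd e S 1 (l.erase b ++ [b])
      set W' := ((l.erase b ++ [b]).map fun i => ((1 : ℤ) : A) - theta e S i).prod
      have w8 : Q' * Q = 1 := by rw [w7, ← ih b hbl]; simp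
      simp only [revProd_nil, one_mul, List.map_nil, List.prod_nil, mul_one, Int.cast_one]
        at w1 w2 w3 w4
      rw [h1, h2, if_pos hb]
      exact diag_blocks (h.idem b) g.sq (g.comm b) w1 w2 w3 (by rwa [mul_assoc]) w5 w6 w8
    · have hbl : b ∉ l := fun hb' => hb (hS' b hb')
      obtain ⟨-, h1, h2⟩ := hcoeff l (List.Perm.refl l)
      have w1 := h.thetaProdLin_mul_pi_of_notMem (S := S) (σ := σ) hl hbl
      have w2 := h.pi_mul_thetaProdLin'_of_notMem (S := S) (σ := σ) hl hbl
      rw [h1, h2, if_neg hb, mul_add, add_mul, mul_assoc, mul_assoc, w1, ← mul_assoc, ← mul_assoc,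
        ← mul_assoc, w2]
      simp
  have hL : D.coeff 2 = -∑ c ∈ S, π c := by
    rw [h.eq_sum_of_commute (x := D.coeff 2) fun c => ?_]
    · simp [hdiag, Finset.sum_ite_mem]
    · by_cases hc : c ∈ S
      exacts [(hcomm c hc).1, hout c hc 2]
  have hLθ : ∀ a ∈ S, Commute (theta e S a) (D.coeff 2) := fun a ha => by
    rw [hL]
    exact (Commute.sum_left _ _ _ fun b hb => h.commute_e_sum_pi ha hb).neg_right
  have hLσ : ∀ a, Commute (σ * π a) (D.coeff 2) := fun a => by
    rw [hL]
    refine (Commute.sum_right _ _ _ fun b _ => ?_).neg_right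
    change _ * _ = _ * _
    rw [← mul_assoc (π b), ← g.comm, mul_assoc, mul_assoc]
    by_cases hab : a = b
    · rw [hab]
    · rw [h.orth a b hab, h.orth b a (Ne.symm hab)]
  have hN : D.coeff 1 = 0 := by
    rw [h.eq_sum_of_commute (x := D.coeff 1) fun c => ?_]
    · simp [hdiag]
    · by_cases hc : c ∈ S
      · have := (hcomm c hc).2.1
        rw [(((hLθ c hc).mul_left (hLσ c)).add_left ((hLσ c).mul_left (hLθ c hc))).eq] at this
        exact add_left_cancel this
      · exact hout c hc 1
  rw [← hM]
  by_cases hc : c ∈ S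
  · have := (hcomm c hc).2.2
    rw [hN, ((hLθ c hc).mul_left (hLθ c hc)).eq, mul_zero, zero_mul] at this
    exact add_left_cancel this
  · exact hout c hc 0

end Mark

end Polynomial

section PermMatrix

open Equiv Matrix

variable {ι A : Type*} [Fintype ι] [DecidableEq ι] [Ring A] {e : ι → ι → A}

/-- The generator `e a b` multiplied by the left translation by the transposition of `a` and `b`,
as a matrix indexed by permutations. -/
def permGen (e : ι → ι → A) (a b : ι) : Matrix (Perm ι) (Perm ι) A :=
  Matrix.of fun w w' => if w = swap a b * w' then e a b else 0

/-- The projection to the permutations sending `c` to `a`. -/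
def permMark (A : Type*) [Ring A] (c a : ι) : Matrix (Perm ι) (Perm ι) A :=
  Matrix.diagonal fun w => if w c = a then 1 else 0

/-- The diagonal matrix of signs of permutations. -/
def permSign (ι A : Type*) [Fintype ι] [DecidableEq ι] [Ring A] : Matrix (Perm ι) (Perm ι) A :=
  Matrix.diagonal fun w => ((Perm.sign w : ℤ) : A)

lemma mul_permGen_apply (X : Matrix (Perm ι) (Perm ι) A) (a b : ι) (w w' : Perm ι) :
    (X * permGen e a b) w w' = X w (swap a b * w') * e a b := by
  simp [Matrix.mul_apply, permGen]

lemma permGen_mul_apply (X : Matrix (Perm ι) (Perm ι) A) (a b : ι) (w w' : Perm ι) :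
    (permGen e a b * X) w w' = e a b * X (swap a b * w) w' := by
  have : ∀ v : Perm ι, w = swap a b * v ↔ swap a b * w = v := fun v => by
    constructor <;> rintro rfl <;> simp [← mul_assoc]
  simp [Matrix.mul_apply, permGen, this]

lemma permGen_mul_permGen_apply (a b c d : ι) (w w' : Perm ι) :
    (permGen e a b * permGen e c d) w w'
      = if w = swap a b * swap c d * w' then e a b * e c d else 0 := by
  rw [mul_permGen_apply]
  simp [permGen, mul_assoc]

omit [Fintype ι] in
lemma swap_mul_swap_cycle {a b c : ι} (hab : a ≠ b) (hbc : b ≠ c) (hca : c ≠ a) :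
    swap a b * swap b c = swap b c * swap c a := by
  ext x
  simp only [Perm.mul_apply, swap_apply_def]
  split_ifs <;> simp_all

lemma Rel.permGen (h : Rel e) : Rel (permGen e) := by
  refine Rel.of_distinct (fun a b => ?_) (fun a => ?_) (fun a b _ => ?_)
    (fun a b c d hab hcd hac had hbc hbd => ?_) (fun a b c hab hbc hca => ?_) <;> ext w w'
  · simp [DunklElements.permGen, h.symm a b, swap_comm a b]
  · simp [DunklElements.permGen, h.diag]
  · simp [permGen_mul_permGen_apply, h.sq]
  · have hs : swap c d * swap a b = swap a b * swap c d :=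
      ((Perm.disjoint_swap_swap (by simp; tauto)).commute).eq.symm
    rw [Matrix.add_apply, permGen_mul_permGen_apply, permGen_mul_permGen_apply, hs]
    split_ifs
    · exact h.anti a b c d hac had hbc hbd
    · simp
  · simp only [Matrix.add_apply, permGen_mul_permGen_apply]
    rw [swap_mul_swap_cycle hab hbc hca, swap_mul_swap_cycle hbc hca hab]
    split_ifs
    · exact h.tri a b c
    · simp

lemma permMark_mul_apply (X : Matrix (Perm ι) (Perm ι) A) (c a : ι) (w w' : Perm ι) :
    (permMark A c a * X) w w' = if w c = a then X w w' else 0 := by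
  simp [permMark, Matrix.diagonal_mul]

lemma mul_permMark_apply (X : Matrix (Perm ι) (Perm ι) A) (c a : ι) (w w' : Perm ι) :
    (X * permMark A c a) w w' = if w' c = a then X w w' else 0 := by
  simp [permMark, Matrix.mul_diagonal]

lemma Rel.mark (h : Rel e) (c₀ : ι) :
    Mark (DunklElements.permGen e) (permMark A c₀) where
  rel := h.permGen
  idem a := by
    ext w w'
    rw [permMark_mul_apply]
    simp only [permMark, Matrix.diagonal_apply]
    split_ifs <;> simp_all
  orth a b hab := by
    ext w w'
    rw [permMark_mul_apply]
    simp only [permMark, Matrix.diagonal_apply, Matrix.zero_apply]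
    split_ifs <;> simp_all
  sum := by
    ext w w'
    simp only [permMark, Matrix.sum_apply, Matrix.diagonal_apply, Matrix.one_apply]
    split_ifs <;> simp
  swap a b := by
    ext w w'
    rw [permMark_mul_apply, mul_permMark_apply]
    simp only [DunklElements.permGen, Matrix.of_apply]
    by_cases hw : w = Equiv.swap a b * w'
    · have : w c₀ = b ↔ w' c₀ = a := by
        rw [hw, Perm.mul_apply, swap_apply_eq_iff, swap_apply_right]
      simp [this]
    · simp [hw]
  comm a b c hca hcb := by
    ext w w'
    rw [permMark_mul_apply, mul_permMark_apply]
    simp only [DunklElements.permGen, Matrix.of_apply]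
    by_cases hw : w = Equiv.swap a b * w'
    · have : w c₀ = c ↔ w' c₀ = c := by
        rw [hw, Perm.mul_apply, swap_apply_eq_iff, swap_apply_of_ne_of_ne hca hcb]
      simp [this]
    · simp [hw]

lemma Rel.grading (h : Rel e) (c₀ : ι) :
    Grading (DunklElements.permGen e) (permMark A c₀) (permSign ι A) where
  sq := by
    have : ∀ w : Perm ι, ((Perm.sign w : ℤ) : A) * ((Perm.sign w : ℤ) : A) = 1 := fun w => by
      rw [← Int.cast_mul]
      rcases Int.units_eq_one_or (Perm.sign w) with h | h <;> simp [h]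
    simp [permSign, this]
  anti a b := by
    ext w w'
    rw [permSign, Matrix.diagonal_mul, Matrix.neg_apply, Matrix.mul_diagonal]
    simp only [DunklElements.permGen, Matrix.of_apply]
    by_cases hab : a = b
    · simp [hab, h.diag]
    split_ifs with hw
    · rw [hw, Perm.sign_mul, Perm.sign_swap hab, (Int.cast_commute _ (e a b)).eq]
      simp
    · simp
  comm a := by
    ext w w'
    simp only [permSign, permMark, Matrix.diagonal_mul_diagonal]
    simp

lemma permMark_mul_mul_permMark_apply (X : Matrix (Perm ι) (Perm ι) A) {c a b : ι}
    {w w' : Perm ι} (ha : w c = a) (hb : w' c = b) :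
    (permMark A c a * X * permMark A c b) w w' = X w w' := by
  rw [mul_permMark_apply, if_pos hb, permMark_mul_apply, if_pos ha]

lemma eq_one_of_commute_permMark {X : Matrix (Perm ι) (Perm ι) A}
    (h : ∀ c a, Commute (permMark A c a) X) (h1 : ∀ w, X w w = 1) : X = 1 := by
  ext w w'
  by_cases hw : w = w'
  · subst hw
    simp [h1]
  · obtain ⟨c, hc⟩ : ∃ c, w c ≠ w' c := by
      by_contra! hcon
      exact hw (Equiv.ext hcon)
    rw [Matrix.one_apply_ne hw, ← permMark_mul_mul_permMark_apply X (c := c) rfl rfl, (h _ _).eq,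
      mul_permMark_apply, if_pos rfl, mul_permMark_apply, if_neg (Ne.symm hc)]

end PermMatrix

namespace Mark

variable {ι A : Type*} [Fintype ι] [DecidableEq ι] [Ring A] {e : ι → ι → A} {π : ι → A}
  {S : Finset ι}

lemma pi_mul_thetaProd_mul_pi_mul_e (h : Mark e π) {u : ℤ} {i c : ι} {l : List ι} (hl : l.Nodup)
    (hS : ∀ a ∈ l, a ∈ S) (hi : i ∉ l) : π c * thetaProd e S u l * π i * e i c = 0 := by
  by_cases hci : c = i
  · simp [hci, h.rel.diag]
  by_cases hc : c ∈ l
  · obtain ⟨l₂, l₁, rfl⟩ := List.append_of_mem hc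
    have h0 : restr e S c i * π i * e i c = 0 := by
      rw [mul_assoc, h.pi_mul_e, ← mul_assoc]
      unfold restr
      split_ifs <;> simp [h.rel.sq']
    rw [h.pi_mul_thetaProd_mul_pi_of_mem hl hS hi, mul_assoc, h0, mul_zero]
  · rw [h.pi_mul_thetaProd_mul_pi_of_notMem hci hl hc hi, zero_mul]

lemma pi_mul_thetaProd_cons_concat_mul_pi (h : Mark e π) {m b : ι} {l : List ι}
    (hl : (m :: (l ++ [b])).Nodup) (hm : m ∈ S) (hb : b ∈ S) :
    π m * thetaProd e S 0 (m :: (l ++ [b])) * π b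
      = thetaProd e (S.erase m) 0 (l ++ [b]) * e m b * π b
        + e b m * (thetaProd e (S.erase b) 0 (m :: l) * π b) := by
  have hmb : m ≠ b := by rintro rfl; simp at hl
  have hml : m ∉ l := fun hm => (List.nodup_cons.1 hl).1 (by simp [hm])
  have hlb := List.nodup_append.1 (List.nodup_cons.1 hl).2
  have hbl : b ∉ l := fun hb => hlb.2.2 b hb b (by simp) rfl
  have hln := hlb.1
  have h1 := h.theta_mul_pi (S := S) hmb
  have h2 := h.pi_mul_theta (S := S) hmb.symm
  simp only [restr, hm, hb, if_true] at h1 h2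
  have hself := fun j => h.pi_mul_thetaProd_mul_pi_self (S := S) (u := 0) (j := j) hln
  have hzero := fun i j hij =>
    h.pi_mul_thetaProd_mul_pi_of_notMem (S := S) (u := 0) (i := i) (j := j) hij hln
  have hc := (h.commute_theta hmb (Finset.notMem_erase b S)).eq
  simp only [thetaProd, revProd_append, revProd_cons, revProd_nil, one_mul, Int.cast_zero,
    zero_add] at hself hzero ⊢
  calc _ = (π m * theta e S b) * revProd (fun i => theta e S i) l * (theta e S m * π b) := by
        simp only [mul_assoc]
    _ = theta e (S.erase m) b * (π m * revProd (fun i => theta e S i) l * π b)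
          * theta e (S.erase b) m
        + theta e (S.erase m) b * (π m * revProd (fun i => theta e S i) l * π m) * e m b
        + e b m * (π b * revProd (fun i => theta e S i) l * π b) * theta e (S.erase b) m
        + e b m * (π b * revProd (fun i => theta e S i) l * π m) * e m b := by
        rw [h1, h2]; noncomm_ring
    _ = _ := by
        rw [hzero m b hmb hml hbl, hzero b m hmb.symm hbl hml, hself m hml, hself b hbl]
        simp only [mul_assoc, h.pi_mul_e m b, hc, mul_zero, zero_mul, zero_add, add_zero]

lemma exists_pi_mul_thetaProd_mul_pi_eq (h : Mark e π) {u : ℤ} {m j : ι} (hmj : m ≠ j)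
    {l : List ι} (hl : l.Nodup) (hS : ∀ a ∈ l, a ∈ S) (hj : j ∉ l) :
    ∃ Y, π m * thetaProd e S u l * π j = Y * e m j * π j := by
  by_cases hm : m ∈ l
  · obtain ⟨l₂, l₁, rfl⟩ := List.append_of_mem hm
    rw [h.pi_mul_thetaProd_mul_pi_of_mem hl hS hj, ← mul_assoc]
    unfold restr
    split_ifs
    · exact ⟨_, rfl⟩
    · exact ⟨0, by simp⟩
  · exact ⟨0, by rw [h.pi_mul_thetaProd_mul_pi_of_notMem hmj hl hm hj, zero_mul, zero_mul]⟩

lemma exists_pi_mul_prod_sub_theta_mul_pi_eq (h : Mark e π) {u : ℤ} {m j : ι} (hmj : m ≠ j)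
    {l : List ι} (hl : l.Nodup) (hS : ∀ a ∈ l, a ∈ S) (hj : j ∉ l) :
    ∃ Y, π j * (l.map fun i => (u : A) - theta e S i).prod * π m = π j * (e m j * Y) := by
  obtain ⟨Y, hY⟩ := h.opGen.exists_pi_mul_thetaProd_mul_pi_eq (u := u) hmj hl hS hj
  refine ⟨-Y.unop, ?_⟩
  rw [thetaProd_opGen] at hY
  have := congrArg MulOpposite.unop hY
  simpa [DunklElements.opGen, mul_assoc] using this

end Mark

section PermMatrix

open Equiv Matrix MulOpposite

variable {ι A : Type*} [DecidableEq ι] [Ring A] {e : ι → ι → A} {S : Finset ι}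

lemma Rel.thetaProd_zero_perm (h : Rel e) {l l' : List ι} (hp : l.Perm l') (hl : l.Nodup)
    (hS : ∀ a ∈ l, a ∈ S) :
    thetaProd e S 0 l = thetaProd e S 0 l' ∨ thetaProd e S 0 l = -thetaProd e S 0 l' :=
  revProd_perm hp hl fun a ha b hb hab => by
    simpa using h.theta_anticomm (hS a ha) (hS b hb) hab

variable [Fintype ι]

/-- Entries of a product of Dunkl elements between permutations which differ only over the
indices of the product. -/
lemma Rel.thetaProd_zero_apply_eq_zero (h : Rel e) (n : ℕ) {l : List ι} (hn : l.length = n)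
    (hne : l ≠ []) (hl : l.Nodup) (hS : ∀ a ∈ l, a ∈ S) {w w' : Perm ι}
    (hw : ∀ c, w' c ∉ l → w c = w' c) :
    thetaProd (DunklElements.permGen e) S 0 l w w' = 0 := by
  induction n generalizing l S w w' with
  | zero => exact absurd (List.length_eq_zero_iff.1 hn) hne
  | succ n ih =>
    by_cases hww : w = w'
    · subst hww
      obtain ⟨i, l, rfl⟩ := List.exists_cons_of_ne_nil hne
      have hl' := List.nodup_cons.1 hl
      rw [thetaProd, revProd_cons, Int.cast_zero, zero_add, theta, Finset.mul_sum,
        Matrix.sum_apply]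
      refine Finset.sum_eq_zero fun c _ => ?_
      have hm := h.mark (w⁻¹ c)
      have hc : w (w⁻¹ c) = c := by simp
      refine (permMark_mul_mul_permMark_apply _ hc hc).symm.trans ?_
      rw [← mul_assoc, mul_assoc _ _ (permMark A _ c),
        ← hm.pi_mul_e, ← mul_assoc]
      have := hm.pi_mul_thetaProd_mul_pi_mul_e (u := 0) (c := c) hl'.2
        (fun a ha => hS a (List.mem_cons_of_mem _ ha)) hl'.1
      simp only [Int.cast_zero, zero_add, thetaProd] at this ⊢
      rw [this, Matrix.zero_apply]
    · obtain ⟨c₀, hc₀⟩ : ∃ c, w c ≠ w' c := by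
        by_contra! hcon
        exact hww (Equiv.ext hcon)
      obtain ⟨m, hm⟩ : ∃ m, w c₀ = m := ⟨_, rfl⟩
      obtain ⟨b, hb⟩ : ∃ b, w' c₀ = b := ⟨_, rfl⟩
      rw [hm, hb] at hc₀
      have hbl : b ∈ l := by
        by_contra hbl
        exact hc₀ (by rw [← hm, ← hb]; exact hw c₀ (by rwa [hb]))
      have hml : m ∈ l := by
        by_contra hml
        have h1 : w' (w'⁻¹ m) = m := by simp
        have h2 := hw (w'⁻¹ m) (by rwa [h1])
        exact hc₀ (by rw [← hb, ← w.injective (h2.trans (h1.trans hm.symm)), h1])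
      set L := (l.erase m).erase b with hL
      have hbm : b ∈ l.erase m := (List.mem_erase_of_ne (Ne.symm hc₀)).2 hbl
      have hp : l.Perm (m :: (L ++ [b])) :=
        (List.perm_cons_erase hml).trans (((List.perm_cons_erase hbm).trans
          (List.perm_append_comm (l₁ := [b]))).cons m)
      have hnd := hp.nodup hl
      have hnd' : (m :: L).Nodup := by
        refine hnd.sublist ?_
        simp
      have hlen : L.length + 1 = n := by
        have := hp.length_eq
        simp at this
        omega
      have hmem : ∀ a, a ∈ l ↔ a = m ∨ a ∈ L ∨ a = b := fun a => by
        rw [hp.mem_iff]; simp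
      have hmL : m ∉ L := fun hmL => (List.nodup_cons.1 hnd').1 hmL
      have hbL : b ∉ L := fun hb =>
        (List.nodup_append.1 (List.nodup_cons.1 hnd).2).2.2 b hb b (by simp) rfl
      have hmark := h.mark c₀
      have key : thetaProd (DunklElements.permGen e) S 0 (m :: (L ++ [b])) w w' = 0 := by
        refine (permMark_mul_mul_permMark_apply _ hm hb).symm.trans ?_
        rw [hmark.pi_mul_thetaProd_cons_concat_mul_pi hnd (hS m hml) (hS b hbl),
          Matrix.add_apply, mul_permMark_apply, if_pos hb, mul_permGen_apply, permGen_mul_apply,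
          mul_permMark_apply, if_pos hb, ih (l := L ++ [b]) (by simpa using hlen) (by simp)
            (List.nodup_cons.1 hnd).2, ih (l := m :: L) (by simpa using hlen) (by simp) hnd']
        · simp
        · intro a ha
          refine Finset.mem_erase.2 ⟨?_, hS a ((hmem a).2 ?_)⟩
          · rintro rfl
            rcases List.mem_cons.1 ha with h | h
            exacts [hc₀ h.symm, hbL h]
          · rcases List.mem_cons.1 ha with h | h <;> simp [h]
        · intro c hc
          simp only [List.mem_cons, not_or] at hc
          rw [Perm.mul_apply]
          by_cases hcb : w' c = b
          · have : c = c₀ := w'.injective (hcb.trans hb.symm)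
            rw [this, hm, hb, swap_apply_right]
          · have := hw c (by rw [hmem]; tauto)
            rw [this, swap_apply_of_ne_of_ne hcb hc.1]
        · intro a ha
          refine Finset.mem_erase.2 ⟨?_, hS a ((hmem a).2 ?_)⟩
          · rintro rfl
            rcases List.mem_append.1 ha with h | h
            exacts [hmL h, hc₀ (by simpa using h)]
          · rcases List.mem_append.1 ha with h | h <;> simp_all
        · intro c hc
          simp only [List.mem_append, List.mem_singleton, not_or, Perm.mul_apply] at hc ⊢
          by_cases hcb : w' c = b
          · have : c = c₀ := w'.injective (hcb.trans hb.symm)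
            rw [this, hm, hb, swap_apply_right]
          · by_cases hcm : w' c = m
            · rw [hcm, swap_apply_left] at hc
              exact absurd rfl hc.2
            · rw [swap_apply_of_ne_of_ne hcm hcb] at hc ⊢
              exact hw c (by rw [hmem]; tauto)
      rcases h.permGen.thetaProd_zero_perm hp hl hS with h | h
      · rw [h, key]
      · rw [h, Matrix.neg_apply, key, neg_zero]

/-- The diagonal entries of products of squares of Dunkl elements vanish. -/
lemma Rel.prod_neg_theta_sq_apply_self (h : Rel e) {l : List ι} (hne : l ≠ []) (hl : l.Nodup)
    (hS : ∀ a ∈ l, a ∈ S) (w : Perm ι) :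
    (l.map fun a => -(theta (DunklElements.permGen e) S a
      * theta (DunklElements.permGen e) S a)).prod w w = 0 := by
  have hprod := revProd_add_mul_prod_sub 0 hl fun a ha b hb hab =>
    h.permGen.theta_anticomm (hS a ha) (hS b hb) hab
  simp only [Int.cast_zero, mul_zero, zero_sub] at hprod
  rw [← hprod, Matrix.mul_apply]
  refine Finset.sum_eq_zero fun w' _ => ?_
  by_cases hw : ∀ c, w' c ∉ l → w c = w' c
  · have h0 := h.thetaProd_zero_apply_eq_zero l.length rfl hne hl hS hw
    rw [thetaProd, Int.cast_zero] at h0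
    rw [h0, zero_mul]
  · push Not at hw
    obtain ⟨c, hc, hne⟩ := hw
    obtain ⟨Y, hY⟩ := (h.mark c).exists_pi_mul_thetaProd_mul_pi_eq (u := 0) hne hl hS hc
    obtain ⟨Z, hZ⟩ := (h.mark c).exists_pi_mul_prod_sub_theta_mul_pi_eq (u := 0) hne hl hS hc
    have hY' := congrFun (congrFun hY w) w'
    have hZ' := congrFun (congrFun hZ w') w
    rw [permMark_mul_mul_permMark_apply _ rfl rfl, mul_permMark_apply, if_pos rfl,
      mul_permGen_apply] at hY'
    rw [permMark_mul_mul_permMark_apply _ rfl rfl, permMark_mul_apply, if_pos rfl,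
      permGen_mul_apply] at hZ'
    simp only [Int.cast_zero, zero_sub, thetaProd] at hY' hZ'
    rw [hY', hZ', mul_assoc, ← mul_assoc (e _ _), h.sq, zero_mul, mul_zero]

/-- The product of the `1 - θ ^ 2` has diagonal entries one. -/
lemma Rel.prod_one_sub_theta_sq_apply_self (h : Rel e) {l l' : List ι} (hl : (l' ++ l).Nodup)
    (hS : ∀ a ∈ l' ++ l, a ∈ S) (w : Perm ι) :
    ((l'.map fun a => -(theta (DunklElements.permGen e) S a
        * theta (DunklElements.permGen e) S a)).prod
      * (l.map fun a => 1 - theta (DunklElements.permGen e) S a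
        * theta (DunklElements.permGen e) S a).prod) w w = if l' = [] then 1 else 0 := by
  induction l generalizing l' with
  | nil =>
    simp only [List.append_nil, List.map_nil, List.prod_nil, mul_one] at hl hS ⊢
    split_ifs with hl'
    · simp [hl']
    · exact h.prod_neg_theta_sq_apply_self hl' hl hS w
  | cons i l ih =>
    have h1 := ih (l' := l' ++ [i]) (by simpa using hl) (by simpa using hS)
    have h2 := ih (l' := l') (hl.sublist (by simp)) fun a ha => hS a (by
      rcases List.mem_append.1 ha with h | h <;> simp [h])
    rw [List.map_append, List.prod_append] at h1
    simp only [List.map_cons, List.prod_cons, List.map_nil, List.prod_nil, mul_one] at h1 ⊢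
    rw [sub_eq_add_neg, add_mul, one_mul, mul_add, Matrix.add_apply, h2, ← mul_assoc, h1]
    simp

end PermMatrix

universe u

section Main

open Equiv Matrix

lemma permGen_mulVec_const {ι A : Type*} [Fintype ι] [DecidableEq ι] [Ring A] (e : ι → ι → A)
    (a b : ι) (r : A) : permGen e a b *ᵥ (fun _ => r) = fun _ => e a b * r := by
  have : ∀ w v : Perm ι, w = swap a b * v ↔ swap a b * w = v := fun w v => by
    constructor <;> rintro rfl <;> simp [← mul_assoc]
  ext w
  simp [Matrix.mulVec, dotProduct, permGen, this]

lemma theta_permGen_mulVec_const {ι A : Type*} [Fintype ι] [DecidableEq ι] [Ring A]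
    (e : ι → ι → A) (S : Finset ι) (a : ι) (r : A) :
    theta (permGen e) S a *ᵥ (fun _ => r) = fun _ => theta e S a * r := by
  simp only [theta, Matrix.sum_mulVec, permGen_mulVec_const]
  ext w
  simp [Finset.sum_mul]

lemma prod_one_sub_theta_sq_permGen_mulVec_const {ι A : Type*} [Fintype ι] [DecidableEq ι] [Ring A]
    (e : ι → ι → A) (S : Finset ι) (l : List ι) (r : A) :
    (l.map fun a => 1 - theta (permGen e) S a * theta (permGen e) S a).prod *ᵥ (fun _ => r)
      = fun _ => (l.map fun a => 1 - theta e S a * theta e S a).prod * r := by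
  induction l with
  | nil => simp
  | cons i l ih =>
    rw [List.map_cons, List.prod_cons, ← Matrix.mulVec_mulVec, ih, Matrix.sub_mulVec,
      Matrix.one_mulVec, ← Matrix.mulVec_mulVec, theta_permGen_mulVec_const,
      theta_permGen_mulVec_const]
    ext w
    simp only [Pi.sub_apply, List.map_cons, List.prod_cons]
    noncomm_ring

/-- The product of the `1 - θ ^ 2` over all indices is one. -/
theorem Rel.prod_one_sub_theta_sq {ι : Type} [Fintype ι] [DecidableEq ι] (n : ℕ) {A : Type u}
    [Ring A] {e : ι → ι → A} (h : Rel e) {S : Finset ι} {l : List ι} (hn : l.length = n)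
    (hl : l.Nodup) (hS : ∀ a, a ∈ l ↔ a ∈ S) :
    (l.map fun a => 1 - theta e S a * theta e S a).prod = 1 := by
  induction n generalizing A S l with
  | zero => simp [List.length_eq_zero_iff.1 hn]
  | succ n ih =>
    have hX : (l.map fun a => 1 - theta (DunklElements.permGen e) S a
        * theta (DunklElements.permGen e) S a).prod = 1 := by
      refine eq_one_of_commute_permMark (fun c a => ?_) fun w => ?_
      · refine (h.mark c).commute_pi_prod_one_sub_theta_sq (h.grading c) hl hS (fun b hb => ?_) a
        refine ih h.permGen ?_ (hl.erase b) fun x => ?_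
        · rw [List.length_erase_of_mem hb, hn, Nat.add_sub_cancel]
        · rw [hl.mem_erase_iff, Finset.mem_erase, hS]
      · simpa using h.prod_one_sub_theta_sq_apply_self (l := l) (l' := []) hl
          (fun a ha => (hS a).1 ha) w
    have h1 := prod_one_sub_theta_sq_permGen_mulVec_const e S l 1
    rw [hX, Matrix.one_mulVec] at h1
    simpa using (congrFun h1 1).symm

end Main

section PowerSums

open Polynomial
open scoped IsMulCommutative

lemma sum_pow_eq_zero_of_prod_one_sub {ι K : Type*} [Fintype ι] [DecidableEq ι] [CommRing K]
    (s : ι → K) (h : ∏ a, (1 - (X : K[X]) * C (s a)) = 1) {m : ℕ} (hm : 1 ≤ m) :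
    ∑ a, s a ^ m = 0 := by
  have hes : ∀ k, 1 ≤ k → MvPolynomial.aeval s (MvPolynomial.esymm ι K k) = 0 := by
    intro k hk
    have h1 := congrArg (fun p => coeff p k) h
    have h2 : ∏ a, (1 - (X : K[X]) * C (s a))
        = ∑ t : Finset ι, X ^ t.card * C ((-1) ^ t.card * ∏ a ∈ t, s a) := by
      simp only [sub_eq_add_neg, Finset.prod_one_add, Finset.powerset_univ]
      refine Finset.sum_congr rfl fun t _ => ?_
      simp only [Finset.prod_neg, Finset.prod_mul_distrib, Finset.prod_const, map_mul, map_prod,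
        map_pow, map_neg, map_one]
      ring
    simp only [h2, finsetSum_coeff, coeff_one, coeff_X_pow_mul', coeff_C] at h1
    rw [if_neg (by omega)] at h1
    have h3 : (-1) ^ k * MvPolynomial.aeval s (MvPolynomial.esymm ι K k) = 0 := by
      rw [← h1, MvPolynomial.esymm, map_sum, Finset.mul_sum, Finset.powersetCard_eq_filter,
        Finset.powerset_univ, Finset.sum_filter]
      refine Finset.sum_congr rfl fun t _ => ?_
      split_ifs with h1 h2 h3 h3 h3
      all_goals first | (exfalso; omega) | simp [*]
    rcases neg_one_pow_eq_or K k with hk | hk <;> simpa [hk] using h3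
  have hN := congrArg (MvPolynomial.aeval s) (MvPolynomial.psum_eq_mul_esymm_sub_sum ι K m hm)
  rw [map_sub, map_mul, hes m hm, map_sum, Finset.sum_eq_zero] at hN
  · simpa [MvPolynomial.psum] using hN
  · intro a ha
    have : 1 ≤ a.1 := (Finset.mem_filter.1 ha).2.1
    rw [map_mul, map_mul, hes a.1 this, mul_zero, zero_mul]

lemma Rel.polynomial {ι A : Type*} [Ring A] {e : ι → ι → A} (h : Rel e) :
    Rel fun a b => (X : A[X]) * C (e a b) := by
  have key : ∀ a b c d, (X : A[X]) * C (e a b) * (X * C (e c d)) = X ^ 2 * C (e a b * e c d) := by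
    intro a b c d
    rw [mul_assoc, ← mul_assoc (C _), ← X_mul_C, C_mul, pow_two]
    simp only [mul_assoc]
  refine ⟨fun a b => ?_, fun a => ?_, fun a b => ?_, fun a b c d h₁ h₂ h₃ h₄ => ?_,
    fun a b c => ?_⟩
  · simp only [h.symm a b]
  · simp [h.diag]
  · rw [key, h.sq, C_0, mul_zero]
  · rw [key, key, ← mul_add, ← C_add, h.anti a b c d h₁ h₂ h₃ h₄, C_0, mul_zero]
  · rw [key, key, key, ← mul_add, ← mul_add, ← C_add, ← C_add, h.tri, C_0, mul_zero]

/-- The even power sums of the elements `θ` vanish. -/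
theorem Rel.sum_theta_pow_eq_zero {ι : Type} [Fintype ι] [DecidableEq ι] {A : Type*} [Ring A]
    {e : ι → ι → A} (h : Rel e) {m : ℕ} (hm : 1 ≤ m) :
    ∑ a, theta e Finset.univ a ^ (2 * m) = 0 := by
  set T : Set A := Set.range fun a => theta e Finset.univ a ^ 2 with hT
  have hcomm : ∀ x ∈ T, ∀ y ∈ T, x * y = y * x := by
    rintro _ ⟨a, rfl⟩ _ ⟨b, rfl⟩
    by_cases hab : a = b
    · rw [hab]
    · have := h.theta_anticomm (Finset.mem_univ a) (Finset.mem_univ b) hab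
      have hsq := commute_sq_of_anticommute this
      simpa [pow_two] using (hsq.mul_left hsq).eq
  have := Subring.isMulCommutative_closure hcomm
  let s : ι → Subring.closure T := fun a =>
    ⟨theta e Finset.univ a ^ 2, Subring.subset_closure ⟨a, rfl⟩⟩
  have hprod : ∏ a, (1 - (X : (Subring.closure T)[X]) * C (s a)) = 1 := by
    apply expand_injective (R := Subring.closure T) two_pos
    apply map_injective (Subring.closure T).subtype Subtype.val_injective
    have h1 := h.polynomial.prod_one_sub_theta_sq _ rfl (Finset.nodup_toList Finset.univ)
      (fun _ => Finset.mem_toList)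
    have h2 : ∀ a, theta (fun a b => (X : A[X]) * C (e a b)) Finset.univ a
        = X * C (theta e Finset.univ a) := fun a => by
      simp [theta, Finset.mul_sum]
    have h3 : ∀ a, Polynomial.map (Subring.closure T).subtype
        (expand _ 2 (1 - (X : (Subring.closure T)[X]) * C (s a)))
        = 1 - theta (fun a b => (X : A[X]) * C (e a b)) Finset.univ a
          * theta (fun a b => (X : A[X]) * C (e a b)) Finset.univ a := fun a => by
      rw [h2]
      rw [mul_assoc, ← mul_assoc (C _), ← X_mul_C, mul_assoc, ← C_mul, ← mul_assoc, ← pow_two,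
        ← pow_two]
      simpa [s] using (((commute_X (C (theta e Finset.univ a))).pow_pow 2 2).eq).symm
    simp only [← h3] at h1
    rw [← coe_mapRingHom, map_one, map_one, ← h1, ← Finset.prod_map_toList, map_list_prod,
      map_list_prod, List.map_map, List.map_map]
    rfl
  have h0 := congrArg (Subring.closure T).subtype (sum_pow_eq_zero_of_prod_one_sub s hprod hm)
  simpa [s, pow_mul] using h0

end PowerSums

end DunklElements

/-- Corollary 5.1 of Kirillov–Maeno: for every `m ≥ 1`,
`θ_1^{2m} + ⋯ + θ_n^{2m} = 0` in `Λ_quad(A_{n-1})`. -/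
theorem power_sums_vanish_typeA (n : ℕ) (hn : 1 ≤ n) (R : Type*) [Ring R]
    (e : Fin n → Fin n → R)
    (hsymm : ∀ a b : Fin n, a ≠ b → e a b = e b a)
    (hsq : ∀ a b : Fin n, a ≠ b → e a b * e a b = 0)
    (hdisj : ∀ a b c d : Fin n, a ≠ b → c ≠ d → a ≠ c → a ≠ d → b ≠ c → b ≠ d →
      e a b * e c d + e c d * e a b = 0)
    (htri : ∀ a b c : Fin n, a ≠ b → b ≠ c → c ≠ a →
      e a b * e b c + e b c * e c a + e c a * e a b = 0)
    (θ : Fin n → R)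
    (hθ : ∀ i : Fin n, θ i = ∑ j ∈ Finset.univ.filter (fun j => j ≠ i), e i j) :
    ∀ m : ℕ, 1 ≤ m → ∑ i : Fin n, θ i ^ (2 * m) = 0 := by
  intro m hm
  let e' : Fin n → Fin n → R := fun a b => if a = b then 0 else e a b
  have he : ∀ {a b}, a ≠ b → e' a b = e a b := fun hab => if_neg hab
  have hrel : DunklElements.Rel e' := by
    refine DunklElements.Rel.of_distinct (fun a b => ?_) (fun a => if_pos rfl)
      (fun a b hab => ?_) (fun a b c d hab hcd hac had hbc hbd => ?_)
      (fun a b c hab hbc hca => ?_)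
    · by_cases hab : a = b
      · rw [hab]
      · rw [he hab, he (Ne.symm hab), hsymm a b hab]
    · rw [he hab, hsq a b hab]
    · rw [he hab, he hcd, hdisj a b c d hab hcd hac had hbc hbd]
    · rw [he hab, he hbc, he hca, htri a b c hab hbc hca]
  have hθ' : ∀ i, θ i = DunklElements.theta e' Finset.univ i := fun i => by
    rw [hθ, DunklElements.theta, Finset.sum_filter]
    refine Finset.sum_congr rfl fun j _ => ?_
    by_cases hij : j = i
    · simp [hij, e']
    · rw [if_pos hij, he (Ne.symm hij)]
  simp only [hθ']
  exact hrel.sum_theta_pow_eq_zero hm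
end

section
/- Lemma 5.3. θ_1 θ_2 ⋯ θ_n = 0, the product being taken in increasing order of the index. -/
open scoped TensorProduct

/-- The relations satisfied by `y a b = ξ a * e a b`, where `e` satisfies the quadratic relations of
type A and the `ξ a` are Grassmann variables commuting with `e`. -/
structure IsDressed {ι S : Type*} [Ring S] (y : ι → ι → S) : Prop where
  diag : ∀ a, y a a = 0
  absorb : ∀ a b c z, y a b * z * y a c = 0
  opp : ∀ a b, y a b * y b a = 0
  comm : ∀ a b c d, a ≠ c → a ≠ d → b ≠ c → b ≠ d → Commute (y a b) (y c d)
  tri : ∀ a b c, a ≠ b → b ≠ c → c ≠ a → y a c * y b c = y b a * y a c + y b c * y a b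

namespace IsDressed

variable {ι S : Type*} [Ring S] {y : ι → ι → S}

/-- The sum of the column `b` of `y` over the rows in `K`. -/
def col (y : ι → ι → S) (K : Finset ι) (b : ι) : S := ∑ a ∈ K, y a b

/-- The geometric series `1 + Y + Y ^ 2 + ⋯` of the nilpotent element `Y = col y K b`. -/
noncomputable def geom (y : ι → ι → S) (K : Finset ι) (b : ι) : S :=
  Ring.inverse (1 - col y K b)

theorem absorb_one (hy : IsDressed y) (a b c : ι) : y a b * y a c = 0 := by
  simpa using hy.absorb a b c 1

theorem commute_of_ne (hy : IsDressed y) {a b c d : ι} (had : a ≠ d) (hbc : b ≠ c)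
    (hbd : b ≠ d) : Commute (y a b) (y c d) := by
  by_cases hac : a = c
  · subst hac
    simp [Commute, SemiconjBy, hy.absorb_one]
  · exact hy.comm a b c d hac had hbc hbd

/-- The product over `J` of the geometric series of the columns. -/
noncomputable def geomProd (y : ι → ι → S) (J : List ι) (K : Finset ι) : S :=
  (J.map (geom y K)).prod

theorem commute_geomProd {z : S} {J : List ι} {K : Finset ι}
    (h : ∀ b ∈ J, Commute z (geom y K b)) : Commute z (geomProd y J K) :=
  Commute.list_prod_right _ _ fun _ hc => by
    obtain ⟨b, hb, rfl⟩ := List.mem_map.mp hc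
    exact h b hb

section Geom

variable [DecidableEq ι]

theorem isUnit_one_sub_col (hy : IsDressed y) (K : Finset ι) (b : ι) :
    IsUnit (1 - col y K b) := by
  induction K using Finset.induction_on with
  | empty => simp [col]
  | insert x K hx ih =>
    obtain ⟨u, hu⟩ := ih
    have h1 : (1 - col y K b) * (↑u⁻¹ : S) = 1 := by rw [← hu]; simp
    have h2 : (↑u⁻¹ : S) * (1 - col y K b) = 1 := by rw [← hu]; simp
    have h3 := hy.absorb x b b (↑u⁻¹ : S)
    have hc : col y (insert x K) b = y x b + col y K b := by simp [col, hx]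
    generalize (↑u⁻¹ : S) = v at *
    refine isUnit_iff_exists.mpr ⟨v + v * y x b * v, ?_, ?_⟩
    · rw [hc]
      calc _ = (1 - col y K b) * v + (1 - col y K b) * v * y x b * v - y x b * v
            - y x b * v * y x b * v := by noncomm_ring
        _ = 1 := by rw [h1, h3]; noncomm_ring
    · rw [hc]
      calc _ = v * (1 - col y K b) + v * y x b * (v * (1 - col y K b)) - v * y x b
            - v * (y x b * v * y x b) := by noncomm_ring
        _ = 1 := by rw [h2, h3]; noncomm_ring

theorem one_sub_col_mul_geom (hy : IsDressed y) (K : Finset ι) (b : ι) :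
    (1 - col y K b) * geom y K b = 1 :=
  Ring.mul_inverse_cancel _ (hy.isUnit_one_sub_col K b)

theorem geom_mul_one_sub_col (hy : IsDressed y) (K : Finset ι) (b : ι) :
    geom y K b * (1 - col y K b) = 1 :=
  Ring.inverse_mul_cancel _ (hy.isUnit_one_sub_col K b)

theorem geom_eq_one_add_mul_col (hy : IsDressed y) (K : Finset ι) (b : ι) :
    geom y K b = 1 + geom y K b * col y K b := by
  have h := hy.geom_mul_one_sub_col K b
  rw [mul_sub, mul_one, sub_eq_iff_eq_add] at h
  exact h

theorem geom_insert (hy : IsDressed y) {K : Finset ι} {x : ι} (hx : x ∉ K) (b : ι) :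
    geom y (insert x K) b = geom y K b + geom y K b * y x b * geom y K b := by
  have hc : col y (insert x K) b = y x b + col y K b := by simp [col, hx]
  have h1 := hy.geom_mul_one_sub_col (insert x K) b
  have h2 := hy.one_sub_col_mul_geom K b
  have h3 := hy.absorb x b b (geom y K b)
  have h4 : (1 - col y (insert x K) b) * (geom y K b + geom y K b * y x b * geom y K b) = 1 := by
    rw [hc]
    calc _ = (1 - col y K b) * geom y K b + (1 - col y K b) * geom y K b * y x b * geom y K b
          - y x b * geom y K b - y x b * geom y K b * y x b * geom y K b := by noncomm_ring
      _ = 1 := by rw [h2, h3]; noncomm_ring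
  exact left_inv_eq_right_inv h1 h4

theorem mul_geom_insert (hy : IsDressed y) {K : Finset ι} {x : ι} (hx : x ∉ K) (b c : ι) (z : S) :
    y x c * z * geom y (insert x K) b = y x c * z * geom y K b := by
  rw [hy.geom_insert hx, mul_add, ← mul_assoc, ← mul_assoc, mul_assoc (y x c) z,
    hy.absorb, zero_mul, add_zero]

theorem geom_insert_mul (hy : IsDressed y) {K : Finset ι} {x : ι} (hx : x ∉ K) (b c : ι) :
    geom y (insert x K) b * y x c = geom y K b * y x c := by
  have := hy.absorb x b c (geom y K b)
  rw [hy.geom_insert hx, add_mul, mul_assoc, mul_assoc, ← mul_assoc (y x b), this, mul_zero,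
    add_zero]

theorem commute_geom (hy : IsDressed y) {z : S} {K : Finset ι} {b : ι}
    (h : ∀ a ∈ K, Commute z (y a b)) : Commute z (geom y K b) := by
  have hz : Commute z (1 - col y K b) :=
    (Commute.one_right z).sub_right (Commute.sum_right _ _ _ h)
  calc z * geom y K b = geom y K b * (1 - col y K b) * z * geom y K b := by
        rw [hy.geom_mul_one_sub_col, one_mul]
    _ = geom y K b * z * ((1 - col y K b) * geom y K b) := by
        rw [mul_assoc (geom y K b), ← hz.eq]; noncomm_ring
    _ = geom y K b * z := by rw [hy.one_sub_col_mul_geom, mul_one]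

/-- The part of the cyclic relation at the root `m` that is linear in the letter `x`. -/
noncomputable def cyclicPart (y : ι → ι → S) (K : Finset ι) (m x : ι) : S :=
  y x m * geom y K m * y m x + ∑ a ∈ K, y a m * geom y K m * y x m * geom y K m * y m a

/-- The words in which the letter `z` follows `x` cyclically, in terms of shorter cyclic relations. -/
theorem cyclicPart_adjacent (hy : IsDressed y) {K : Finset ι} {m x z : ι}
    (hx : x ∉ K) (hz : z ∉ K) (hmx : m ≠ x) (hmz : m ≠ z) (hxz : x ≠ z) :
    y z m * geom y K m * y x m * y m z + y x m * y z m * geom y K m * y m x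
      + ∑ a ∈ K, y a m * geom y K m * (y x m * y z m) * geom y K m * y m a
      = y z x * cyclicPart y K m x + cyclicPart y K m z * y x z := by
  have hzx : Commute (y z x) (geom y K m) := hy.commute_geom fun a ha =>
    hy.commute_of_ne hmz.symm (ne_of_mem_of_not_mem ha hx).symm hmx.symm
  have hxz' : Commute (y x z) (geom y K m) := hy.commute_geom fun a ha =>
    hy.commute_of_ne hmx.symm (ne_of_mem_of_not_mem ha hz).symm hmz.symm
  have t1 : y z x * y x m = y x m * y z m - y z m * y x z :=
    eq_sub_of_add_eq (hy.tri x z m hxz hmz.symm hmx).symm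
  have t2 : y x z * y m x = y m z * y x z - y x m * y m z :=
    eq_sub_of_add_eq' (hy.tri m x z hmx hxz hmz.symm).symm
  have hsum : ∀ a ∈ K,
      y z x * (y a m * geom y K m * y x m * geom y K m * y m a)
        + y a m * geom y K m * y z m * geom y K m * y m a * y x z
      = y a m * geom y K m * (y x m * y z m) * geom y K m * y m a := by
    intro a ha
    have hax := ne_of_mem_of_not_mem ha hx
    have haz := ne_of_mem_of_not_mem ha hz
    have c1 : Commute (y z x) (y a m) := hy.commute_of_ne hmz.symm hax.symm hmx.symm
    have c2 : Commute (y x z) (y m a) := hy.commute_of_ne hax.symm hmz.symm haz.symm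
    generalize geom y K m = G at *
    calc _ = (y z x * y a m) * G * y x m * G * y m a
            + y a m * G * y z m * G * y m a * y x z := by noncomm_ring
      _ = y a m * (y z x * G) * y x m * G * y m a
            + y a m * G * y z m * G * y m a * y x z := by rw [c1.eq]; noncomm_ring
      _ = y a m * G * (y z x * y x m) * G * y m a
            + y a m * G * y z m * G * y m a * y x z := by rw [hzx.eq]; noncomm_ring
      _ = y a m * G * (y x m * y z m) * G * y m a
            - y a m * G * y z m * (y x z * G) * y m a
            + y a m * G * y z m * G * y m a * y x z := by rw [t1]; noncomm_ring
      _ = y a m * G * (y x m * y z m) * G * y m a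
            - y a m * G * y z m * G * (y x z * y m a)
            + y a m * G * y z m * G * y m a * y x z := by rw [hxz'.eq]; noncomm_ring
      _ = _ := by rw [c2.eq]; noncomm_ring
  rw [cyclicPart, cyclicPart, mul_add, add_mul, Finset.mul_sum, Finset.sum_mul,
    ← Finset.sum_congr rfl hsum, Finset.sum_add_distrib]
  have hhead : y z x * (y x m * geom y K m * y m x) + y z m * geom y K m * y m z * y x z
      = y z m * geom y K m * y x m * y m z + y x m * y z m * geom y K m * y m x := by
    generalize geom y K m = G at *
    calc _ = (y z x * y x m) * G * y m x + y z m * G * y m z * y x z := by noncomm_ring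
      _ = y x m * y z m * G * y m x - y z m * (y x z * G) * y m x
            + y z m * G * y m z * y x z := by rw [t1]; noncomm_ring
      _ = y x m * y z m * G * y m x - y z m * G * (y x z * y m x)
            + y z m * G * y m z * y x z := by rw [hxz'.eq]; noncomm_ring
      _ = _ := by rw [t2]; noncomm_ring
  rw [← hhead]
  abel

theorem cyclicPart_eq_sum (hy : IsDressed y) {K : Finset ι} {m z : ι} :
    cyclicPart y K m z = ∑ x ∈ K, (y z m * geom y K m * y x m * y m z
      + y x m * y z m * geom y K m * y m x
      + ∑ a ∈ K, y a m * geom y K m * (y x m * y z m) * geom y K m * y m a) := by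
  have h1 : y z m * geom y K m * y m z = ∑ x ∈ K, y z m * geom y K m * y x m * y m z := by
    conv_lhs => rw [hy.geom_eq_one_add_mul_col]
    rw [mul_add, add_mul, mul_one, hy.opp, zero_add, ← mul_assoc, col, Finset.mul_sum,
      Finset.sum_mul]
  have h2 : ∀ a ∈ K, y a m * geom y K m * y z m * geom y K m * y m a
      = y a m * y z m * geom y K m * y m a
        + ∑ x ∈ K, y a m * geom y K m * (y x m * y z m) * geom y K m * y m a := by
    intro a _
    have : y a m * geom y K m = y a m + ∑ x ∈ K, y a m * geom y K m * y x m := by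
      conv_lhs => rw [hy.geom_eq_one_add_mul_col]
      rw [mul_add, mul_one, ← mul_assoc, col, Finset.mul_sum]
    conv_lhs => rw [this]
    simp only [add_mul, Finset.sum_mul, mul_assoc]
  rw [cyclicPart, h1, Finset.sum_congr rfl h2]
  simp only [Finset.sum_add_distrib]
  rw [Finset.sum_comm (s := K) (t := K), add_assoc]

theorem cyclicPart_eq_zero (hy : IsDressed y) (K : Finset ι) {m z : ι} (hm : m ∉ K)
    (hz : z ∉ K) (hmz : m ≠ z) : cyclicPart y K m z = 0 := by
  induction hk : K.card generalizing K z with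
  | zero =>
    rw [hy.cyclicPart_eq_sum, Finset.card_eq_zero.mp hk, Finset.sum_empty]
  | succ k ih =>
    rw [hy.cyclicPart_eq_sum]
    refine Finset.sum_eq_zero fun x hx => ?_
    obtain ⟨L, hxL, rfl⟩ : ∃ L, x ∉ L ∧ insert x L = K :=
      ⟨K.erase x, Finset.notMem_erase x K, Finset.insert_erase hx⟩
    rw [Finset.card_insert_of_notMem hxL, Nat.succ_inj] at hk
    simp only [Finset.mem_insert, not_or] at hm hz
    have hadj := hy.cyclicPart_adjacent hxL hz.2 hm.1 hmz (Ne.symm hz.1)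
    rw [ih L hm.2 hxL hm.1 hk, ih L hm.2 hz.2 hmz hk, mul_zero, zero_mul, add_zero] at hadj
    rw [Finset.sum_insert hxL, ← hadj]
    have e0 : y x m * geom y (insert x L) m * (y x m * y z m) = 0 := by
      rw [← mul_assoc, hy.absorb, zero_mul]
    have e1 : geom y (insert x L) m * y x m = geom y L m * y x m := hy.geom_insert_mul hxL m m
    have e2 : y x m * y z m * geom y (insert x L) m = y x m * y z m * geom y L m :=
      hy.mul_geom_insert hxL m m _
    rw [e0, zero_mul, zero_mul, zero_add, e2, mul_assoc (y z m), e1, ← mul_assoc (y z m)]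
    congr 1
    refine Finset.sum_congr rfl fun a _ => ?_
    rw [mul_assoc (y a m * _), e2, mul_assoc (y a m), ← mul_assoc (geom y (insert x L) m),
      ← mul_assoc (geom y (insert x L) m), e1]
    simp only [mul_assoc]

/-- The cyclic relation: all words that start and end with the same letter and whose other letters
are distinct sum up to zero. -/
theorem sum_mul_geom_mul_eq_zero (hy : IsDressed y) {K : Finset ι} {m : ι} (hm : m ∉ K) :
    ∑ a ∈ K, y a m * geom y K m * y m a = 0 := by
  induction K using Finset.induction_on with
  | empty => simp
  | insert x K hx ih =>
    simp only [Finset.mem_insert, not_or] at hm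
    have hlin := hy.cyclicPart_eq_zero K hm.2 hx hm.1
    rw [cyclicPart] at hlin
    have hmul := hy.mul_geom_insert hx m m 1
    rw [mul_one] at hmul
    rw [Finset.sum_insert hx, hmul, hy.geom_insert hx]
    simp only [mul_add, add_mul, Finset.sum_add_distrib]
    rw [ih hm.2, zero_add, ← hlin]
    simp only [mul_assoc]

theorem commute_geom_geom (hy : IsDressed y) {K : Finset ι} {b c : ι} (hb : b ∉ K) (hc : c ∉ K)
    (hbc : b ≠ c) : Commute (geom y K b) (geom y K c) :=
  hy.commute_geom fun _ ha => (hy.commute_geom fun _ ha' =>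
    hy.commute_of_ne (ne_of_mem_of_not_mem ha hb) (ne_of_mem_of_not_mem ha' hc).symm hbc.symm).symm

theorem geomProd_insert (hy : IsDressed y) {J : List ι} {K : Finset ι} {x : ι} (hJ : J.Nodup)
    (hJK : ∀ b ∈ J, b ∉ K) (hxK : x ∉ K) (hxJ : x ∉ J) :
    geomProd y J (insert x K) = geomProd y J K
      + ∑ b ∈ J.toFinset, geomProd y J K * y x b * geom y K b := by
  induction J with
  | nil => simp [geomProd]
  | cons b J ih =>
    have cons_eq : ∀ L, geomProd y (b :: J) L = geom y L b * geomProd y J L := fun L => by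
      simp [geomProd]
    rw [List.nodup_cons] at hJ
    simp only [List.mem_cons, not_or, forall_eq_or_imp] at hJK hxJ
    rw [cons_eq, cons_eq, ih hJ.2 hJK.2 hxJ.2, hy.geom_insert hxK, List.toFinset_cons,
      Finset.sum_insert (by simpa using hJ.1)]
    have hne : ∀ c ∈ J, b ≠ c := fun c hc h => hJ.1 (h ▸ hc)
    have c1 : Commute (geom y K b) (geomProd y J K) := commute_geomProd fun c hc =>
      hy.commute_geom_geom hJK.1 (hJK.2 c hc) (hne c hc)
    have c2 : Commute (y x b) (geomProd y J K) := commute_geomProd fun c hc =>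
      hy.commute_geom fun a ha => hy.commute_of_ne (fun h => hxJ.2 (h ▸ hc))
        (ne_of_mem_of_not_mem ha hJK.1).symm (hne c hc)
    have e0 : y x b * geom y K b * ∑ c ∈ J.toFinset, geomProd y J K * y x c * geom y K c = 0 := by
      rw [Finset.mul_sum]
      refine Finset.sum_eq_zero fun c _ => ?_
      have := hy.absorb x b c (geom y K b * geomProd y J K)
      calc _ = y x b * (geom y K b * geomProd y J K) * y x c * geom y K c := by noncomm_ring
        _ = 0 := by rw [this, zero_mul]
    have e1 : ∑ c ∈ J.toFinset, geom y K b * geomProd y J K * y x c * geom y K c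
        = geom y K b * ∑ c ∈ J.toFinset, geomProd y J K * y x c * geom y K c := by
      rw [Finset.mul_sum]
      simp only [mul_assoc]
    rw [e1]
    generalize (∑ c ∈ J.toFinset, geomProd y J K * y x c * geom y K c) = s at *
    generalize geomProd y J K = H at *
    generalize geom y K b = G at *
    calc _ = G * H + G * s + G * (y x b * (G * H)) + G * (y x b * G * s) := by noncomm_ring
      _ = G * H + G * s + G * (y x b * H * G) := by rw [e0, c1.eq]; noncomm_ring
      _ = _ := by rw [c2.eq]; noncomm_ring

theorem mul_geom_eq (hy : IsDressed y) {K : Finset ι} {m b : ι} (hm : m ∉ K) (hb : b ∉ K)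
    (hmb : m ≠ b) : y m b * geom y K b
      = geom y K m * y m b + ∑ a ∈ K, geom y K m * y a b * geom y K b * y m a := by
  have hrel : col y K m * y m b + ∑ a ∈ K, y a b * y m a = y m b * col y K b := by
    rw [col, col, Finset.sum_mul, Finset.mul_sum, ← Finset.sum_add_distrib]
    refine Finset.sum_congr rfl fun a ha => ?_
    exact (hy.tri m a b (ne_of_mem_of_not_mem ha hm).symm (ne_of_mem_of_not_mem ha hb)
      hmb.symm).symm ▸ rfl
  have hswap : (∑ a ∈ K, y a b * y m a) * geom y K b
      = ∑ a ∈ K, y a b * geom y K b * y m a := by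
    rw [Finset.sum_mul]
    refine Finset.sum_congr rfl fun a ha => ?_
    obtain ⟨L, haL, rfl⟩ : ∃ L, a ∉ L ∧ insert a L = K :=
      ⟨K.erase a, Finset.notMem_erase a K, Finset.insert_erase ha⟩
    have hab := ne_of_mem_of_not_mem ha hb
    have hc : Commute (y m a) (geom y L b) := hy.commute_geom fun c hc =>
      hy.commute_of_ne hmb (ne_of_mem_of_not_mem hc haL).symm hab
    have hmul := hy.mul_geom_insert haL b b 1
    rw [mul_one] at hmul
    rw [hy.mul_geom_insert haL, hmul, mul_assoc, hc.eq, mul_assoc]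
  simp only [mul_assoc (geom y K m), ← Finset.mul_sum]
  rw [← hswap]
  have hm1 := hy.geom_mul_one_sub_col K m
  have hb1 := hy.one_sub_col_mul_geom K b
  have hrel' : (1 - col y K m) * y m b
      = y m b * (1 - col y K b) + ∑ a ∈ K, y a b * y m a := by
    rw [mul_sub, ← hrel]
    noncomm_ring
  generalize (∑ a ∈ K, y a b * y m a) = s at *
  calc _ = geom y K m * (1 - col y K m) * (y m b * geom y K b) := by rw [hm1, one_mul]
    _ = geom y K m * ((1 - col y K m) * y m b) * geom y K b := by noncomm_ring
    _ = geom y K m * y m b * ((1 - col y K b) * geom y K b)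
          + geom y K m * (s * geom y K b) := by rw [hrel']; noncomm_ring
    _ = _ := by rw [hb1, mul_one]

theorem geomProd_insert_mul (hy : IsDressed y) {J : List ι} {K : Finset ι} {x : ι} (hJ : J.Nodup)
    (hJK : ∀ b ∈ J, b ∉ K) (hxK : x ∉ K) (hxJ : x ∉ J) (c : ι) :
    geomProd y J (insert x K) * y x c = geomProd y J K * y x c := by
  rw [hy.geomProd_insert hJ hJK hxK hxJ, add_mul, Finset.sum_mul, Finset.sum_eq_zero, add_zero]
  intro b _
  have := hy.absorb x b c (geom y K b)
  rw [mul_assoc, mul_assoc, ← mul_assoc (y x b), this, mul_zero]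

theorem geomProd_sub_geomProd_erase_mul (hy : IsDressed y) {J : List ι} {K : Finset ι} {a : ι}
    (hJ : J.Nodup) (hJK : ∀ b ∈ J, b ∉ K) (ha : a ∈ K) (z : S) :
    geomProd y J K * z - geomProd y J (K.erase a) * z
      = ∑ b ∈ J.toFinset, geomProd y J K * y a b * geom y K b * z := by
  obtain ⟨L, haL, rfl⟩ : ∃ L, a ∉ L ∧ insert a L = K :=
    ⟨K.erase a, Finset.notMem_erase a K, Finset.insert_erase ha⟩
  have haJ : a ∉ J := fun h => hJK a h ha
  have hJL : ∀ b ∈ J, b ∉ L := fun b hb h => hJK b hb (Finset.mem_insert_of_mem h)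
  rw [Finset.erase_insert haL, ← sub_mul, ← Finset.sum_mul]
  congr 1
  rw [sub_eq_iff_eq_add', hy.geomProd_insert hJ hJL haL haJ]
  congr 1
  refine Finset.sum_congr rfl fun b _ => ?_
  have hmul := hy.mul_geom_insert haL b b 1
  rw [mul_one] at hmul
  rw [← hy.geomProd_insert hJ hJL haL haJ, hy.geomProd_insert_mul hJ hJL haL haJ, mul_assoc,
    mul_assoc, hmul]

theorem geomProd_insert_eq_concat (hy : IsDressed y) {J : List ι} {K : Finset ι} {m : ι}
    (hJ : J.Nodup) (hJK : ∀ b ∈ J, b ∉ K) (hmK : m ∉ K) (hmJ : m ∉ J) :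
    geomProd y J (insert m K) = geomProd y J K
      + geomProd y (J ++ [m]) K * (∑ b ∈ J.toFinset, y m b + ∑ a ∈ K, y m a)
      - ∑ a ∈ K, geomProd y (J ++ [m]) (K.erase a) * y m a := by
  have hconcat : geomProd y (J ++ [m]) K = geomProd y J K * geom y K m := by simp [geomProd]
  have hnodup : (J ++ [m]).Nodup := by simpa using hJ.concat hmJ
  have hdisj : ∀ b ∈ J ++ [m], b ∉ K := by
    intro b hb
    rcases List.mem_append.mp hb with h | h
    · exact hJK b h
    · rwa [List.mem_singleton.mp h]
  have hset : (J ++ [m]).toFinset = insert m J.toFinset := by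
    ext; simp
  have hdiff : ∑ a ∈ K, (geomProd y (J ++ [m]) K * y m a
        - geomProd y (J ++ [m]) (K.erase a) * y m a)
      = ∑ b ∈ J.toFinset, ∑ a ∈ K, geomProd y (J ++ [m]) K * y a b * geom y K b * y m a := by
    rw [Finset.sum_congr rfl fun a ha => hy.geomProd_sub_geomProd_erase_mul hnodup hdisj ha (y m a),
      Finset.sum_comm, hset, Finset.sum_insert (by simpa using hmJ)]
    have := hy.sum_mul_geom_mul_eq_zero hmK
    simp only [mul_assoc, ← Finset.mul_sum] at this ⊢
    rw [this, mul_zero, zero_add]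
  have hlin : ∑ b ∈ J.toFinset, geomProd y J K * y m b * geom y K b
      = ∑ b ∈ J.toFinset, geomProd y (J ++ [m]) K * y m b
        + ∑ b ∈ J.toFinset, ∑ a ∈ K, geomProd y (J ++ [m]) K * y a b * geom y K b * y m a := by
    rw [← Finset.sum_add_distrib]
    refine Finset.sum_congr rfl fun b hb => ?_
    have hbJ : b ∈ J := by simpa using hb
    rw [mul_assoc, hy.mul_geom_eq hmK (hJK b hbJ) (fun h => hmJ (h ▸ hbJ)), hconcat, mul_add,
      Finset.mul_sum]
    simp only [mul_assoc]
  rw [hy.geomProd_insert hJ hJK hmK hmJ, hlin, ← hdiff, Finset.sum_sub_distrib, mul_add,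
    Finset.mul_sum, Finset.mul_sum]
  abel

end Geom

section Linear

variable [LinearOrder ι]

/-- The product, in increasing order of `a ∈ s`, of the sums of `y a b` over `b ∈ u`. -/
def rowProd (y : ι → ι → S) (s u : Finset ι) : S :=
  (s.sort.map fun a => ∑ b ∈ u, y a b).prod

theorem _root_.Finset.sort_insert_of_forall_lt {s : Finset ι} {m : ι} (h : ∀ x ∈ s, x < m) :
    (insert m s).sort = s.sort ++ [m] := by
  have hm : m ∉ s := fun hm => lt_irrefl _ (h m hm)
  have hnodup : (s.sort ++ [m]).Nodup := by simpa using (s.sort_nodup (· ≤ ·)).concat (by simpa)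
  have hset : (s.sort ++ [m]).toFinset = insert m s := by ext; simp
  rw [← hset, List.toFinset_sort _ hnodup, List.pairwise_append]
  exact ⟨s.pairwise_sort _, List.pairwise_singleton _ _, by simpa using fun a ha => (h a ha).le⟩

theorem rowProd_insert {s u : Finset ι} {m : ι} (h : ∀ x ∈ s, x < m) :
    rowProd y (insert m s) u = rowProd y s u * ∑ b ∈ u, y m b := by
  simp [rowProd, Finset.sort_insert_of_forall_lt h]

/-- Summed over the subsets of `K`, the row products with targets in `J` or in the subset itself
give the product of the geometric series of the columns in `J`. -/
theorem sum_powerset_rowProd (hy : IsDressed y) (K : Finset ι) {J : List ι} (hJ : J.Nodup)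
    (hJK : ∀ b ∈ J, b ∉ K) :
    ∑ s ∈ K.powerset, rowProd y s (s ∪ J.toFinset) = geomProd y J K := by
  induction K using Finset.strongInduction generalizing J with
  | H K ih =>
  rcases K.eq_empty_or_nonempty with rfl | hne
  · have : geom y ∅ = fun _ => 1 := funext fun b => by simp [geom, col]
    simp [rowProd, geomProd, this]
  · obtain ⟨m, K, hlt, rfl⟩ : ∃ m L, (∀ x ∈ L, x < m) ∧ insert m L = K :=
      ⟨K.max' hne, K.erase (K.max' hne), fun x hx => K.lt_max'_of_mem_erase_max' hne hx,
        Finset.insert_erase (K.max'_mem hne)⟩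
    have hmK : m ∉ K := fun h => lt_irrefl _ (hlt m h)
    have hss : K ⊂ insert m K := Finset.ssubset_insert hmK
    simp only [Finset.mem_insert, not_or] at hJK
    have hmJ : m ∉ J := fun h => (hJK m h).1 rfl
    have hJK' : ∀ b ∈ J, b ∉ K := fun b hb => (hJK b hb).2
    have hnodup : (J ++ [m]).Nodup := by simpa using hJ.concat hmJ
    have hdisj : ∀ b ∈ J ++ [m], b ∉ K := by
      intro b hb
      rcases List.mem_append.mp hb with h | h
      · exact hJK' b h
      · rwa [List.mem_singleton.mp h]
    have hset : ∀ s : Finset ι, insert m s ∪ J.toFinset = s ∪ (J ++ [m]).toFinset := by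
      intro s; ext; simp
    have hrow : ∀ s ∈ K.powerset, rowProd y (insert m s) (insert m s ∪ J.toFinset)
        = rowProd y s (s ∪ (J ++ [m]).toFinset) * (∑ b ∈ J.toFinset, y m b + ∑ a ∈ K, y m a)
          - ∑ a ∈ K \ s, rowProd y s (s ∪ (J ++ [m]).toFinset) * y m a := by
      intro s hs
      rw [Finset.mem_powerset] at hs
      rw [rowProd_insert fun x hx => hlt x (hs hx), ← hset, ← Finset.mul_sum, ← mul_sub]
      congr 1
      have hms : m ∉ s ∪ J.toFinset := by simpa using ⟨fun h => hmK (hs h), hmJ⟩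
      have hsJ : Disjoint s J.toFinset := Finset.disjoint_left.mpr fun a ha haJ =>
        hJK' a (by simpa using haJ) (hs ha)
      rw [Finset.insert_union, Finset.sum_insert hms, hy.diag, zero_add, Finset.sum_union hsJ,
        ← Finset.sum_sdiff hs]
      abel
    rw [Finset.sum_powerset_insert hmK, ih K hss hJ hJK', Finset.sum_congr rfl hrow,
      Finset.sum_sub_distrib, ← Finset.sum_mul, ih K hss hnodup hdisj,
      hy.geomProd_insert_eq_concat hJ hJK' hmK hmJ, add_sub_assoc]
    congr 2
    rw [Finset.sum_comm' (t' := K) (s' := fun a => (K.erase a).powerset)]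
    · refine Finset.sum_congr rfl fun a _ => ?_
      rw [← Finset.sum_mul, ih _ ((K.erase_subset a).trans_ssubset hss) hnodup
        fun b hb h => hdisj b hb (Finset.mem_of_mem_erase h)]
    · intro s a
      simp only [Finset.mem_powerset, Finset.mem_sdiff, Finset.subset_erase]
      tauto

theorem rowProd_self_eq_zero (hy : IsDressed y) {K : Finset ι} (hK : K.Nonempty) :
    rowProd y K K = 0 := by
  induction K using Finset.strongInduction with
  | H K ih =>
    have hsum := hy.sum_powerset_rowProd K (J := []) List.nodup_nil (by simp)
    simp only [List.toFinset_nil, Finset.union_empty] at hsum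
    rw [← Finset.sum_subset (s₁ := {∅, K}), Finset.sum_pair hK.ne_empty.symm] at hsum
    · simpa [rowProd, geomProd] using hsum
    · simp [Finset.insert_subset_iff]
    · intro s hs hs'
      simp only [Finset.mem_insert, Finset.mem_singleton, not_or] at hs'
      exact ih s ((Finset.mem_powerset.mp hs).ssubset_of_ne hs'.2)
        (Finset.nonempty_iff_ne_empty.mpr hs'.1)

end Linear

end IsDressed

theorem ExteriorAlgebra.ι_mul_mul_ι {A M : Type*} [CommRing A] [AddCommGroup M] [Module A M]
    (v : M) (z : ExteriorAlgebra A M) : ι A v * z * ι A v = 0 := by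
  suffices h : ∃ w, ι A v * z = w * ι A v by
    obtain ⟨w, hw⟩ := h
    rw [hw, mul_assoc, ι_sq_zero, mul_zero]
  induction z using ExteriorAlgebra.induction with
  | algebraMap r => exact ⟨_, (Algebra.commutes r _).symm⟩
  | ι x => exact ⟨-ι A x, by rw [neg_mul, eq_neg_iff_add_eq_zero, ι_add_mul_swap]⟩
  | mul a b ha hb =>
    obtain ⟨a', ha⟩ := ha
    obtain ⟨b', hb⟩ := hb
    exact ⟨a' * b', by rw [← mul_assoc, ha, mul_assoc, hb, mul_assoc]⟩
  | add a b ha hb =>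
    obtain ⟨a', ha⟩ := ha
    obtain ⟨b', hb⟩ := hb
    exact ⟨a' + b', by rw [mul_add, ha, hb, add_mul]⟩

/-- Tensoring with the top exterior power of the standard basis is injective. -/
theorem ExteriorAlgebra.tmul_prod_ι_single_injective (R : Type*) [Ring R] (n : ℕ) :
    Function.Injective fun r : R =>
      r ⊗ₜ[ℤ] (List.ofFn fun i : Fin n => ι ℤ (Pi.single i 1 : Fin n → ℤ)).prod := by
  let top : ExteriorAlgebra ℤ (Fin n → ℤ) →ₗ[ℤ] ℤ := liftAlternating fun i =>
    if h : n = i then h ▸ Matrix.detRowAlternating else 0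
  have htop : top (List.ofFn fun i : Fin n => ι ℤ (Pi.single i 1 : Fin n → ℤ)).prod = 1 := by
    rw [← ιMulti_apply, liftAlternating_apply_ιMulti]
    simp only [dite_true]
    exact (congrArg Matrix.det (by ext i j; simp [Matrix.one_apply, Pi.single_apply, eq_comm])).trans
      Matrix.det_one
  intro r s h
  simpa [htop] using congrArg (fun z => TensorProduct.rid ℤ R (top.lTensor R z)) h

theorem List.prod_map_tmul {ι R A : Type*} [Ring R] [Ring A] (l : List ι) (r : ι → R)
    (ξ : ι → A) :
    (l.map fun i => r i ⊗ₜ[ℤ] ξ i).prod = (l.map r).prod ⊗ₜ[ℤ] (l.map ξ).prod := by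
  induction l with
  | nil => simp [Algebra.TensorProduct.one_def]
  | cons i l ih => simp [ih]

theorem isDressed_tmul {ι R A : Type*} [Ring R] [Ring A] {e : ι → ι → R} {ξ : ι → A}
    (hdiag : ∀ a, e a a = 0) (hsymm : ∀ a b, e a b = e b a) (hsq : ∀ a b, e a b * e a b = 0)
    (hdisj : ∀ a b c d, a ≠ c → a ≠ d → b ≠ c → b ≠ d → e a b * e c d + e c d * e a b = 0)
    (htri : ∀ a b c, a ≠ b → b ≠ c → c ≠ a →
      e a b * e b c + e b c * e c a + e c a * e a b = 0)
    (hξ : ∀ a z, ξ a * z * ξ a = 0) (hanti : ∀ a b, ξ a * ξ b = -(ξ b * ξ a)) :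
    IsDressed fun a b => e a b ⊗ₜ[ℤ] ξ a where
  diag a := by simp [hdiag]
  absorb a b c z := by
    induction z using TensorProduct.induction_on with
    | zero => simp
    | tmul r z => simp [hξ]
    | add z w hz hw => rw [mul_add, add_mul, hz, hw, add_zero]
  opp a b := by
    rw [hsymm b a, Algebra.TensorProduct.tmul_mul_tmul, hsq, TensorProduct.zero_tmul]
  comm a b c d hac had hbc hbd := by
    rw [Commute, SemiconjBy, Algebra.TensorProduct.tmul_mul_tmul,
      Algebra.TensorProduct.tmul_mul_tmul, hanti c a,
      eq_neg_of_add_eq_zero_left (hdisj a b c d hac had hbc hbd), TensorProduct.neg_tmul,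
      TensorProduct.tmul_neg]
  tri a b c hab hbc hca := by
    have h : e a c * e b c = -(e b a * e a c) + -(e b c * e a b) := by
      have h := htri b a c hab.symm hca.symm hbc.symm
      rw [hsymm c b, hsymm b a] at h
      rw [hsymm b a, ← sub_eq_zero, ← h]
      abel
    simp only [Algebra.TensorProduct.tmul_mul_tmul]
    rw [hanti b a, h]
    simp only [TensorProduct.add_tmul, TensorProduct.neg_tmul, TensorProduct.tmul_neg]

/-- Lemma 5.3 of Kirillov–Maeno: `θ_1 θ_2 ⋯ θ_n = 0` in `Λ_quad(A_{n-1})`,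
the product being taken in increasing order of the index. -/
theorem theta_product_vanishes_typeA (n : ℕ) (hn : 1 ≤ n) (R : Type*) [Ring R]
    (e : Fin n → Fin n → R)
    (hsymm : ∀ a b : Fin n, a ≠ b → e a b = e b a)
    (hsq : ∀ a b : Fin n, a ≠ b → e a b * e a b = 0)
    (hdisj : ∀ a b c d : Fin n, a ≠ b → c ≠ d → a ≠ c → a ≠ d → b ≠ c → b ≠ d →
      e a b * e c d + e c d * e a b = 0)
    (htri : ∀ a b c : Fin n, a ≠ b → b ≠ c → c ≠ a →
      e a b * e b c + e b c * e c a + e c a * e a b = 0)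
    (θ : Fin n → R)
    (hθ : ∀ i : Fin n, θ i = ∑ j ∈ Finset.univ.filter (fun j => j ≠ i), e i j) :
    (List.ofFn θ).prod = 0 := by
  let e' : Fin n → Fin n → R := fun a b => if a = b then 0 else e a b
  let ξ : Fin n → ExteriorAlgebra ℤ (Fin n → ℤ) := fun i =>
    ExteriorAlgebra.ι ℤ (Pi.single i 1 : Fin n → ℤ)
  have he' : ∀ {a b}, a ≠ b → e' a b = e a b := fun h => if_neg h
  have hdiag : ∀ a, e' a a = 0 := fun a => if_pos rfl
  have hy : IsDressed fun a b => e' a b ⊗ₜ[ℤ] ξ a := by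
    refine isDressed_tmul hdiag (fun a b => ?_) (fun a b => ?_) (fun a b c d hac had hbc hbd => ?_)
      (fun a b c hab hbc hca => ?_) (fun a z => ExteriorAlgebra.ι_mul_mul_ι _ z)
      (fun a b => eq_neg_of_add_eq_zero_left (ExteriorAlgebra.ι_add_mul_swap _ _))
    · rcases eq_or_ne a b with rfl | h
      · rfl
      · rw [he' h, he' h.symm, hsymm a b h]
    · rcases eq_or_ne a b with rfl | h
      · rw [hdiag, zero_mul]
      · rw [he' h, hsq a b h]
    · rcases eq_or_ne a b with rfl | hab
      · simp [hdiag]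
      rcases eq_or_ne c d with rfl | hcd
      · simp [hdiag]
      rw [he' hab, he' hcd, hdisj a b c d hab hcd hac had hbc hbd]
    · rw [he' hab, he' hbc, he' hca, htri a b c hab hbc hca]
  have hrow : ∀ a, ∑ b, e' a b ⊗ₜ[ℤ] ξ a = θ a ⊗ₜ[ℤ] ξ a := fun a => by
    rw [← TensorProduct.sum_tmul, hθ, Finset.sum_filter]
    congr 1
    refine Finset.sum_congr rfl fun b _ => ?_
    rcases eq_or_ne b a with rfl | h
    · simp [hdiag]
    · rw [he' h.symm, if_pos h]
  have hzero := hy.rowProd_self_eq_zero (K := Finset.univ) ⟨⟨0, hn⟩, Finset.mem_univ _⟩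
  simp only [IsDressed.rowProd, hrow, Fin.sort_univ, List.prod_map_tmul] at hzero
  refine ExteriorAlgebra.tmul_prod_ι_single_injective R n ?_
  simp only [List.ofFn_eq_map, TensorProduct.zero_tmul]
  exact hzero
end
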